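/- arXiv:1107.2314 — 4 statements merged into one kernel-verified Lean document; each statement's English description precedes it below -/
import Mathlib

section
/- Let X be a set of 2n points in general position in the plane and let H be a set of exactly n edges of X such that no non-crossing perfect matching of X avoids H (so the graph determined by H is a tree on n+1 vertices). Then for every vertex v of this tree of degree 1 (a leaf), the unique neighbor of v in the tree is an extreme point of the convex hull of X. -/
open MeasureTheory Set Filter

noncomputable section

abbrev Pt : Type := ℝ × ℝ

/-- A finite point set is in general position: no three distinct points are collinear. -/
def GenPos (X : Finset Pt) : Prop :=
  ∀ a ∈ X, ∀ b ∈ X, ∀ c ∈ X, a ≠ b → a ≠ c → b ≠ c → ¬ Collinear ℝ ({a, b, c} : Set Pt)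

/-- `e` is an edge of `X`: an unordered pair of distinct points of `X`. -/
def IsEdgeOf (X : Finset Pt) (e : Sym2 Pt) : Prop :=
  ¬ e.IsDiag ∧ ∀ p ∈ e, p ∈ X

/-- The closed segment joining the two points of an unordered pair. -/
def edgeSeg (e : Sym2 Pt) : Set Pt :=
  Sym2.lift ⟨fun u v => segment ℝ u v, fun u v => segment_symm ℝ u v⟩ e

/-- `M` is a non-crossing perfect matching of `X`: a partition of `X` into unordered pairs
whose closed segments are pairwise disjoint. -/
def IsNCMatching (X : Finset Pt) (M : Finset (Sym2 Pt)) : Prop :=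
  (∀ e ∈ M, IsEdgeOf X e) ∧
  (∀ p ∈ X, ∃! e, e ∈ M ∧ p ∈ e) ∧
  (M : Set (Sym2 Pt)).Pairwise fun e f => Disjoint (edgeSeg e) (edgeSeg f)

/-- The matching `M` avoids the edge set `S`. -/
def Avoids (M S : Finset (Sym2 Pt)) : Prop := ∀ e ∈ M, e ∉ S

/-- `Y` has a non-crossing perfect matching inside the region `K` that avoids `H`. -/
def MatchableIn (H : Finset (Sym2 Pt)) (Y : Finset Pt) (K : Set Pt) : Prop :=
  ∃ M, IsNCMatching Y M ∧ Avoids M H ∧ ∀ e ∈ M, edgeSeg e ⊆ K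

lemma MatchableIn.union {H : Finset (Sym2 Pt)} {Y Z : Finset Pt} {K J : Set Pt}
    (hY : MatchableIn H Y K) (hZ : MatchableIn H Z J) (hYZ : Disjoint Y Z) (hKJ : Disjoint K J) :
    MatchableIn H (Y ∪ Z) (K ∪ J) := by
  classical
  obtain ⟨M, ⟨hM, hM', hM''⟩, hMH, hMK⟩ := hY
  obtain ⟨N, ⟨hN, hN', hN''⟩, hNH, hNJ⟩ := hZ
  rw [Finset.disjoint_left] at hYZ
  refine ⟨M ∪ N, ⟨?_, ?_, ?_⟩, ?_, ?_⟩
  · intro e he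
    rcases Finset.mem_union.1 he with he | he
    · exact ⟨(hM e he).1, fun p hp => Finset.mem_union_left _ ((hM e he).2 p hp)⟩
    · exact ⟨(hN e he).1, fun p hp => Finset.mem_union_right _ ((hN e he).2 p hp)⟩
  · intro p hp
    rcases Finset.mem_union.1 hp with hp | hp
    · obtain ⟨e, ⟨he, hpe⟩, huniq⟩ := hM' p hp
      refine ⟨e, ⟨Finset.mem_union_left _ he, hpe⟩, ?_⟩
      rintro f ⟨hf, hpf⟩
      rcases Finset.mem_union.1 hf with hf | hf
      · exact huniq f ⟨hf, hpf⟩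
      · exact absurd ((hN f hf).2 p hpf) (hYZ hp)
    · obtain ⟨e, ⟨he, hpe⟩, huniq⟩ := hN' p hp
      refine ⟨e, ⟨Finset.mem_union_right _ he, hpe⟩, ?_⟩
      rintro f ⟨hf, hpf⟩
      rcases Finset.mem_union.1 hf with hf | hf
      · exact absurd hp (hYZ ((hM f hf).2 p hpf))
      · exact huniq f ⟨hf, hpf⟩
  · intro e he f hf hef
    rcases Finset.mem_union.1 he with he | he <;> rcases Finset.mem_union.1 hf with hf | hf
    · exact hM'' he hf hef
    · exact hKJ.mono (hMK e he) (hNJ f hf)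
    · exact (hKJ.mono (hMK f hf) (hNJ e he)).symm
    · exact hN'' he hf hef
  · intro e he
    rcases Finset.mem_union.1 he with he | he
    exacts [hMH e he, hNH e he]
  · intro e he
    rcases Finset.mem_union.1 he with he | he
    exacts [(hMK e he).trans subset_union_left, (hNJ e he).trans subset_union_right]

/-- The Euclidean distance, as opposed to the sup distance that `ℝ × ℝ` carries. -/
def euclidDist (p q : Pt) : ℝ :=
  dist (Complex.equivRealProdLm.symm p) (Complex.equivRealProdLm.symm q)

lemma euclidDist_comm (p q : Pt) : euclidDist p q = euclidDist q p := dist_comm _ _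

lemma euclidDist_triangle (p q r : Pt) :
    euclidDist p r ≤ euclidDist p q + euclidDist q r := dist_triangle _ _ _

lemma euclidDist_add_eq_iff (p q r : Pt) :
    euclidDist p q + euclidDist q r = euclidDist p r ↔ Wbtw ℝ p q r := by
  unfold euclidDist
  rw [dist_add_dist_eq_iff]
  exact Function.Injective.wbtw_map_iff
    (f := (Complex.equivRealProdLm.symm : Pt →ₗ[ℝ] ℂ).toAffineMap)
    Complex.equivRealProdLm.symm.injective

lemma GenPos.subset {X Y : Finset Pt} (hX : GenPos X) (hYX : Y ⊆ X) : GenPos Y :=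
  fun a ha b hb c hc => hX a (hYX ha) b (hYX hb) c (hYX hc)

/-- Uncrossing two segments strictly decreases the total length. -/
lemma GenPos.uncross {X : Finset Pt} (hX : GenPos X) {a b c d : Pt}
    (ha : a ∈ X) (hb : b ∈ X) (hc : c ∈ X) (hd : d ∈ X)
    (hab : a ≠ b) (hac : a ≠ c) (had : a ≠ d) (hbd : b ≠ d) (hcd : c ≠ d)
    {x : Pt} (hxab : x ∈ segment ℝ a b) (hxcd : x ∈ segment ℝ c d) :
    euclidDist a d + euclidDist c b < euclidDist a b + euclidDist c d := by
  rw [mem_segment_iff_wbtw] at hxab hxcd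
  have h1 := (euclidDist_add_eq_iff _ _ _).2 hxab
  have h2 := (euclidDist_add_eq_iff _ _ _).2 hxcd
  have h3 := euclidDist_triangle a x d
  have h4 := euclidDist_triangle c x b
  by_contra! hlt
  have h5 : Wbtw ℝ a x d := (euclidDist_add_eq_iff _ _ _).1 (by linarith)
  have hxa : x ≠ a := by
    rintro rfl
    exact hX c hc x ha d hd hac.symm hcd had hxcd.collinear
  have hc1 := hxab.collinear
  have hc2 := h5.collinear
  have : Collinear ℝ ({x, b, a, d} : Set Pt) := by
    have e1 : b ∈ line[ℝ, a, x] := by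
      apply hc1.mem_affineSpan_of_mem_of_ne (p₁ := a) (p₂ := x) <;> simp [hxa.symm]
    have e2 : d ∈ line[ℝ, a, x] := by
      apply hc2.mem_affineSpan_of_mem_of_ne (p₁ := a) (p₂ := x) <;> simp [hxa.symm]
    have := collinear_insert_insert_of_mem_affineSpan_pair e1 e2
    refine this.subset ?_
    intro y; simp only [mem_insert_iff, mem_singleton_iff]; tauto
  refine hX a ha b hb d hd hab had hbd (this.subset ?_)
  intro y; simp only [mem_insert_iff, mem_singleton_iff]; tauto

/-- A balanced two-colored set in general position has a non-crossing perfect matching all of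
whose edges join points of different colors. -/
lemma GenPos.exists_bichromatic_matching {Y : Finset Pt} (hY : GenPos Y) (R B : Finset Pt)
    (hRB : Disjoint R B) (hYRB : Y = R ∪ B) (hcard : R.card = B.card) :
    ∃ M, IsNCMatching Y M ∧ ∀ e ∈ M, ∃ a ∈ R, ∃ b ∈ B, e = s(a, b) := by
  classical
  subst hYRB
  have hne : Nonempty (R ≃ B) := ⟨Finset.equivOfCardEq hcard⟩
  obtain ⟨σ, hσ⟩ := Finite.exists_min (fun σ : R ≃ B => ∑ a, euclidDist a.1 (σ a).1)
  have hdist : ∀ (a : R) (b : B), a.1 ≠ b.1 := fun a b h =>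
    Finset.disjoint_left.1 hRB a.2 (h ▸ b.2)
  have hR : ∀ a : R, a.1 ∈ R ∪ B := fun a => Finset.mem_union_left _ a.2
  have hB : ∀ a : B, a.1 ∈ R ∪ B := fun a => Finset.mem_union_right _ a.2
  refine ⟨Finset.univ.image fun a : R => s(a.1, (σ a).1), ⟨?_, ?_, ?_⟩, ?_⟩
  · intro e he
    obtain ⟨a, -, rfl⟩ := Finset.mem_image.1 he
    refine ⟨by simpa using hdist a (σ a), ?_⟩
    intro p hp
    rcases Sym2.mem_iff.1 hp with rfl | rfl
    exacts [hR a, hB _]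
  · intro p hp
    rcases Finset.mem_union.1 hp with hp | hp
    · refine ⟨s(p, (σ ⟨p, hp⟩).1),
        ⟨Finset.mem_image.2 ⟨⟨p, hp⟩, Finset.mem_univ _, rfl⟩, by simp⟩, ?_⟩
      rintro f ⟨hf, hpf⟩
      obtain ⟨a, -, rfl⟩ := Finset.mem_image.1 hf
      rcases Sym2.mem_iff.1 hpf with rfl | h
      · rfl
      · exact absurd h (hdist ⟨p, hp⟩ _)
    · refine ⟨s((σ.symm ⟨p, hp⟩).1, p),
        ⟨Finset.mem_image.2 ⟨σ.symm ⟨p, hp⟩, Finset.mem_univ _, by simp⟩, by simp⟩, ?_⟩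
      rintro f ⟨hf, hpf⟩
      obtain ⟨a, -, rfl⟩ := Finset.mem_image.1 hf
      rcases Sym2.mem_iff.1 hpf with h | rfl
      · exact absurd h.symm (hdist a ⟨p, hp⟩)
      · simp
  · intro e he f hf hef
    obtain ⟨a, -, rfl⟩ := Finset.mem_image.1 he
    obtain ⟨c, -, rfl⟩ := Finset.mem_image.1 hf
    have hac : a ≠ c := by rintro rfl; exact hef rfl
    rw [Set.disjoint_left]
    intro x hx hx'
    have hlt := hY.uncross (hR a) (hB (σ a)) (hR c) (hB (σ c)) (hdist _ _)
      (fun h => hac (Subtype.ext h)) (hdist _ _)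
      (fun h => hac (σ.injective (Subtype.ext h))) (hdist _ _) hx hx'
    have hmin := hσ ((Equiv.swap a c).trans σ)
    have hc' : c ∈ Finset.univ.erase a := by simp [hac.symm]
    rw [← Finset.add_sum_erase _ _ (Finset.mem_univ a), ← Finset.add_sum_erase _ _ hc',
      ← Finset.add_sum_erase _ _ (Finset.mem_univ a), ← Finset.add_sum_erase _ _ hc'] at hmin
    have heq : ∑ x ∈ (Finset.univ.erase a).erase c,
        euclidDist x.1 (((Equiv.swap a c).trans σ) x).1 =
        ∑ x ∈ (Finset.univ.erase a).erase c, euclidDist x.1 (σ x).1 := by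
      refine Finset.sum_congr rfl fun x hx => ?_
      simp only [Finset.mem_erase] at hx
      rw [Equiv.trans_apply, Equiv.swap_apply_of_ne_of_ne hx.2.1 hx.1]
    rw [heq] at hmin
    simp only [Equiv.trans_apply, Equiv.swap_apply_left, Equiv.swap_apply_right] at hmin
    linarith
  · intro e he
    obtain ⟨a, -, rfl⟩ := Finset.mem_image.1 he
    exact ⟨a, a.2, σ a, (σ a).2, rfl⟩

lemma edgeSeg_subset_convexHull {Y : Finset Pt} {e : Sym2 Pt} (he : IsEdgeOf Y e) :
    edgeSeg e ⊆ convexHull ℝ (Y : Set Pt) := by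
  induction e with
  | _ a b =>
    exact segment_subset_convexHull (he.2 a (by simp)) (he.2 b (by simp))

/-- The two color classes of a `±1`-coloring with zero total are equally large. -/
lemma card_filter_eq_of_sum_eq_zero {Y : Finset Pt} {w : Pt → ℤ}
    (hw : ∀ p, w p = 1 ∨ w p = -1) (hsum : ∑ p ∈ Y, w p = 0) :
    (Y.filter (fun p => w p = 1)).card = (Y.filter (fun p => ¬ w p = 1)).card := by
  have h1 : ∑ p ∈ Y.filter (fun p => w p = 1), w p = (Y.filter (fun p => w p = 1)).card := by
    rw [Finset.sum_congr rfl (fun p hp => (Finset.mem_filter.1 hp).2)]; simp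
  have h2 : ∑ p ∈ Y.filter (fun p => ¬ w p = 1), w p =
      -(Y.filter (fun p => ¬ w p = 1)).card := by
    rw [Finset.sum_congr rfl
      (fun p hp => (hw p).resolve_left (Finset.mem_filter.1 hp).2)]; simp
  rw [← Finset.sum_filter_add_sum_filter_not Y (fun p => w p = 1), h1, h2] at hsum
  omega

/-- A `±1`-coloring with zero total for which the edges of `H` are monochromatic yields a
non-crossing perfect matching that avoids `H`. -/
lemma GenPos.matchableIn_of_coloring {Y : Finset Pt} (hY : GenPos Y) {H : Finset (Sym2 Pt)}
    {w : Pt → ℤ} (hw : ∀ p, w p = 1 ∨ w p = -1) (hsum : ∑ p ∈ Y, w p = 0)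
    (hmono : ∀ a ∈ Y, ∀ b ∈ Y, s(a, b) ∈ H → w a = w b) :
    MatchableIn H Y (convexHull ℝ (Y : Set Pt)) := by
  classical
  have hcard := card_filter_eq_of_sum_eq_zero hw hsum
  obtain ⟨M, hM, hMe⟩ := hY.exists_bichromatic_matching _ _
    (Finset.disjoint_filter_filter_not Y Y (fun p => w p = 1))
    (Finset.filter_union_filter_not_eq _ Y).symm hcard
  refine ⟨M, hM, ?_, fun e he => edgeSeg_subset_convexHull (hM.1 e he)⟩
  intro e he heH
  obtain ⟨a, ha, b, hb, rfl⟩ := hMe e he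
  rw [Finset.mem_filter] at ha hb
  exact hb.2 (hmono a ha.1 b hb.1 heH ▸ ha.2)

/-- Merging the classes of a labeling along `m` edges destroys at most `m` labels. -/
lemma exists_labeling {α : Type*} [DecidableEq α] (X : Finset α) (H : Finset (Sym2 α)) :
    ∃ f : α → α, (∀ a b, s(a, b) ∈ H → f a = f b) ∧ X.card ≤ (X.image f).card + H.card := by
  induction H using Finset.induction_on with
  | empty => exact ⟨id, by simp, by simp⟩
  | insert e H he ih =>
    obtain ⟨f, hf, hcard⟩ := ih
    induction e with
    | _ c d =>
      refine ⟨fun x => if f x = f d then f c else f x, ?_, ?_⟩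
      · intro a b hab
        rcases Finset.mem_insert.1 hab with h | h
        · rcases Sym2.eq_iff.1 h with ⟨rfl, rfl⟩ | ⟨rfl, rfl⟩ <;> simp
        · simp [hf a b h]
      · have hsub : (X.image f).erase (f d) ⊆
            X.image fun x => if f x = f d then f c else f x := by
          intro y hy
          simp only [Finset.mem_erase, Finset.mem_image] at hy ⊢
          obtain ⟨hyd, x, hx, rfl⟩ := hy
          exact ⟨x, hx, by simp [hyd]⟩
        have h1 := Finset.card_le_card hsub
        have h2 := Finset.pred_card_le_card_erase (s := X.image f) (a := f d)
        rw [Finset.card_insert_of_notMem he]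
        omega

/-- More than `n` positive integers with sum `2 n` include some with sum `n`. -/
lemma exists_subset_sum_eq {α : Type*} [DecidableEq α] (K : Finset α) (c : α → ℕ) (n : ℕ)
    (hc : ∀ k ∈ K, 0 < c k) (hK : n < K.card) (hsum : ∑ k ∈ K, c k = 2 * n) :
    ∃ S ⊆ K, ∑ k ∈ S, c k = n := by
  have hn : 0 < n := by
    rcases Nat.eq_zero_or_pos n with rfl | h
    · obtain ⟨k, hk⟩ := Finset.card_pos.1 hK
      have := Finset.single_le_sum (fun i _ => Nat.zero_le (c i)) hk
      have := hc k hk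
      omega
    · exact h
  let g : ℕ → α := fun i => if h : i < K.card then (K.equivFin.symm ⟨i, h⟩ : α) else
    (K.equivFin.symm ⟨0, by omega⟩ : α)
  have hgK : ∀ i, g i ∈ K := by
    intro i
    simp only [g]
    split_ifs <;> exact Subtype.coe_prop _
  have hginj : ∀ i j, i < K.card → j < K.card → g i = g j → i = j := by
    intro i j hi hj h
    simp only [g, hi, hj, dif_pos] at h
    simpa using K.equivFin.symm.injective (Subtype.ext h)
  obtain ⟨i, hi, j, hj, hij, heq⟩ : ∃ i ∈ Finset.range (n + 1), ∃ j ∈ Finset.range (n + 1),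
      i ≠ j ∧ (∑ k ∈ Finset.range i, c (g k)) % n = (∑ k ∈ Finset.range j, c (g k)) % n :=
    Finset.exists_ne_map_eq_of_card_lt_of_maps_to (t := Finset.range n) (by simp)
      (fun i _ => by simpa using Nat.mod_lt _ hn)
  wlog hlt : i < j generalizing i j
  · exact this j hj i hi hij.symm heq.symm (by omega)
  simp only [Finset.mem_range] at hi hj
  have hsub : (Finset.Ico i j).image g ⊆ K := by
    intro x hx
    obtain ⟨k, -, rfl⟩ := Finset.mem_image.1 hx
    exact hgK k
  have himg : ∑ x ∈ (Finset.Ico i j).image g, c x = ∑ k ∈ Finset.Ico i j, c (g k) := by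
    refine Finset.sum_image ?_
    intro a ha b hb hab
    simp only [Finset.coe_Ico, Set.mem_Ico] at ha hb
    exact hginj a b (by omega) (by omega) hab
  refine ⟨_, hsub, ?_⟩
  have hadd := Finset.sum_range_add_sum_Ico (fun k => c (g k)) hlt.le
  have hdvd : n ∣ ∑ k ∈ Finset.Ico i j, c (g k) := by
    have := (Nat.modEq_iff_dvd' (by omega)).1 (show _ ≡ _ [MOD n] from heq)
    rwa [← hadd, Nat.add_sub_cancel_left] at this
  have hpos : 0 < ∑ k ∈ Finset.Ico i j, c (g k) :=
    Finset.sum_pos (fun k _ => hc _ (hgK k)) ⟨i, by simp [hlt]⟩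
  have hltsum : ∑ x ∈ (Finset.Ico i j).image g, c x < ∑ k ∈ K, c k := by
    have hss : ∃ y ∈ K, y ∉ (Finset.Ico i j).image g := by
      by_contra! h
      have h1 := Finset.card_le_card (show K ⊆ (Finset.Ico i j).image g from h)
      have h2 := Finset.card_image_le (s := Finset.Ico i j) (f := g)
      rw [Nat.card_Ico] at h2
      omega
    obtain ⟨y, hy, hy'⟩ := hss
    exact Finset.sum_lt_sum_of_subset hsub hy hy' (hc y hy) (fun _ _ _ => Nat.zero_le _)
  rw [himg] at hltsum ⊢
  obtain ⟨q, hq⟩ := hdvd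
  rw [hq] at hpos hltsum ⊢
  rw [hsum, mul_comm 2 n] at hltsum
  have h1 : q < 2 := lt_of_mul_lt_mul_left hltsum (Nat.zero_le n)
  have h2 : 0 < q := Nat.pos_of_mul_pos_left hpos
  obtain rfl : q = 1 := by omega
  simp

/-- Fewer than `n` edges on `2 n` points leave a balanced coloring without bichromatic edges. -/
lemma exists_balanced_coloring {α : Type*} [DecidableEq α] (X : Finset α) (H : Finset (Sym2 α))
    (n : ℕ) (hX : X.card = 2 * n) (hH : H.card < n) :
    ∃ w : α → ℤ, (∀ p, w p = 1 ∨ w p = -1) ∧ ∑ p ∈ X, w p = 0 ∧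
      ∀ a b, s(a, b) ∈ H → w a = w b := by
  obtain ⟨f, hf, hcard⟩ := exists_labeling X H
  obtain ⟨S, hSK, hS⟩ := exists_subset_sum_eq (X.image f)
    (fun k => (X.filter (fun x => f x = k)).card) n
    (fun k hk => by
      obtain ⟨x, hx, rfl⟩ := Finset.mem_image.1 hk
      exact Finset.card_pos.2 ⟨x, by simp [hx]⟩)
    (by omega)
    (by rw [← hX]; exact (Finset.card_eq_sum_card_image f X).symm)
  refine ⟨fun x => if f x ∈ S then 1 else -1, ?_, ?_, ?_⟩
  · intro p; dsimp only; split_ifs <;> simp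
  · have h1 : (X.filter (fun x => f x ∈ S)).card = n := by
      rw [← hS]
      rw [Finset.card_eq_sum_card_fiberwise (f := f) (t := S)
        (fun x hx => by simpa using (Finset.mem_filter.1 hx).2)]
      refine Finset.sum_congr rfl fun k hk => ?_
      rw [Finset.filter_filter]
      congr 1
      ext x
      simp only [Finset.mem_filter]
      constructor
      · rintro ⟨h, -, h'⟩; exact ⟨h, h'⟩
      · rintro ⟨h, h'⟩; exact ⟨h, h' ▸ hk, h'⟩
    have h2 := Finset.card_filter_add_card_filter_not (s := X) (fun x => f x ∈ S)
    rw [Finset.sum_ite]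
    simp only [Finset.sum_const, nsmul_eq_mul]
    have h3 : (X.filter (fun x => ¬ f x ∈ S)).card = n := by omega
    rw [h1, h3]; ring
  · intro a b hab; simp [hf a b hab]

/-- Fewer than `n` edges cannot block `2 n` points. -/
lemma GenPos.matchableIn_of_card_lt {Y : Finset Pt} (hY : GenPos Y) {H : Finset (Sym2 Pt)}
    (n : ℕ) (hcard : Y.card = 2 * n) (hH : (H ∩ Y.sym2).card < n) :
    MatchableIn H Y (convexHull ℝ (Y : Set Pt)) := by
  classical
  obtain ⟨w, hw, hsum, hmono⟩ := exists_balanced_coloring Y _ n hcard hH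
  refine hY.matchableIn_of_coloring hw hsum fun a ha b hb hab => hmono a b ?_
  simp [hab, ha, hb]

/-- `φ` is an affine function on the plane. -/
def IsAff (φ : Pt → ℝ) : Prop :=
  ∀ x y : Pt, ∀ a b : ℝ, a + b = 1 → φ (a • x + b • y) = a * φ x + b * φ y

/-- Twice the signed area of the triangle `a b c`. -/
def ori (a b c : Pt) : ℝ := (b.1 - a.1) * (c.2 - a.2) - (b.2 - a.2) * (c.1 - a.1)

lemma ori_swap (a b c : Pt) : ori a c b = -ori a b c := by unfold ori; ring

lemma ori_left (a b : Pt) : ori a b a = 0 := by unfold ori; ring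

lemma ori_right (a b : Pt) : ori a b b = 0 := by unfold ori; ring

/-- The three-term Grassmann–Plücker relation. -/
lemma ori_plucker (u a b c d : Pt) :
    ori u a b * ori u c d = ori u a c * ori u b d - ori u a d * ori u b c := by
  unfold ori; ring

lemma isAff_ori (a b : Pt) (ε : ℝ) : IsAff fun p => ε * ori a b p := by
  intro x y s t hst
  obtain rfl : s = 1 - t := by linarith
  simp only [ori, Prod.fst_add, Prod.snd_add, Prod.smul_fst, Prod.smul_snd, smul_eq_mul]
  ring

lemma IsAff.add {φ ψ : Pt → ℝ} (hφ : IsAff φ) (hψ : IsAff ψ) : IsAff fun p => φ p + ψ p := by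
  intro x y s t hst
  simp only [hφ x y s t hst, hψ x y s t hst]; ring

lemma IsAff.const_mul {φ : Pt → ℝ} (hφ : IsAff φ) (c : ℝ) : IsAff fun p => c * φ p := by
  intro x y s t hst
  simp only [hφ x y s t hst]; ring

lemma IsAff.neg {φ : Pt → ℝ} (hφ : IsAff φ) : IsAff fun p => -φ p := by
  intro x y s t hst
  simp only [hφ x y s t hst]; ring

lemma GenPos.ori_ne_zero {X : Finset Pt} (hX : GenPos X) {a b c : Pt} (ha : a ∈ X) (hb : b ∈ X)
    (hc : c ∈ X) (hab : a ≠ b) (hac : a ≠ c) (hbc : b ≠ c) : ori a b c ≠ 0 := by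
  intro h
  refine hX a ha b hb c hc hab hac hbc ?_
  rw [collinear_iff_of_mem (p₀ := a) (by simp)]
  refine ⟨b - a, ?_⟩
  have hba : b - a ≠ 0 := sub_ne_zero.2 hab.symm
  intro p hp
  rcases hp with rfl | rfl | rfl
  · exact ⟨0, by simp⟩
  · exact ⟨1, by simp⟩
  · unfold ori at h
    by_cases h1 : b.1 - a.1 = 0
    · have h2 : b.2 - a.2 ≠ 0 := fun h2 => hba (Prod.ext h1 h2)
      refine ⟨(p.2 - a.2) / (b.2 - a.2), Prod.ext ?_ ?_⟩
      · simp only [vadd_eq_add, Prod.fst_add, Prod.smul_fst, Prod.fst_sub, smul_eq_mul]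
        field_simp
        linarith
      · simp only [vadd_eq_add, Prod.snd_add, Prod.smul_snd, Prod.snd_sub, smul_eq_mul]
        field_simp
        ring
    · refine ⟨(p.1 - a.1) / (b.1 - a.1), Prod.ext ?_ ?_⟩
      · simp only [vadd_eq_add, Prod.fst_add, Prod.smul_fst, Prod.fst_sub, smul_eq_mul]
        field_simp
        ring
      · simp only [vadd_eq_add, Prod.snd_add, Prod.smul_snd, Prod.snd_sub, smul_eq_mul]
        field_simp
        linarith

lemma IsAff.convex_nonneg {φ : Pt → ℝ} (hφ : IsAff φ) : Convex ℝ {x | 0 ≤ φ x} := by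
  intro x hx y hy s t hs ht hst
  simp only [mem_ofPred_eq] at *
  rw [hφ x y s t hst]; positivity

lemma IsAff.convex_pos {φ : Pt → ℝ} (hφ : IsAff φ) : Convex ℝ {x | 0 < φ x} := by
  intro x hx y hy s t hs ht hst
  simp only [mem_ofPred_eq] at *
  rw [hφ x y s t hst]
  rcases hs.eq_or_lt with rfl | hs
  · obtain rfl : t = 1 := by linarith
    simpa using hy
  · have := mul_pos hs hx
    have := mul_nonneg ht hy.le
    linarith

lemma IsAff.convex_pos_or_eq {φ : Pt → ℝ} (hφ : IsAff φ) {a : Pt} (ha : 0 ≤ φ a) :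
    Convex ℝ {x | 0 < φ x ∨ x = a} := by
  intro x hx y hy s t hs ht hst
  simp only [mem_ofPred_eq] at *
  have hx0 : 0 ≤ φ x := by
    rcases hx with h | rfl
    exacts [h.le, ha]
  have hy0 : 0 ≤ φ y := by
    rcases hy with h | rfl
    exacts [h.le, ha]
  rw [hφ x y s t hst]
  have h1 := mul_nonneg hs hx0
  have h2 := mul_nonneg ht hy0
  rcases hs.eq_or_lt with rfl | hs
  · obtain rfl : t = 1 := by linarith
    simpa using hy
  rcases ht.eq_or_lt with rfl | ht
  · obtain rfl : s = 1 := by linarith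
    simpa using hx
  rcases hx with hx | rfl
  · left; have := mul_pos hs hx; linarith
  rcases hy with hy | rfl
  · left; have := mul_pos ht hy; linarith
  right
  rw [← add_smul, hst, one_smul]

lemma IsAff.disjoint_convexHull {φ : Pt → ℝ} (hφ : IsAff φ) {Y Z : Finset Pt}
    (hY : ∀ p ∈ Y, 0 ≤ φ p) (hZ : ∀ p ∈ Z, φ p < 0) :
    Disjoint (convexHull ℝ (Y : Set Pt)) (convexHull ℝ (Z : Set Pt)) := by
  rw [Set.disjoint_left]
  intro x hx hx'
  have h1 := convexHull_min (t := {x | 0 ≤ φ x}) (fun p hp => hY p hp) hφ.convex_nonneg hx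
  have h2 := convexHull_min (t := {x | 0 < -φ x}) (fun p hp => by simpa using hZ p hp)
    hφ.neg.convex_pos hx'
  simp only [mem_ofPred_eq] at h1 h2
  linarith

/-- Two sets touching a common line in different points are separated by it. -/
lemma IsAff.disjoint_convexHull_of_ne {φ : Pt → ℝ} (hφ : IsAff φ) {Y Z : Finset Pt} {a b : Pt}
    (hab : a ≠ b) (ha : φ a = 0) (hb : φ b = 0)
    (hY : ∀ p ∈ Y, p ≠ a → 0 < φ p) (hZ : ∀ p ∈ Z, p ≠ b → φ p < 0) :
    Disjoint (convexHull ℝ (Y : Set Pt)) (convexHull ℝ (Z : Set Pt)) := by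
  rw [Set.disjoint_left]
  intro x hx hx'
  have h1 := convexHull_min (t := {x | 0 < φ x ∨ x = a})
    (fun p hp => or_iff_not_imp_right.2 (hY p hp)) (hφ.convex_pos_or_eq ha.ge) hx
  have h2 := convexHull_min (t := {x | 0 < -φ x ∨ x = b})
    (fun p hp => or_iff_not_imp_right.2 fun h => by simpa using hZ p hp h)
    (hφ.neg.convex_pos_or_eq (by simp [hb])) hx'
  rcases h1 with h1 | rfl <;> rcases h2 with h2 | rfl
  · linarith
  · linarith
  · linarith
  · exact hab rfl

/-- A point of `X` at which an affine function attains its strict minimum over `X` is extreme. -/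
lemma IsAff.mem_extremePoints {φ : Pt → ℝ} (hφ : IsAff φ) {X : Finset Pt} {u : Pt} (hu : u ∈ X)
    (hu0 : φ u = 0) (hX : ∀ p ∈ X, p ≠ u → 0 < φ p) :
    u ∈ Set.extremePoints ℝ (convexHull ℝ (X : Set Pt)) := by
  have hsub := convexHull_min (s := (X : Set Pt)) (t := {x | 0 < φ x ∨ x = u})
    (fun p hp => or_iff_not_imp_right.2 (hX p hp)) (hφ.convex_pos_or_eq hu0.ge)
  refine ⟨subset_convexHull ℝ _ hu, ?_⟩
  rintro x hx y hy ⟨s, t, hs, ht, hst, hxy⟩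
  have h := hφ x y s t hst
  rw [hxy, hu0] at h
  have hy0 : 0 ≤ φ y := by
    rcases hsub hy with h | rfl
    exacts [h.le, hu0.ge]
  rcases hsub hx with h1 | h1
  · have := mul_pos hs h1
    have := mul_nonneg ht.le hy0
    linarith
  · exact h1

/-- Lexicographic version of `IsAff.mem_extremePoints`, with ties in `φ` broken by `ψ`. -/
lemma IsAff.mem_extremePoints_of_lex {φ ψ : Pt → ℝ} (hφ : IsAff φ) (hψ : IsAff ψ)
    {X : Finset Pt} {u : Pt} (hu : u ∈ X) (hφu : φ u = 0) (hψu : ψ u = 0)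
    (hX : ∀ p ∈ X, p ≠ u → 0 < φ p ∨ φ p = 0 ∧ 0 < ψ p) :
    u ∈ Set.extremePoints ℝ (convexHull ℝ (X : Set Pt)) := by
  have hev : ∀ᶠ ε in nhdsWithin (0 : ℝ) (Set.Ioi 0), ∀ p ∈ X, p ≠ u → 0 < φ p + ε * ψ p := by
    rw [Filter.eventually_all_finset]
    intro p hp
    rw [Filter.eventually_imp_distrib_left]
    intro hpu
    rcases hX p hp hpu with h | ⟨h, h'⟩
    · have hc : Continuous fun ε : ℝ => φ p + ε * ψ p := by fun_prop
      have ht := hc.tendsto 0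
      simp only [zero_mul, add_zero] at ht
      exact (ht.mono_left nhdsWithin_le_nhds).eventually (lt_mem_nhds h)
    · filter_upwards [self_mem_nhdsWithin] with ε hε
      rw [h, zero_add]
      exact mul_pos hε h'
  obtain ⟨ε, hε⟩ := hev.exists
  exact (hφ.add (hψ.const_mul ε)).mem_extremePoints hu (by simp [hφu, hψu]) hε

/-- The points of `X` on one side of the line through `u` and `v`, as selected by the sign
of `ε`. -/
def side (X : Finset Pt) (u v : Pt) (ε : ℝ) : Finset Pt :=
  X.filter fun p => 0 < ε * ori u v p

lemma mem_side {X : Finset Pt} {u v p : Pt} {ε : ℝ} :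
    p ∈ side X u v ε ↔ p ∈ X ∧ 0 < ε * ori u v p := by
  simp [side]

/-- The inner product of `v - u` and `p - u`. -/
def along (u v p : Pt) : ℝ := (v.1 - u.1) * (p.1 - u.1) + (v.2 - u.2) * (p.2 - u.2)

lemma isAff_along (u v : Pt) : IsAff (along u v) := by
  intro x y s t hst
  obtain rfl : s = 1 - t := by linarith
  simp only [along, Prod.fst_add, Prod.snd_add, Prod.smul_fst, Prod.smul_snd, smul_eq_mul]
  ring

lemma along_self_pos {u v : Pt} (huv : u ≠ v) : 0 < along u v v := by
  unfold along
  by_contra! h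
  apply huv
  have h1 := mul_self_nonneg (v.1 - u.1)
  have h2 := mul_self_nonneg (v.2 - u.2)
  have h3 : v.1 - u.1 = 0 := mul_self_eq_zero.1 (by linarith)
  have h4 : v.2 - u.2 = 0 := mul_self_eq_zero.1 (by linarith)
  exact Prod.ext (by linarith) (by linarith)

lemma along_mul_ori (u v p q : Pt) :
    along u v p * ori u v q - along u v q * ori u v p = along u v v * ori u p q := by
  unfold along ori; ring

/-- The point of a side that is last in the angular order around `u` starting from `v`. -/
lemma exists_last {X : Finset Pt} (hX : GenPos X) {u v : Pt} (hu : u ∈ X) (huv : u ≠ v) {ε : ℝ}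
    (hne : (side X u v ε).Nonempty) :
    ∃ l ∈ side X u v ε, ∀ p ∈ side X u v ε, p ≠ l → 0 < ε * ori u p l := by
  obtain ⟨l, hl, hmax⟩ := Finset.exists_max_image (side X u v ε)
    (fun p => -along u v p / (ε * ori u v p)) hne
  refine ⟨l, hl, fun p hp hpl => ?_⟩
  have h := hmax p hp
  rw [mem_side] at hl hp
  rw [div_le_div_iff₀ hp.2 hl.2] at h
  have hc := along_self_pos huv
  have hid := along_mul_ori u v p l
  have hne0 : ∀ q, 0 < ε * ori u v q → u ≠ q := by
    rintro q hq rfl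
    simp [ori_left] at hq
  have hε : ε ≠ 0 := by rintro rfl; simp at hl
  have h0 : ori u p l ≠ 0 := hX.ori_ne_zero hu hp.1 hl.1 (hne0 p hp.2) (hne0 l hl.2) hpl
  have h1 : 0 ≤ along u v v * (ε * ori u p l) := by
    have : along u v v * (ε * ori u p l) = ε * (along u v v * ori u p l) := by ring
    rw [this, ← hid]; linarith
  exact lt_of_le_of_ne (nonneg_of_mul_nonneg_right h1 hc) (mul_ne_zero hε h0).symm

/-- If `u` is not extreme, then both sides of any line `u v` are occupied, and their last points
around `u` span a segment passing behind `u` as seen from `v`. -/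
lemma exists_last_pair {X : Finset Pt} (hX : GenPos X) {u v : Pt} (hu : u ∈ X) (hv : v ∈ X)
    (huv : u ≠ v) (hext : u ∉ Set.extremePoints ℝ (convexHull ℝ (X : Set Pt))) :
    ∃ l r, l ∈ side X u v 1 ∧ r ∈ side X u v (-1) ∧
      (∀ p ∈ side X u v 1, p ≠ l → 0 < ori u p l) ∧
      (∀ p ∈ side X u v (-1), p ≠ r → ori u p r < 0) ∧ 0 < ori u l r := by
  have hne : ∀ p ∈ X, p ≠ u → p ≠ v → ori u v p ≠ 0 := fun p hp hpu hpv =>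
    hX.ori_ne_zero hu hv hp huv hpu.symm hpv.symm
  have hside : ∀ ε : ℝ, ε ≠ 0 → (side X u v ε).Nonempty := by
    intro ε hε
    by_contra hemp
    apply hext
    refine (isAff_ori u v (-ε)).mem_extremePoints_of_lex (isAff_along u v) hu
      (by simp [ori_left]) (by simp [along]) ?_
    intro p hp hpu
    by_cases hpv : p = v
    · subst hpv
      exact Or.inr ⟨by simp [ori_right], along_self_pos huv⟩
    · left
      have h1 : ¬ 0 < ε * ori u v p := fun h => hemp ⟨p, mem_side.2 ⟨hp, h⟩⟩
      have h2 := mul_ne_zero hε (hne p hp hpu hpv)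
      rcases lt_or_gt_of_ne h2 with h | h
      · linarith
      · exact absurd h h1
  obtain ⟨l, hl, hlast⟩ := exists_last hX hu huv (hside 1 one_ne_zero)
  obtain ⟨r, hr, hrast⟩ := exists_last hX hu huv (hside (-1) (by norm_num))
  have hl' := mem_side.1 hl
  have hr' := mem_side.1 hr
  refine ⟨l, r, hl, hr, fun p hp hpl => by simpa using hlast p hp hpl,
    fun p hp hpr => by simpa using hrast p hp hpr, ?_⟩
  have hul : u ≠ l := by rintro rfl; simp [ori_left] at hl'
  have hur : u ≠ r := by rintro rfl; simp [ori_left] at hr'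
  have hlr : l ≠ r := by
    rintro rfl
    have := hl'.2; have := hr'.2; linarith
  by_contra hneg
  have hlr0 : 0 < ori u r l := by
    have := hX.ori_ne_zero hu hl'.1 hr'.1 hul hur hlr
    rw [ori_swap u l r]
    rcases lt_or_gt_of_ne this with h | h
    · linarith
    · exact absurd h hneg
  have hvl : 0 < ori u v l := by simpa using hl'.2
  have hvr : ori u v r < 0 := by simpa using hr'.2
  apply hext
  refine ((isAff_ori u r 1).add (isAff_ori u l (-1))).mem_extremePoints hu
    (by simp [ori_left]) ?_
  intro p hp hpu
  suffices 0 < ori u r p - ori u l p by linarith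
  by_cases hpv : p = v
  · subst hpv
    rw [ori_swap u p r, ori_swap u p l]
    linarith
  rcases lt_or_gt_of_ne (hne p hp hpu hpv) with h | h
  · by_cases hpr : p = r
    · subst hpr
      rw [ori_right, ori_swap u p l]; linarith
    · have h1 := hrast p (mem_side.2 ⟨hp, by linarith⟩) hpr
      rw [ori_swap u r p] at h1
      have h2 := ori_plucker u v r p l
      rw [ori_swap u l p] at h2
      have h3 : 0 < -ori u l p := by
        by_contra! h4
        nlinarith [mul_nonneg_of_nonpos_of_nonpos hvr.le h4,
          mul_pos_of_neg_of_neg h (neg_neg_of_pos hlr0),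
          mul_pos hvl (show 0 < ori u r p by linarith)]
      linarith
  · by_cases hpl : p = l
    · subst hpl
      rw [ori_right]; linarith
    · have h1 := hlast p (mem_side.2 ⟨hp, by linarith⟩) hpl
      rw [ori_swap u l p] at h1
      have h2 := ori_plucker u v l p r
      rw [ori_swap u r p, ori_swap u r l] at h2
      have h3 : 0 < ori u r p := by
        by_contra! h4
        nlinarith [mul_nonneg hvl.le (neg_nonneg.2 h4), mul_pos h hlr0,
          mul_pos_of_neg_of_neg hvr (show ori u l p < 0 by linarith)]
      linarith

/-- A walk with steps at least `-1` that goes from a nonnegative to a negative value takes a step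
from `0` to `-1`. -/
lemma exists_crossing {α : Type*} [DecidableEq α] (V : Finset α) (t : α → ℝ)
    (ht : Set.InjOn t V) (s : α → ℤ) (hs : ∀ p ∈ V, -1 ≤ s p) (c : ℤ) (hc : 0 ≤ c)
    (hfin : c + ∑ p ∈ V, s p < 0) :
    ∃ p ∈ V, c + ∑ q ∈ V with t q < t p, s q = 0 ∧ s p = -1 := by
  induction V using Finset.induction_on_max_value t with
  | empty => simp at hfin; omega
  | insert a V ha hmax ih =>
    rw [Finset.sum_insert ha] at hfin
    have hsa := hs a (Finset.mem_insert_self _ _)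
    by_cases hlt : c + ∑ p ∈ V, s p < 0
    · obtain ⟨p, hp, hp0, hp1⟩ := ih
        (ht.mono (by simp)) (fun p hp => hs p (Finset.mem_insert_of_mem hp)) hlt
      refine ⟨p, Finset.mem_insert_of_mem hp, ?_, hp1⟩
      rw [Finset.filter_insert, if_neg (not_lt.2 (hmax p hp))]
      exact hp0
    · refine ⟨a, Finset.mem_insert_self _ _, ?_, by omega⟩
      rw [Finset.filter_insert, if_neg (lt_irrefl _), Finset.filter_true_of_mem]
      · omega
      · intro q hq
        refine lt_of_le_of_ne (hmax q hq) fun h => ha ?_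
        rwa [← ht (by simp [hq]) (by simp) h]

/-- The set `H` blocks all non-crossing perfect matchings of `X`, and `w` is a balanced coloring
for which `s(u, v)` is the only bichromatic edge in `H`. -/
structure Critical (X : Finset Pt) (H : Finset (Sym2 Pt)) (u v : Pt) (w : Pt → ℤ) : Prop where
  genPos : GenPos X
  isEdgeOf : ∀ e ∈ H, IsEdgeOf X e
  card_eq : X.card = 2 * H.card
  mem_left : u ∈ X
  mem_right : v ∈ X
  ne : u ≠ v
  color : ∀ p, w p = 1 ∨ w p = -1
  color_left : w u = 1
  color_right : w v = -1
  sum_eq : ∑ p ∈ X, w p = 0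
  mono : ∀ a b, s(a, b) ∈ H → s(a, b) ≠ s(u, v) → w a = w b
  blocked : ∀ K, ¬ MatchableIn H X K

lemma disjoint_of_disjoint_convexHull {Y Z : Finset Pt}
    (h : Disjoint (convexHull ℝ (Y : Set Pt)) (convexHull ℝ (Z : Set Pt))) : Disjoint Y Z :=
  Finset.disjoint_coe.1 (h.mono (subset_convexHull ℝ _) (subset_convexHull ℝ _))

namespace Critical

variable {X : Finset Pt} {H : Finset (Sym2 Pt)} {u v : Pt} {w : Pt → ℤ}

lemma matchableIn (h : Critical X H u v w) {Y : Finset Pt} (hY : Y ⊆ X)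
    (huv : u ∈ Y → v ∉ Y) (hsum : ∑ p ∈ Y, w p = 0) :
    MatchableIn H Y (convexHull ℝ (Y : Set Pt)) := by
  refine (h.genPos.subset hY).matchableIn_of_coloring h.color hsum fun a ha b hb hab => ?_
  refine h.mono a b hab fun heq => ?_
  rcases Sym2.eq_iff.1 heq with ⟨rfl, rfl⟩ | ⟨rfl, rfl⟩
  exacts [huv ha hb, huv hb ha]

lemma false_of_two (h : Critical X H u v w) {Y Z : Finset Pt} (hX : X = Y ∪ Z)
    (hY : MatchableIn H Y (convexHull ℝ (Y : Set Pt)))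
    (hZ : MatchableIn H Z (convexHull ℝ (Z : Set Pt)))
    (hYZ : Disjoint (convexHull ℝ (Y : Set Pt)) (convexHull ℝ (Z : Set Pt))) : False :=
  h.blocked _ (hX ▸ hY.union hZ (disjoint_of_disjoint_convexHull hYZ) hYZ)

lemma false_of_three (h : Critical X H u v w) {Y Z W : Finset Pt} (hX : X = Y ∪ Z ∪ W)
    (hY : MatchableIn H Y (convexHull ℝ (Y : Set Pt)))
    (hZ : MatchableIn H Z (convexHull ℝ (Z : Set Pt)))
    (hW : MatchableIn H W (convexHull ℝ (W : Set Pt)))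
    (hYZ : Disjoint (convexHull ℝ (Y : Set Pt)) (convexHull ℝ (Z : Set Pt)))
    (hYW : Disjoint (convexHull ℝ (Y : Set Pt)) (convexHull ℝ (W : Set Pt)))
    (hZW : Disjoint (convexHull ℝ (Z : Set Pt)) (convexHull ℝ (W : Set Pt))) : False := by
  refine h.blocked _ (hX ▸ (hY.union hZ (disjoint_of_disjoint_convexHull hYZ) hYZ).union hW ?_
    (Set.disjoint_union_left.2 ⟨hYW, hZW⟩))
  exact Finset.disjoint_union_left.2
    ⟨disjoint_of_disjoint_convexHull hYW, disjoint_of_disjoint_convexHull hZW⟩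

lemma notMem_side_left (ε : ℝ) : u ∉ side X u v ε := by simp [mem_side, ori_left]

lemma notMem_side_right (ε : ℝ) : v ∉ side X u v ε := by simp [mem_side, ori_right]

lemma disjoint_side (ε : ℝ) : Disjoint (side X u v ε) (side X u v (-ε)) := by
  rw [Finset.disjoint_left]
  intro p hp hp'
  rw [mem_side] at hp hp'
  linarith [hp.2, hp'.2]

lemma eq_insert_side (h : Critical X H u v w) {ε : ℝ} (hε : ε ≠ 0) :
    X = insert u (insert v (side X u v ε ∪ side X u v (-ε))) := by
  ext p
  simp only [Finset.mem_insert, Finset.mem_union, mem_side]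
  constructor
  · intro hp
    by_cases hpu : p = u
    · exact Or.inl hpu
    by_cases hpv : p = v
    · exact Or.inr (Or.inl hpv)
    have h0 := mul_ne_zero hε (h.genPos.ori_ne_zero h.mem_left h.mem_right hp h.ne
      (Ne.symm hpu) (Ne.symm hpv))
    rcases lt_or_gt_of_ne h0 with h0 | h0
    · exact Or.inr (Or.inr (Or.inr ⟨hp, by linarith⟩))
    · exact Or.inr (Or.inr (Or.inl ⟨hp, h0⟩))
  · rintro (rfl | rfl | hp | hp)
    exacts [h.mem_left, h.mem_right, hp.1, hp.1]

lemma sum_eq_sides (h : Critical X H u v w) {ε : ℝ} (hε : ε ≠ 0) (f : Pt → ℤ) :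
    ∑ p ∈ X, f p = f u + (f v + (∑ p ∈ side X u v ε, f p + ∑ p ∈ side X u v (-ε), f p)) := by
  conv_lhs => rw [h.eq_insert_side hε]
  rw [Finset.sum_insert, Finset.sum_insert, Finset.sum_union (disjoint_side ε)]
  · simp [notMem_side_right]
  · simp [notMem_side_left, h.ne]

lemma sum_sides (h : Critical X H u v w) {ε : ℝ} (hε : ε ≠ 0) :
    ∑ p ∈ side X u v ε, w p + ∑ p ∈ side X u v (-ε), w p = 0 := by
  have := h.sum_eq_sides hε w
  rw [h.sum_eq, h.color_left, h.color_right] at this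
  linarith

/-- Rotating a line around `u` yields a balanced cut separating `u` from `v` unless the line `u v`
itself is balanced. -/
lemma sum_side_le (h : Critical X H u v w) {ε : ℝ} (hε : ε ≠ 0) :
    ∑ p ∈ side X u v ε, w p ≤ 0 := by
  by_contra! hpos
  have hsides := h.sum_sides hε
  set d : Pt → ℝ := fun q => ε * ori u v q with hd
  set t : Pt → ℝ := fun q => -along u v q / d q with ht
  set V := (X.erase u).erase v with hV
  have hVmem : ∀ q, q ∈ V ↔ q ∈ X ∧ q ≠ u ∧ q ≠ v := by
    intro q; simp only [hV, Finset.mem_erase]; tauto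
  have hd0 : ∀ q ∈ V, d q ≠ 0 := fun q hq => by
    obtain ⟨hqX, hqu, hqv⟩ := (hVmem q).1 hq
    exact mul_ne_zero hε (h.genPos.ori_ne_zero h.mem_left h.mem_right hqX h.ne hqu.symm hqv.symm)
  have hinj : Set.InjOn t V := by
    intro p hp q hq hpq
    by_contra hne
    have hp' := (hVmem p).1 hp
    have hq' := (hVmem q).1 hq
    simp only [ht] at hpq
    rw [div_eq_div_iff (hd0 p hp) (hd0 q hq)] at hpq
    have hid := along_mul_ori u v p q
    have h0 : ε * (along u v v * ori u p q) = 0 := by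
      rw [← hid]; simp only [hd] at hpq; linarith
    exact mul_ne_zero hε (mul_ne_zero (along_self_pos h.ne).ne'
      (h.genPos.ori_ne_zero h.mem_left hp'.1 hq'.1 hp'.2.1.symm hq'.2.1.symm hne)) h0
  have hside : side X u v ε = V.filter fun q => 0 < d q := by
    ext q
    simp only [mem_side, Finset.mem_filter, hVmem]
    refine ⟨fun hq => ⟨⟨hq.1, ?_, ?_⟩, hq.2⟩, fun hq => ⟨hq.1.1, hq.2⟩⟩
    · rintro rfl; simp [ori_left] at hq
    · rintro rfl; simp [ori_right] at hq
  have hside' : side X u v (-ε) = V.filter fun q => ¬ 0 < d q := by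
    ext q
    simp only [mem_side, Finset.mem_filter, hVmem]
    constructor
    · intro hq
      refine ⟨⟨hq.1, ?_, ?_⟩, ?_⟩
      · rintro rfl; simp [ori_left] at hq
      · rintro rfl; simp [ori_right] at hq
      · simp only [hd]; linarith [hq.2]
    · intro hq
      refine ⟨hq.1.1, ?_⟩
      have h1 := lt_of_le_of_ne (not_lt.1 hq.2) (hd0 q ((hVmem q).2 hq.1))
      simp only [hd] at h1
      linarith
  obtain ⟨p, hp, hp0, hp1⟩ := exists_crossing V t hinj
    (fun q => if 0 < d q then -w q else w q)
    (fun q _ => by rcases h.color q with hq | hq <;> split_ifs <;> omega)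
    (∑ q ∈ side X u v ε, w q) (by omega) (by
      rw [Finset.sum_ite, Finset.sum_neg_distrib, ← hside, ← hside']
      omega)
  obtain ⟨hpX, hpu, hpv⟩ := (hVmem p).1 hp
  set g : Pt → ℝ := fun q => along u v q + t p * d q with hg
  have hgaff : IsAff g := by
    have := (isAff_along u v).add ((isAff_ori u v ε).const_mul (t p))
    exact this
  have hgu : g u = 0 := by simp [hg, hd, along, ori_left]
  have hgv : 0 < g v := by simpa [hg, hd, ori_right] using along_self_pos h.ne
  have hgp : g p = 0 := by
    simp only [hg, ht]
    rw [div_mul_cancel₀ _ (hd0 p hp)]; ring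
  have hgq : ∀ q ∈ V, g q = d q * (t p - t q) := by
    intro q hq
    have : t q * d q = -along u v q := div_mul_cancel₀ _ (hd0 q hq)
    simp only [hg]; linarith
  set U := V.filter fun q => g q < 0 with hU
  have hUsum : ∑ q ∈ U, w q + (if 0 < d p then w p else 0) = 0 := by
    refine Eq.trans ?_ hp0
    rw [hside, hU, Finset.sum_filter, Finset.sum_filter, Finset.sum_filter]
    have h1 : (if 0 < d p then w p else 0) =
        ∑ q ∈ V, if q = p then (if 0 < d p then w p else 0) else 0 := by
      rw [Finset.sum_ite_eq' V p, if_pos hp]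
    rw [h1, ← Finset.sum_add_distrib, ← Finset.sum_add_distrib]
    refine Finset.sum_congr rfl fun q hq => ?_
    by_cases hqp : q = p
    · subst hqp
      simp [hgp]
    have htne : t q ≠ t p := fun heq => hqp (hinj hq hp heq)
    rw [hgq q hq, if_neg hqp]
    rcases lt_or_gt_of_ne (hd0 q hq) with hdq | hdq <;> rcases lt_or_gt_of_ne htne with htq | htq
    · have : d q * (t p - t q) < 0 := mul_neg_of_neg_of_pos hdq (by linarith)
      simp [this, htq, hdq.not_gt]
    · have : 0 < d q * (t p - t q) := mul_pos_of_neg_of_neg hdq (by linarith)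
      simp [this.not_gt, htq.not_gt, hdq.not_gt]
    · have : 0 < d q * (t p - t q) := mul_pos hdq (by linarith)
      simp [this.not_gt, htq, hdq]
    · have : d q * (t p - t q) < 0 := mul_neg_of_pos_of_neg hdq (by linarith)
      simp [this, htq.not_gt, hdq]
  have hUV : ∀ q ∈ U, q ∈ V ∧ g q < 0 := fun q hq => by simpa [hU] using hq
  have huU : u ∉ U := fun hmem => ((hVmem u).1 (hUV u hmem).1).2.1 rfl
  have hvU : v ∉ U := fun hmem => ((hVmem v).1 (hUV v hmem).1).2.2 rfl
  have hpU : p ∉ U := fun hmem => by linarith [(hUV p hmem).2]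
  have hUX : U ⊆ X := fun q hq => ((hVmem q).1 (hUV q hq).1).1
  have houtside : ∀ q ∈ X, q ≠ u → q ≠ p → q ∉ U → 0 < g q := by
    intro q hq hqu hqp hqU
    by_cases hqv : q = v
    · exact hqv ▸ hgv
    have hqV := (hVmem q).2 ⟨hq, hqu, hqv⟩
    refine lt_of_le_of_ne (not_lt.1 fun hlt => hqU (by simp [hU, hqV, hlt])) fun h0 => ?_
    rw [hgq q hqV] at h0
    rcases mul_eq_zero.1 h0.symm with h0 | h0
    · exact hd0 q hqV h0
    · exact hqp (hinj hqV hp (by linarith))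
  have hcut : ∀ Y ⊆ X, u ∈ Y → v ∉ Y → ∑ q ∈ Y, w q = 0 →
      Disjoint (convexHull ℝ (Y : Set Pt)) (convexHull ℝ ((X \ Y : Finset Pt) : Set Pt)) →
      False := by
    intro Y hY huY hvY hsum hdisj
    refine h.false_of_two (Finset.union_sdiff_of_subset hY).symm
      (h.matchableIn hY (fun _ => hvY) hsum)
      (h.matchableIn Finset.sdiff_subset (fun hmem => absurd huY (Finset.mem_sdiff.1 hmem).2) ?_)
      hdisj
    have := Finset.sum_sdiff (f := w) hY
    rw [h.sum_eq] at this
    omega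
  by_cases hdp : 0 < d p
  · simp only [hdp, if_true] at hp1 hUsum
    refine hcut (insert u U) (Finset.insert_subset h.mem_left hUX) (by simp)
      (by simp [h.ne.symm, hvU]) ?_ ?_
    · rw [Finset.sum_insert huU, h.color_left]; omega
    · refine hgaff.neg.disjoint_convexHull_of_ne (a := u) (b := p) hpu.symm (by simp [hgu])
        (by simp [hgp]) ?_ ?_
      · intro q hq hqu
        have := (hUV q ((Finset.mem_insert.1 hq).resolve_left hqu)).2
        linarith
      · intro q hq hqp
        simp only [Finset.mem_sdiff, Finset.mem_insert, not_or] at hq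
        have := houtside q hq.1 hq.2.1 hqp hq.2.2
        linarith
  · simp only [hdp, if_false] at hp1 hUsum
    refine hcut (insert u (insert p U))
      (Finset.insert_subset h.mem_left (Finset.insert_subset hpX hUX)) (by simp)
      (by simp [h.ne.symm, hvU, hpv.symm]) ?_ ?_
    · rw [Finset.sum_insert (by simp [huU, hpu.symm]), Finset.sum_insert hpU, h.color_left]
      omega
    · refine hgaff.neg.disjoint_convexHull ?_ ?_
      · intro q hq
        rcases Finset.mem_insert.1 hq with rfl | hq
        · simp [hgu]
        rcases Finset.mem_insert.1 hq with rfl | hq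
        · simp [hgp]
        · linarith [(hUV q hq).2]
      · intro q hq
        simp only [Finset.mem_sdiff, Finset.mem_insert, not_or] at hq
        have := houtside q hq.1 hq.2.1 hq.2.2.1 hq.2.2.2
        linarith

lemma sum_side (h : Critical X H u v w) {ε : ℝ} (hε : ε ≠ 0) : ∑ p ∈ side X u v ε, w p = 0 := by
  have h1 := h.sum_side_le hε
  have h2 := h.sum_side_le (neg_ne_zero.2 hε)
  have h3 := h.sum_sides hε
  omega

lemma side_subset (ε : ℝ) : side X u v ε ⊆ X := Finset.filter_subset _ _

lemma matchableIn_side (h : Critical X H u v w) {ε : ℝ} (hε : ε ≠ 0) :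
    MatchableIn H (side X u v ε) (convexHull ℝ (side X u v ε : Set Pt)) :=
  h.matchableIn (side_subset ε) (fun hu => absurd hu (notMem_side_left ε)) (h.sum_side hε)

/-- The last point of a side around `u` has the color of `u`. -/
lemma color_last (h : Critical X H u v w) {ε : ℝ} (hε : ε ≠ 0) {l : Pt}
    (hl : l ∈ side X u v ε) (hlast : ∀ p ∈ side X u v ε, p ≠ l → 0 < ε * ori u p l) :
    w l = 1 := by
  by_contra hwl
  have hwl := (h.color l).resolve_left hwl
  have hl' := mem_side.1 hl
  have hul : u ≠ l := fun heq => notMem_side_left ε (heq ▸ hl)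
  have hvl : v ≠ l := fun heq => notMem_side_right ε (heq ▸ hl)
  have hneg : ∀ p ∈ side X u v (-ε), ε * ori u v p < 0 := fun p hp => by
    linarith [(mem_side.1 hp).2]
  refine h.false_of_three (Y := {u, l}) (Z := insert v ((side X u v ε).erase l))
    (W := side X u v (-ε)) ?_ ?_ ?_ (h.matchableIn_side (neg_ne_zero.2 hε)) ?_ ?_ ?_
  · conv_lhs => rw [h.eq_insert_side hε, ← Finset.insert_erase hl]
    ext p
    simp only [Finset.mem_insert, Finset.mem_union, Finset.mem_singleton]
    tauto
  · refine h.matchableIn ?_ ?_ ?_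
    · simp [Finset.insert_subset_iff, h.mem_left, hl'.1]
    · simp [h.ne.symm, hvl]
    · rw [Finset.sum_pair hul, h.color_left, hwl]; rfl
  · refine h.matchableIn ?_ ?_ ?_
    · exact Finset.insert_subset h.mem_right ((Finset.erase_subset _ _).trans (side_subset ε))
    · simp [h.ne, notMem_side_left]
    · have h1 := Finset.add_sum_erase _ w hl
      rw [h.sum_side hε] at h1
      rw [Finset.sum_insert (by simp [notMem_side_right]), h.color_right]
      omega
  · refine (isAff_ori u l ε).disjoint_convexHull ?_ ?_
    · intro p hp
      rcases Finset.mem_insert.1 hp with rfl | hp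
      · simp [ori_left]
      · simp [Finset.mem_singleton.1 hp, ori_right]
    · intro p hp
      rw [ori_swap]
      rcases Finset.mem_insert.1 hp with rfl | hp
      · linarith [hl'.2]
      · have := hlast p (Finset.mem_of_mem_erase hp) (Finset.ne_of_mem_erase hp)
        linarith
  · refine (isAff_ori u v ε).disjoint_convexHull ?_ hneg
    intro p hp
    rcases Finset.mem_insert.1 hp with rfl | hp
    · simp [ori_left]
    · rw [Finset.mem_singleton.1 hp]; exact hl'.2.le
  · refine (isAff_ori u v ε).disjoint_convexHull ?_ hneg
    intro p hp
    rcases Finset.mem_insert.1 hp with rfl | hp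
    · simp [ori_right]
    · exact (mem_side.1 (Finset.mem_of_mem_erase hp)).2.le

/-- A closed side spans at least half as many edges of `H` as it has points. -/
lemma card_le_edges (h : Critical X H u v w) {ε : ℝ} (hε : ε ≠ 0) :
    (side X u v ε).card + 2 ≤ 2 * (H ∩ (insert u (insert v (side X u v ε))).sym2).card := by
  by_contra! hlt
  have hcard : (insert u (insert v (side X u v ε))).card = (side X u v ε).card + 2 := by
    rw [Finset.card_insert_of_notMem (by simp [h.ne, notMem_side_left]),
      Finset.card_insert_of_notMem (notMem_side_right ε)]
  have h1 := card_filter_eq_of_sum_eq_zero h.color (h.sum_side hε)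
  have h2 := Finset.card_filter_add_card_filter_not (s := side X u v ε) (fun p => w p = 1)
  refine h.false_of_two (Y := insert u (insert v (side X u v ε))) (Z := side X u v (-ε)) ?_
    (GenPos.matchableIn_of_card_lt (h.genPos.subset ?_)
      (((side X u v ε).filter (fun p => w p = 1)).card + 1) ?_ ?_)
    (h.matchableIn_side (neg_ne_zero.2 hε)) ?_
  · conv_lhs => rw [h.eq_insert_side hε]
    simp [Finset.insert_union]
  · exact Finset.insert_subset h.mem_left (Finset.insert_subset h.mem_right (side_subset ε))
  · omega
  · omega
  · refine (isAff_ori u v ε).disjoint_convexHull ?_ ?_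
    · intro p hp
      rcases Finset.mem_insert.1 hp with rfl | hp
      · simp [ori_left]
      rcases Finset.mem_insert.1 hp with rfl | hp
      · simp [ori_right]
      · exact (mem_side.1 hp).2.le
    · intro p hp
      linarith [(mem_side.1 hp).2]

/-- No edge of `H` crosses the line `u v`. -/
lemma notMem_of_mem_sides (h : Critical X H u v w) {ε : ℝ} (hε : ε ≠ 0) {l r : Pt}
    (hl : l ∈ side X u v ε) (hr : r ∈ side X u v (-ε)) : s(l, r) ∉ H := by
  intro hlr
  have h1 := h.card_le_edges hε
  have h2 := h.card_le_edges (neg_ne_zero.2 hε)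
  have hdisj : ∀ p, p ∈ side X u v ε → p ∉ side X u v (-ε) :=
    fun p hp hp' => Finset.disjoint_left.1 (disjoint_side ε) hp hp'
  set E := H ∩ (insert u (insert v (side X u v ε))).sym2 with hE
  set F := H ∩ (insert u (insert v (side X u v (-ε)))).sym2 with hF
  have hX : X.card = (side X u v ε).card + (side X u v (-ε)).card + 2 := by
    have := h.sum_eq_sides hε (fun _ => 1)
    simp only [Finset.sum_const, nsmul_eq_mul, mul_one] at this
    omega
  have hEF : (E ∩ F).card ≤ 1 := by
    rw [Finset.card_le_one_iff_subset_singleton]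
    refine ⟨s(u, v), fun e he => ?_⟩
    induction e with
    | _ a b =>
      simp only [hE, hF, Finset.mem_inter, Finset.mk_mem_sym2_iff, Finset.mem_insert] at he
      have hab : a ≠ b := by simpa using (h.isEdgeOf _ he.1.1).1
      have := hdisj a
      have := hdisj b
      rw [Finset.mem_singleton, Sym2.eq_iff]
      grind
  have hlrE : s(l, r) ∉ E ∪ F := by
    have h3 := hdisj l hl
    have h4 : r ∉ side X u v ε := fun hr' => hdisj r hr' hr
    have hru : r ≠ u := fun heq => notMem_side_left (-ε) (heq ▸ hr)
    have hrv : r ≠ v := fun heq => notMem_side_right (-ε) (heq ▸ hr)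
    have hlu : l ≠ u := fun heq => notMem_side_left ε (heq ▸ hl)
    have hlv : l ≠ v := fun heq => notMem_side_right ε (heq ▸ hl)
    simp [hE, hF, h3, h4, hru, hrv, hlu, hlv]
  have hsub : insert s(l, r) (E ∪ F) ⊆ H :=
    Finset.insert_subset hlr (Finset.union_subset Finset.inter_subset_left
      Finset.inter_subset_left)
  have h5 := Finset.card_le_card hsub
  rw [Finset.card_insert_of_notMem hlrE] at h5
  have h6 := Finset.card_union_add_card_inter E F
  have h7 := h.card_eq
  omega

lemma mem_extremePoints (h : Critical X H u v w) (hleaf : ∀ e ∈ H, v ∈ e → e = s(u, v)) :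
    u ∈ Set.extremePoints ℝ (convexHull ℝ (X : Set Pt)) := by
  by_contra hext
  obtain ⟨l, r, hl, hr, hlast, hrast, hlr⟩ :=
    exists_last_pair h.genPos h.mem_left h.mem_right h.ne hext
  have hl' := mem_side.1 hl
  have hr' := mem_side.1 hr
  have hne : l ≠ r := by rintro rfl; simp [ori_right] at hlr
  have hwl := h.color_last one_ne_zero hl fun p hp hpl => by simpa using hlast p hp hpl
  have hwr := h.color_last (by norm_num) hr fun p hp hpr => by simpa using hrast p hp hpr
  have hlrH := h.notMem_of_mem_sides one_ne_zero hl hr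
  have hvr : ori u v r < 0 := by simpa using hr'.2
  have hsl := Finset.add_sum_erase _ w hl
  have hsr := Finset.add_sum_erase _ w hr
  rw [h.sum_side one_ne_zero] at hsl
  rw [h.sum_side (by norm_num)] at hsr
  refine h.false_of_three (Y := {l, r}) (Z := insert u ((side X u v 1).erase l))
    (W := insert v ((side X u v (-1)).erase r)) ?_ ?_ ?_ ?_ ?_ ?_ ?_
  · conv_lhs => rw [h.eq_insert_side one_ne_zero, ← Finset.insert_erase hl,
      ← Finset.insert_erase hr]
    ext p
    simp only [Finset.mem_insert, Finset.mem_union, Finset.mem_singleton]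
    tauto
  · refine GenPos.matchableIn_of_coloring (w := Function.update w r (-1)) (h.genPos.subset ?_)
      ?_ ?_ ?_
    · simp [Finset.insert_subset_iff, hl'.1, hr'.1]
    · intro p
      by_cases hpr : p = r
      · simp [hpr]
      · simpa [hpr] using h.color p
    · rw [Finset.sum_pair hne]; simp [hne, hwl]
    · intro a ha b hb hab
      simp only [Finset.mem_insert, Finset.mem_singleton] at ha hb
      rcases ha with rfl | rfl <;> rcases hb with rfl | rfl
      · rfl
      · exact absurd hab hlrH
      · exact absurd (Sym2.eq_swap ▸ hab) hlrH
      · rfl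
  · refine h.matchableIn ?_ ?_ ?_
    · exact Finset.insert_subset h.mem_left ((Finset.erase_subset _ _).trans (side_subset 1))
    · simp [h.ne.symm, notMem_side_right]
    · rw [Finset.sum_insert (by simp [notMem_side_left]), h.color_left]; omega
  · refine GenPos.matchableIn_of_coloring (w := Function.update w v 1) (h.genPos.subset ?_)
      ?_ ?_ ?_
    · exact Finset.insert_subset h.mem_right ((Finset.erase_subset _ _).trans (side_subset _))
    · intro p
      by_cases hpv : p = v
      · simp [hpv]
      · simpa [hpv] using h.color p
    · have hv : v ∉ (side X u v (-1)).erase r := by simp [notMem_side_right]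
      rw [Finset.sum_insert hv, Finset.sum_update_of_notMem hv]
      simp; omega
    · have hu : u ∉ insert v ((side X u v (-1)).erase r) := by simp [h.ne, notMem_side_left]
      intro a ha b hb hab
      have hne : s(a, b) ≠ s(u, v) := by
        intro heq
        rcases Sym2.eq_iff.1 heq with ⟨rfl, rfl⟩ | ⟨rfl, rfl⟩
        exacts [hu ha, hu hb]
      have hav : a ≠ v := by rintro rfl; exact hne (hleaf _ hab (by simp))
      have hbv : b ≠ v := by rintro rfl; exact hne (hleaf _ hab (by simp))
      simpa [hav, hbv] using h.mono a b hab hne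
  · refine (isAff_ori u l 1).disjoint_convexHull_of_ne (a := l) (b := u) ?_
      (by simp [ori_right]) (by simp [ori_left]) ?_ ?_
    · rintro rfl; exact notMem_side_left 1 hl
    · intro p hp hpl
      rw [Finset.mem_singleton.1 ((Finset.mem_insert.1 hp).resolve_left hpl)]
      linarith
    · intro p hp hpu
      have hp := (Finset.mem_insert.1 hp).resolve_left hpu
      have := hlast p (Finset.mem_of_mem_erase hp) (Finset.ne_of_mem_erase hp)
      rw [ori_swap]; linarith
  · refine (isAff_ori u r (-1)).disjoint_convexHull ?_ ?_
    · intro p hp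
      rcases Finset.mem_insert.1 hp with rfl | hp
      · rw [ori_swap]; linarith
      · simp [Finset.mem_singleton.1 hp, ori_right]
    · intro p hp
      rw [ori_swap]
      rcases Finset.mem_insert.1 hp with rfl | hp
      · linarith
      · have := hrast p (Finset.mem_of_mem_erase hp) (Finset.ne_of_mem_erase hp)
        linarith
  · refine (isAff_ori u v 1).disjoint_convexHull_of_ne h.ne
      (by simp [ori_left]) (by simp [ori_right]) ?_ ?_
    · intro p hp hpu
      have hp := (Finset.mem_insert.1 hp).resolve_left hpu
      exact (mem_side.1 (Finset.mem_of_mem_erase hp)).2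
    · intro p hp hpv
      have hp := (Finset.mem_insert.1 hp).resolve_left hpv
      linarith [(mem_side.1 (Finset.mem_of_mem_erase hp)).2]

end Critical

/-- Claim `leaf`: if removing a set `H` of exactly `n` edges eliminates all
non-crossing perfect matchings, then the unique neighbor of every leaf of the tree determined
by `H` is an extreme point of the convex hull of `X`. -/
theorem leaf_neighbor_on_hull (n : ℕ) (X : Finset Pt)
    (hXcard : X.card = 2 * n) (hgp : GenPos X)
    (H : Finset (Sym2 Pt)) (hH : ∀ e ∈ H, IsEdgeOf X e) (hHcard : H.card = n)
    (helim : ∀ M : Finset (Sym2 Pt), IsNCMatching X M → ¬ Avoids M H)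
    (v u : Pt) (huv : s(u, v) ∈ H)
    (hleaf : ∀ e ∈ H, v ∈ e → e = s(u, v)) :
    u ∈ Set.extremePoints ℝ (convexHull ℝ (X : Set Pt)) := by
  classical
  have hedge := hH _ huv
  have huX : u ∈ X := hedge.2 u (by simp)
  have hvX : v ∈ X := hedge.2 v (by simp)
  have hne : u ≠ v := by simpa using hedge.1
  have hblocked : ∀ K, ¬ MatchableIn H X K := fun K ⟨M, hM, hMH, _⟩ => helim M hM hMH
  have hpos := Finset.card_pos.2 ⟨_, huv⟩
  obtain ⟨w, hw, hsum, hmono⟩ := exists_balanced_coloring X (H.erase s(u, v)) n hXcard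
    (by rw [Finset.card_erase_of_mem huv]; omega)
  have hmono' : ∀ a b, s(a, b) ∈ H → s(a, b) ≠ s(u, v) → w a = w b := fun a b hab hab' =>
    hmono a b (Finset.mem_erase.2 ⟨hab', hab⟩)
  have hcolor : w u ≠ w v := by
    intro heq
    refine hblocked _ (hgp.matchableIn_of_coloring hw hsum fun a _ b _ hab => ?_)
    by_cases hab' : s(a, b) = s(u, v)
    · rcases Sym2.eq_iff.1 hab' with ⟨rfl, rfl⟩ | ⟨rfl, rfl⟩
      exacts [heq, heq.symm]
    · exact hmono' a b hab hab'
  have hX : X.card = 2 * H.card := by rw [hXcard, hHcard]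
  rcases hw u with hwu | hwu <;> rcases hw v with hwv | hwv
  · exact absurd (hwu.trans hwv.symm) hcolor
  · exact Critical.mem_extremePoints (w := w)
      ⟨hgp, hH, hX, huX, hvX, hne, hw, hwu, hwv, hsum, hmono', hblocked⟩ hleaf
  · exact Critical.mem_extremePoints (w := fun p => -w p)
      ⟨hgp, hH, hX, huX, hvX, hne, fun p => by rcases hw p with h | h <;> simp [h],
        by simp [hwu], by simp [hwv], by simp [hsum],
        fun a b hab hab' => by rw [hmono' a b hab hab'], hblocked⟩ hleaf
  · exact absurd (hwu.trans hwv.symm) hcolor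
end
end

section
/- Let X be a set of 2n points in general position in the plane and let H be a set of exactly n edges of X such that no non-crossing perfect matching of X avoids H. Call a point of X red if it is an endpoint of some edge of H and blue otherwise. Suppose {u,v} ∈ H is an edge such that v is an extreme point of the convex hull of X and v is an endpoint of at least two edges of H. Then on each of the two open half-planes determined by the line through u and v, the number of red points of X equals the number of blue points of X. -/
open MeasureTheory Set Filter

noncomputable section

/-- The signed cross product determining on which side of the oriented line through `u` and `v`
the point `w` lies (`0 <` : left open half-plane, `< 0` : right open half-plane). -/
def cross (u v w : Pt) : ℝ :=
  (v.1 - u.1) * (w.2 - u.2) - (v.2 - u.2) * (w.1 - u.1)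

/-- A point is red (w.r.t. `H`) if it is an endpoint of some edge of `H`. -/
def RedPt (H : Finset (Sym2 Pt)) (p : Pt) : Prop := ∃ e ∈ H, p ∈ e

/-- `P` contains both or none of the points of `e`. -/
def Respects {α : Type*} (P : Finset α) (e : Sym2 α) : Prop :=
  ∀ p ∈ e, ∀ q ∈ e, p ∈ P → q ∈ P

/-- The points of `S` that precede `x` in the order given by `g`. -/
def below {α : Type*} (S : Finset α) (g : α → ℝ) (x : α) : Finset α :=
  S.filter fun p => g p < g x

section Combinatorics

lemma mem_below {α : Type*} {S : Finset α} {g : α → ℝ} {x p : α} :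
    p ∈ below S g x ↔ p ∈ S ∧ g p < g x := by
  simp [below]

lemma below_subset {α : Type*} (S : Finset α) (g : α → ℝ) (x : α) : below S g x ⊆ S :=
  Finset.filter_subset _ _

variable {α : Type*} [DecidableEq α]

lemma exists_labelling (X : Finset α) (H : Finset (Sym2 α)) :
    ∃ c : α → α, (∀ e ∈ H, ∀ p ∈ e, ∀ q ∈ e, c p = c q) ∧
      X.card ≤ (X.image c).card + H.card := by
  induction H using Finset.induction_on with
  | empty => exact ⟨id, by simp, by simp⟩
  | insert e H he ih =>
    obtain ⟨c, hc, hcard⟩ := ih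
    induction e using Sym2.ind with
    | _ a b =>
    refine ⟨fun p => if c p = c a then c b else c p, ?_, ?_⟩
    · intro e' he' p hp q hq
      rcases Finset.mem_insert.1 he' with rfl | he'
      · rw [Sym2.mem_iff] at hp hq
        rcases hp with rfl | rfl <;> rcases hq with rfl | rfl <;> simp
      · simp only [hc e' he' p hp q hq]
    · have hsub : X.image c ⊆
          insert (c a) (X.image fun p => if c p = c a then c b else c p) := by
        intro y hy
        obtain ⟨p, hp, rfl⟩ := Finset.mem_image.1 hy
        by_cases h : c p = c a
        · simp [h]
        · exact Finset.mem_insert_of_mem (Finset.mem_image.2 ⟨p, hp, by simp [h]⟩)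
      have h1 := (Finset.card_le_card hsub).trans (Finset.card_insert_le _ _)
      rw [Finset.card_insert_of_notMem he]
      omega

lemma exists_subset_sum_eq_s8 {ι : Type*} [DecidableEq ι] (s : Finset ι) (a : ι → ℕ)
    (ha : ∀ i ∈ s, 1 ≤ a i) (hs : ∑ i ∈ s, a i < 2 * s.card) (t : ℕ) (ht : t ≤ ∑ i ∈ s, a i) :
    ∃ r ⊆ s, ∑ i ∈ r, a i = t := by
  induction hk : s.card generalizing s t with
  | zero => omega
  | succ k ih =>
    by_cases h : ∃ i ∈ s, 2 ≤ a i
    · obtain ⟨i, hi, hai⟩ := h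
      have hsum := Finset.add_sum_erase s a hi
      have hcard : (s.erase i).card = k := by rw [Finset.card_erase_of_mem hi, hk]; rfl
      have hle : (s.erase i).card ≤ ∑ j ∈ s.erase i, a j := by
        simpa using Finset.card_nsmul_le_sum (s.erase i) a 1
          fun j hj => ha j (Finset.mem_of_mem_erase hj)
      have ih' := ih (s.erase i) (fun j hj => ha j (Finset.mem_of_mem_erase hj)) (by omega)
      by_cases htl : t ≤ ∑ j ∈ s.erase i, a j
      · obtain ⟨r, hr, hrs⟩ := ih' t htl hcard
        exact ⟨r, hr.trans (Finset.erase_subset _ _), hrs⟩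
      · obtain ⟨r, hr, hrs⟩ := ih' (t - a i) (by omega) hcard
        refine ⟨insert i r, Finset.insert_subset hi (hr.trans (Finset.erase_subset _ _)), ?_⟩
        rw [Finset.sum_insert fun h => Finset.notMem_erase i s (hr h), hrs]
        omega
    · push Not at h
      have h1 : ∀ i ∈ s, a i = 1 := fun i hi => le_antisymm (Nat.le_of_lt_succ (h i hi)) (ha i hi)
      rw [Finset.sum_congr rfl h1] at ht
      obtain ⟨r, hr, hrc⟩ := Finset.exists_subset_card_eq (by simpa using ht : t ≤ s.card)
      exact ⟨r, hr, by rw [Finset.sum_congr rfl fun i hi => h1 i (hr hi)]; simpa using hrc⟩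

lemma card_filter_mem_image (X : Finset α) (c : α → α) (r : Finset α) :
    (X.filter fun p => c p ∈ r).card = ∑ y ∈ r, (X.filter fun p => c p = y).card := by
  rw [Finset.card_eq_sum_card_fiberwise (f := c) (t := r)
    fun p hp => by rw [Finset.mem_coe, Finset.mem_filter] at hp; exact hp.2]
  refine Finset.sum_congr rfl fun y hy => ?_
  congr 1
  ext p
  simp only [Finset.mem_filter]
  constructor
  · rintro ⟨⟨h1, -⟩, h2⟩; exact ⟨h1, h2⟩
  · rintro ⟨h1, rfl⟩; exact ⟨⟨h1, hy⟩, rfl⟩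

/-- If no union of fibres of `c` contains exactly half of the points, then one fibre contains all
but `n - 1` of the points and all other fibres are singletons. -/
lemma fibre_structure {n : ℕ} {X : Finset α} (hX : X.card = 2 * n) (c : α → α)
    (hhalf : ∀ r : Finset α, (X.filter fun p => c p ∈ r).card ≠ n)
    (hn : n ≤ (X.image c).card) {v : α} (hv : v ∈ X)
    (h3 : 3 ≤ (X.filter fun p => c p = c v).card) :
    (X.filter fun p => c p = c v).card = n + 1 ∧ (X.image c).card = n ∧
      ∀ p ∈ X, c p ≠ c v → (X.filter fun q => c q = c p).card = 1 := by
  set a : α → ℕ := fun y => (X.filter fun p => c p = y).card with ha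
  have hpos : ∀ y ∈ X.image c, 1 ≤ a y := by
    intro y hy
    obtain ⟨p, hp, rfl⟩ := Finset.mem_image.1 hy
    exact Finset.card_pos.2 ⟨p, by simp [hp]⟩
  have htot : ∑ y ∈ X.image c, a y = 2 * n := by
    rw [← hX, ← card_filter_mem_image]
    congr 1
    exact Finset.filter_true_of_mem fun p hp => Finset.mem_image_of_mem c hp
  have hvi : c v ∈ X.image c := Finset.mem_image_of_mem c hv
  have hsum := Finset.add_sum_erase _ a hvi
  have hcard := Finset.card_erase_add_one hvi
  have hpos' : ∀ y ∈ (X.image c).erase (c v), 1 ≤ a y :=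
    fun y hy => hpos y (Finset.mem_of_mem_erase hy)
  have hle : ((X.image c).erase (c v)).card ≤ ∑ y ∈ (X.image c).erase (c v), a y := by
    simpa using Finset.card_nsmul_le_sum _ a 1 hpos'
  have hav : a (c v) = (X.filter fun p => c p = c v).card := rfl
  have hbig : n < a (c v) := by
    by_contra hlt
    obtain ⟨r, -, hr⟩ := exists_subset_sum_eq_s8 _ a hpos' (by omega) n (by omega)
    exact hhalf r (by rw [card_filter_mem_image]; exact hr)
  refine ⟨by omega, by omega, fun p hp hpv => ?_⟩
  have hpe : c p ∈ (X.image c).erase (c v) :=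
    Finset.mem_erase.2 ⟨hpv, Finset.mem_image_of_mem c hp⟩
  have heq : ∑ y ∈ (X.image c).erase (c v), 1 = ∑ y ∈ (X.image c).erase (c v), a y := by
    rw [Finset.sum_const, smul_eq_mul]; omega
  exact ((Finset.sum_eq_sum_iff_of_le hpos').1 heq _ hpe).symm

/-- The edges of `H` form a tree with vertex set `A`: they span `A`, connect `A`, and the removal
of any one of them disconnects its endpoints. -/
structure IsTreeOn (H : Finset (Sym2 α)) (A : Finset α) : Prop where
  mem : ∀ e ∈ H, ∀ p ∈ e, p ∈ A
  connected : ∀ I ⊆ A, (∀ e ∈ H, Respects I e) → I = ∅ ∨ I = A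
  cut : ∀ p q, s(p, q) ∈ H →
    ∃ T ⊆ A, p ∈ T ∧ q ∉ T ∧ ∀ f ∈ H, f ≠ s(p, q) → Respects T f

lemma respects_union {P Q A : Finset α} {e : Sym2 α} (hP : Respects P e) (heA : ∀ p ∈ e, p ∈ A)
    (hQ : Disjoint Q A) : Respects (P ∪ Q) e := by
  intro p hp q hq hpP
  rcases Finset.mem_union.1 hpP with h | h
  · exact Finset.mem_union_left _ (hP p hp q hq h)
  · exact absurd (heA p hp) (Finset.disjoint_left.1 hQ h)

lemma exists_tree {n : ℕ} {X : Finset α} (hX : X.card = 2 * n) {H : Finset (Sym2 α)}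
    (hHX : ∀ e ∈ H, ¬ e.IsDiag ∧ ∀ p ∈ e, p ∈ X) (hH : H.card = n)
    (hhalf : ∀ P ⊆ X, P.card = n → ∃ e ∈ H, ¬ Respects P e)
    {u v w : α} (huv : s(u, v) ∈ H) (hwv : s(w, v) ∈ H) (huw : u ≠ w) :
    ∃ A ⊆ X, A.card = n + 1 ∧ IsTreeOn H A := by
  have hmem : ∀ {p q}, s(p, q) ∈ H → p ∈ X ∧ q ∈ X ∧ p ≠ q := fun {p q} h =>
    ⟨(hHX _ h).2 p (by simp), (hHX _ h).2 q (by simp), by simpa using (hHX _ h).1⟩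
  have key : ∀ c : α → α, (∀ e ∈ H, ∀ p ∈ e, ∀ q ∈ e, c p = c q) → n ≤ (X.image c).card →
      (X.filter fun p => c p = c v).card = n + 1 ∧ (X.image c).card = n ∧
      ∀ p ∈ X, c p ≠ c v → (X.filter fun q => c q = c p).card = 1 := by
    intro c hc hn
    refine fibre_structure hX c (fun r hr => ?_) hn (hmem huv).2.1 ?_
    · obtain ⟨e, he, hne⟩ := hhalf _ (Finset.filter_subset _ _) hr
      refine hne fun p hp q hq hpP => ?_
      rw [Finset.mem_filter] at hpP ⊢
      exact ⟨(hHX e he).2 q hq, hc e he p hp q hq ▸ hpP.2⟩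
    · have h3 : ({u, v, w} : Finset α).card = 3 :=
        Finset.card_eq_three.2 ⟨u, v, w, (hmem huv).2.2, huw, (hmem hwv).2.2.symm, rfl⟩
      rw [← h3]
      refine Finset.card_le_card fun p hp => ?_
      simp only [Finset.mem_insert, Finset.mem_singleton] at hp
      rw [Finset.mem_filter]
      rcases hp with rfl | rfl | rfl
      · exact ⟨(hmem huv).1, hc _ huv _ (by simp) _ (by simp)⟩
      · exact ⟨(hmem huv).2.1, rfl⟩
      · exact ⟨(hmem hwv).1, hc _ hwv _ (by simp) _ (by simp)⟩
  obtain ⟨c, hc, hcard⟩ := exists_labelling X H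
  obtain ⟨hA, -, hsing⟩ := key c hc (by omega)
  set A := X.filter fun p => c p = c v with hAdef
  have hAX : A ⊆ X := Finset.filter_subset _ _
  have hHA : ∀ e ∈ H, ∀ p ∈ e, p ∈ A := by
    intro e he p hp
    by_contra hpA
    have hpX := (hHX e he).2 p hp
    have h1 := hsing p hpX fun h => hpA (Finset.mem_filter.2 ⟨hpX, h⟩)
    obtain ⟨q, rfl⟩ := Sym2.mem_iff_exists.1 hp
    have := Finset.card_le_one.1 h1.le p (by simp [hpX]) q
      (by simp [(hmem he).2.1, hc _ he q (by simp) p (by simp)])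
    exact (hmem he).2.2 this
  refine ⟨A, hAX, hA, hHA, ?_, ?_⟩
  · intro I hI hresp
    by_contra hcon
    push Not at hcon
    obtain ⟨hne, hneA⟩ := hcon
    have h1 : 0 < I.card := Finset.card_pos.2 hne
    have h2 : I.card < A.card := Finset.card_lt_card (hI.ssubset_of_ne hneA)
    have h3 : (X \ A).card = n - 1 := by rw [Finset.card_sdiff_of_subset hAX]; omega
    obtain ⟨Q, hQ, hQc⟩ := Finset.exists_subset_card_eq (by omega : n - I.card ≤ (X \ A).card)
    have hQA : Disjoint Q A := Finset.disjoint_of_subset_left hQ Finset.sdiff_disjoint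
    obtain ⟨e, he, hne⟩ := hhalf (I ∪ Q)
      (Finset.union_subset (hI.trans hAX) (hQ.trans Finset.sdiff_subset))
      (by rw [Finset.card_union_of_disjoint (Finset.disjoint_of_subset_left hI hQA.symm)]; omega)
    exact hne (respects_union (hresp e he) (hHA e he) hQA)
  · intro p q hpq
    obtain ⟨d, hd, hdcard⟩ := exists_labelling X (H.erase s(p, q))
    have hHpos := Finset.card_erase_add_one hpq
    have hdpq : d p ≠ d q := by
      intro h
      have := (key d (fun e he x hx y hy => ?_) (by omega)).2.1
      · omega
      · by_cases hepq : e = s(p, q)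
        · subst hepq
          rw [Sym2.mem_iff] at hx hy
          rcases hx with rfl | rfl <;> rcases hy with rfl | rfl <;> simp [h]
        · exact hd e (Finset.mem_erase.2 ⟨hepq, he⟩) x hx y hy
    refine ⟨A.filter fun x => d x = d p, Finset.filter_subset _ _,
      Finset.mem_filter.2 ⟨hHA _ hpq p (by simp), rfl⟩,
      fun h => hdpq (Finset.mem_filter.1 h).2.symm, fun f hf hne x hx y hy hxT => ?_⟩
    rw [Finset.mem_filter] at hxT ⊢
    exact ⟨hHA f hf y hy, hd f (Finset.mem_erase.2 ⟨hne, hf⟩) x hx y hy ▸ hxT.2⟩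

/-- Sweeping `S` in the order of `g`: if `P` is a strict majority of `S`, then some point of `P`
is preceded by equally many points inside and outside `P`. -/
lemma exists_balanced_below (P : Finset α) (g : α → ℝ) (S : Finset α) (hg : Set.InjOn g S)
    (hS : S.card < 2 * (S ∩ P).card) :
    ∃ x ∈ S, x ∈ P ∧ 2 * (below S g x ∩ P).card = (below S g x).card := by
  induction S using Finset.induction_on_max_value g with
  | empty => simp at hS
  | insert a S haS hmax ih =>
    have hlt : ∀ x ∈ S, g x < g a := fun x hx => lt_of_le_of_ne (hmax x hx) fun h =>
      haS (hg (by simp [hx]) (by simp) h ▸ hx)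
    by_cases hmaj : S.card < 2 * (S ∩ P).card
    · obtain ⟨x, hx, hxP, hbal⟩ := ih (hg.mono (by simp)) hmaj
      have hb : below (insert a S) g x = below S g x := by
        ext p
        simp only [mem_below, Finset.mem_insert]
        constructor
        · rintro ⟨rfl | h, hp⟩
          · exact absurd hp (hlt x hx).not_gt
          · exact ⟨h, hp⟩
        · exact fun h => ⟨Or.inr h.1, h.2⟩
      exact ⟨x, by simp [hx], hxP, by rw [hb]; exact hbal⟩
    · rw [Finset.card_insert_of_notMem haS] at hS
      by_cases haP : a ∈ P
      · have hb : below (insert a S) g a = S := by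
          ext p
          simp only [mem_below, Finset.mem_insert]
          constructor
          · rintro ⟨rfl | h, hp⟩
            · exact absurd hp (lt_irrefl _)
            · exact h
          · exact fun h => ⟨Or.inr h, hlt p h⟩
        rw [Finset.insert_inter_of_mem haP,
          Finset.card_insert_of_notMem fun h => haS (Finset.mem_inter.1 h).1] at hS
        exact ⟨a, by simp, haP, by rw [hb]; omega⟩
      · rw [Finset.insert_inter_of_notMem haP] at hS
        omega

lemma card_inter_eq_below_add {S : Finset α} {g : α → ℝ} (hg : Set.InjOn g S) {x : α}
    (hx : x ∈ S) (D : Finset α) :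
    (S ∩ D).card =
      (below S g x ∩ D).card + (below S (-g) x ∩ D).card + if x ∈ D then 1 else 0 := by
  have hx' : ({x} ∩ D).card = if x ∈ D then 1 else 0 := by
    by_cases h : x ∈ D <;> simp [h]
  have hS : S ∩ D = (below S g x ∩ D) ∪ (below S (-g) x ∩ D) ∪ ({x} ∩ D) := by
    ext p
    simp only [Finset.mem_union, Finset.mem_inter, mem_below, Finset.mem_singleton, Pi.neg_apply,
      neg_lt_neg_iff]
    constructor
    · rintro ⟨hp, hD⟩
      rcases lt_trichotomy (g p) (g x) with h | h | h
      · exact Or.inl (Or.inl ⟨⟨hp, h⟩, hD⟩)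
      · exact Or.inr ⟨hg hp hx h, hD⟩
      · exact Or.inl (Or.inr ⟨⟨hp, h⟩, hD⟩)
    · rintro ((⟨⟨h, -⟩, hD⟩ | ⟨⟨h, -⟩, hD⟩) | ⟨rfl, hD⟩)
      exacts [⟨h, hD⟩, ⟨h, hD⟩, ⟨hx, hD⟩]
  rw [← hx', hS, Finset.card_union_of_disjoint, Finset.card_union_of_disjoint]
  · refine Finset.disjoint_left.2 fun p hp hp' => ?_
    simp only [Finset.mem_inter, mem_below, Pi.neg_apply, neg_lt_neg_iff] at hp hp'
    exact lt_asymm hp.1.2 hp'.1.2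
  · refine Finset.disjoint_left.2 fun p hp hp' => ?_
    simp only [Finset.mem_union, Finset.mem_inter, mem_below, Pi.neg_apply, neg_lt_neg_iff,
      Finset.mem_singleton] at hp hp'
    obtain ⟨rfl, -⟩ := hp'
    simp at hp

lemma card_eq_below_add {S : Finset α} {g : α → ℝ} (hg : Set.InjOn g S) {x : α}
    (hx : x ∈ S) : S.card = (below S g x).card + (below S (-g) x).card + 1 := by
  have h := card_inter_eq_below_add hg hx S
  rwa [Finset.inter_self, if_pos hx, Finset.inter_eq_left.2 (below_subset S g x),
    Finset.inter_eq_left.2 (below_subset S (-g) x)] at h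

/-- Every half `P` of the `2 * n` points of `X` which does not contain `v` and is separated by `H`
only at `v` has its balanced points, in the order given by `g`, among the `H`-neighbours
of `v`. -/
def BalancedAdj (n : ℕ) (X : Finset α) (H : Finset (Sym2 α)) (v : α) (g : α → ℝ) : Prop :=
  ∀ P ⊆ X, P.card = n → v ∉ P → (∀ e ∈ H, v ∉ e → Respects P e) → ∀ x ∈ P,
    2 * (below (X.erase v) g x ∩ P).card = (below (X.erase v) g x).card → s(v, x) ∈ H

section Sweep

variable {n : ℕ} {X A : Finset α} {H : Finset (Sym2 α)} {v : α} {g : α → ℝ}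

lemma erase_inter_of_notMem {P : Finset α} (hPX : P ⊆ X) (hvP : v ∉ P) : X.erase v ∩ P = P :=
  Finset.inter_eq_right.2 (Finset.subset_erase.2 ⟨hPX, hvP⟩)

lemma BalancedAdj.neg (hX : X.card = 2 * n) (hv : v ∈ X) (hg : Set.InjOn g (X.erase v))
    (h : BalancedAdj n X H v g) : BalancedAdj n X H v (-g) := by
  intro P hPX hPc hvP hresp x hx hbal
  refine h P hPX hPc hvP hresp x hx ?_
  have hxS : x ∈ X.erase v := Finset.mem_erase.2 ⟨fun h => hvP (h ▸ hx), hPX hx⟩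
  have h1 := card_inter_eq_below_add hg hxS P
  have h2 := card_eq_below_add hg hxS
  rw [erase_inter_of_notMem hPX hvP, if_pos hx] at h1
  rw [Finset.card_erase_of_mem hv] at h2
  omega

/-- A majority of a part `T ∪ Q` in an initial segment `S` is only possible if `S` contains the
end `u` of the edge cut by `T`, and if `u` is balanced. -/
lemma balanced_of_cut (hAX : A ⊆ X) (hT : IsTreeOn H A) (hg : Set.InjOn g (X.erase v))
    (hadj : BalancedAdj n X H v g) {u : α} {T Q : Finset α}
    (hTA : T ⊆ A) (hvT : v ∉ T) (hresp : ∀ f ∈ H, f ≠ s(u, v) → Respects T f) (hvA : v ∈ A)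
    (hQ : Q ⊆ X \ A) (hcard : T.card + Q.card = n) {S : Finset α} (hS : S ⊆ X.erase v)
    (hlow : ∀ p ∈ X.erase v, ∀ q ∈ S, g p < g q → p ∈ S)
    (hmaj : S.card < 2 * (S ∩ (T ∪ Q)).card) :
    u ∈ S ∧ 2 * (below (X.erase v) g u ∩ (T ∪ Q)).card = (below (X.erase v) g u).card := by
  obtain ⟨x, hxS, hxP, hbal⟩ :=
    exists_balanced_below (T ∪ Q) g S (hg.mono (Finset.coe_subset.2 hS)) hmaj
  have hQA : Disjoint Q A := Finset.disjoint_of_subset_left hQ Finset.sdiff_disjoint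
  have hb : below S g x = below (X.erase v) g x := by
    ext p
    simp only [mem_below]
    exact ⟨fun h => ⟨hS h.1, h.2⟩, fun h => ⟨hlow p h.1 x hxS h.2, h.2⟩⟩
  rw [hb] at hbal
  have hvx : s(v, x) ∈ H := by
    refine hadj (T ∪ Q) (Finset.union_subset (hTA.trans hAX) (hQ.trans Finset.sdiff_subset)) ?_ ?_
      ?_ x hxP hbal
    · rw [Finset.card_union_of_disjoint (Finset.disjoint_of_subset_left hTA hQA.symm), hcard]
    · exact fun h => (Finset.mem_union.1 h).elim hvT fun h => Finset.disjoint_left.1 hQA h hvA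
    · refine fun e he hve => respects_union (hresp e he ?_) (hT.mem e he) hQA
      rintro rfl
      simp at hve
  have hxT : x ∈ T := (Finset.mem_union.1 hxP).resolve_right fun h =>
    Finset.disjoint_left.1 hQA h (hT.mem _ hvx x (by simp))
  have hxu : x = u := by
    by_contra hne
    refine hvT (hresp _ hvx (fun h => ?_) x (by simp) v (by simp) hxT)
    rw [Sym2.eq_swap, Sym2.congr_left] at h
    exact hne h
  exact hxu ▸ ⟨hxS, hbal⟩

lemma card_inter_union {L T Q : Finset α} (h : Disjoint T Q) :
    (L ∩ (T ∪ Q)).card = (L ∩ T).card + (L ∩ Q).card := by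
  rw [Finset.inter_union_distrib_left, Finset.card_union_of_disjoint]
  exact h.mono Finset.inter_subset_right Finset.inter_subset_right

/-- The balance forced by the cut `T` of the edge `s(u, v)`, for every choice of the isolated
points `Q` completing `T` to half of the points. -/
lemma balanced_union_of_cut (hX : X.card = 2 * n) (hAX : A ⊆ X) (hT : IsTreeOn H A)
    (hg : Set.InjOn g (X.erase v)) (hadj : BalancedAdj n X H v g) {u : α} {T Q : Finset α}
    (hTA : T ⊆ A) (hvT : v ∉ T) (hresp : ∀ f ∈ H, f ≠ s(u, v) → Respects T f) (hvA : v ∈ A)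
    (hQ : Q ⊆ X \ A) (hcard : T.card + Q.card = n) :
    2 * ((below (X.erase v) g u ∩ T).card + (below (X.erase v) g u ∩ Q).card) =
      (below (X.erase v) g u).card := by
  have hQA : Disjoint Q A := Finset.disjoint_of_subset_left hQ Finset.sdiff_disjoint
  have hTQ : Disjoint T Q := Finset.disjoint_of_subset_left hTA hQA.symm
  rw [← card_inter_union hTQ]
  refine (balanced_of_cut hAX hT hg hadj hTA hvT hresp hvA hQ hcard subset_rfl
    (fun p hp _ _ _ => hp) ?_).2
  rw [erase_inter_of_notMem (Finset.union_subset (hTA.trans hAX) (hQ.trans Finset.sdiff_subset))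
    fun h => (Finset.mem_union.1 h).elim hvT fun h => Finset.disjoint_left.1 hQA h hvA,
    Finset.card_union_of_disjoint hTQ, Finset.card_erase_of_mem (hAX hvA)]
  have := Finset.card_pos.2 ⟨v, hAX hvA⟩
  omega

lemma IsTreeOn.disjoint_cuts (hT : IsTreeOn H A) (hvA : v ∈ A) {u w : α} (huw : u ≠ w)
    (huv : s(u, v) ∈ H) (hwv : s(w, v) ∈ H) {T T' : Finset α} (hTA : T ⊆ A) (hvT : v ∉ T)
    (hresp : ∀ f ∈ H, f ≠ s(u, v) → Respects T f) (hvT' : v ∉ T')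
    (hresp' : ∀ f ∈ H, f ≠ s(w, v) → Respects T' f) : Disjoint T T' := by
  have hne : s(u, v) ≠ s(w, v) := fun h => huw (Sym2.congr_left.1 h)
  have huT' : u ∉ T' := fun h => hvT' (hresp' _ huv hne u (by simp) v (by simp) h)
  have hwT : w ∉ T := fun h => hvT (hresp _ hwv hne.symm w (by simp) v (by simp) h)
  rw [Finset.disjoint_iff_inter_eq_empty]
  refine (hT.connected (T ∩ T') (Finset.inter_subset_left.trans hTA) ?_).resolve_right
    fun h => hvT (Finset.mem_inter.1 (h ▸ hvA)).1
  intro e he p hp q hq hpI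
  rw [Finset.mem_inter] at hpI ⊢
  have h1 : e ≠ s(u, v) := by
    rintro rfl
    rcases Sym2.mem_iff.1 hp with rfl | rfl
    exacts [huT' hpI.2, hvT hpI.1]
  have h2 : e ≠ s(w, v) := by
    rintro rfl
    rcases Sym2.mem_iff.1 hp with rfl | rfl
    exacts [hwT hpI.1, hvT hpI.1]
  exact ⟨hresp e he h1 p hp q hq hpI.1, hresp' e he h2 p hp q hq hpI.2⟩

/-- If all points outside the tree precede `u`, then no point follows `u`. -/
lemma below_neg_eq_empty (hX : X.card = 2 * n) (hAX : A ⊆ X) (hA : A.card = n + 1)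
    (hT : IsTreeOn H A) (hg : Set.InjOn g (X.erase v)) (hadj : BalancedAdj n X H v g) {u : α}
    (huv : s(u, v) ∈ H) (hne : u ≠ v) (hside : X \ A ⊆ below (X.erase v) g u) :
    below (X.erase v) (-g) u = ∅ := by
  by_contra hR
  have huA := hT.mem _ huv u (by simp)
  have hvA := hT.mem _ huv v (by simp)
  have hvX := hAX hvA
  have huS : u ∈ X.erase v := Finset.mem_erase.2 ⟨hne, hAX huA⟩
  have hS : (X.erase v).card = 2 * n - 1 := by rw [Finset.card_erase_of_mem hvX, hX]
  have hXA : (X \ A).card = n - 1 := by rw [Finset.card_sdiff_of_subset hAX]; omega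
  have hcardcut : ∀ T ⊆ A, v ∉ T → T.card ≤ n := fun T hTA hvT => by
    have := Finset.card_lt_card (hTA.ssubset_of_ne fun h => hvT (h ▸ hvA))
    omega
  obtain ⟨T, hTA, huT, hvT, hresp⟩ := hT.cut u v huv
  have hTn := hcardcut T hTA hvT
  have hTpos := Finset.card_pos.2 ⟨u, huT⟩
  obtain ⟨Q, hQ, hQc⟩ := Finset.exists_subset_card_eq (by omega : n - T.card ≤ (X \ A).card)
  have hbal := balanced_union_of_cut hX hAX hT hg hadj hTA hvT hresp hvA hQ (by omega)
  rw [Finset.inter_eq_right.2 (hQ.trans hside)] at hbal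
  have hcT := card_inter_eq_below_add hg huS T
  rw [erase_inter_of_notMem (hTA.trans hAX) hvT, if_pos huT] at hcT
  have hcS := card_eq_below_add hg huS
  set L := below (X.erase v) g u with hL
  set R := below (X.erase v) (-g) u with hRdef
  have hLR : Disjoint L R := Finset.disjoint_left.2 fun p hp hp' => by
    rw [hL, mem_below] at hp
    rw [hRdef, mem_below, Pi.neg_apply, Pi.neg_apply, neg_lt_neg_iff] at hp'
    exact lt_asymm hp.2 hp'.2
  obtain ⟨w, hwR, hwmax⟩ := Finset.exists_max_image R g (Finset.nonempty_iff_ne_empty.2 hR)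
  have hwR' := hwR
  rw [hRdef, mem_below, Pi.neg_apply, Pi.neg_apply, neg_lt_neg_iff] at hwR'
  obtain ⟨hwS, huw⟩ := hwR'
  have hwmax' : below (X.erase v) (-g) w = ∅ := by
    refine Finset.eq_empty_of_forall_notMem fun p hp => ?_
    rw [mem_below, Pi.neg_apply, Pi.neg_apply, neg_lt_neg_iff] at hp
    exact absurd (hwmax p (mem_below.2 ⟨hp.1, neg_lt_neg (huw.trans hp.2)⟩)) hp.2.not_ge
  have hwA : w ∈ A := by
    by_contra h
    exact Finset.disjoint_left.1 hLR
      (hside (Finset.mem_sdiff.2 ⟨Finset.mem_of_mem_erase hwS, h⟩)) hwR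
  have hwv : w ≠ v := Finset.ne_of_mem_erase hwS
  have hvw : s(v, w) ∈ H := by
    have hwP : w ∈ A.erase v := Finset.mem_erase.2 ⟨hwv, hwA⟩
    have hPX : A.erase v ⊆ X := (Finset.erase_subset _ _).trans hAX
    have hPc : (A.erase v).card = n := by rw [Finset.card_erase_of_mem hvA, hA]; rfl
    refine hadj (A.erase v) hPX hPc (Finset.notMem_erase v A) ?_ w hwP ?_
    · exact fun e he hve p _ q hq _ =>
        Finset.mem_erase.2 ⟨fun h => hve (h ▸ hq), hT.mem e he q hq⟩
    · have h1 := card_inter_eq_below_add hg hwS (A.erase v)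
      have h2 := card_eq_below_add hg hwS
      rw [erase_inter_of_notMem hPX (Finset.notMem_erase v A), if_pos hwP, hwmax'] at h1
      rw [hwmax'] at h2
      simp only [Finset.empty_inter, Finset.card_empty] at h1 h2
      omega
  rw [Sym2.eq_swap] at hvw
  obtain ⟨T', hTA', hwT', hvT', hresp'⟩ := hT.cut w v hvw
  have hTn' := hcardcut T' hTA' hvT'
  have hTpos' := Finset.card_pos.2 ⟨w, hwT'⟩
  obtain ⟨Q', hQ', hQc'⟩ := Finset.exists_subset_card_eq (by omega : n - T'.card ≤ (X \ A).card)
  have hdisj := hT.disjoint_cuts hvA (fun h => huw.ne (by rw [h])) huv hvw hTA hvT hresp hvT' hresp'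
  have hQA' : Disjoint Q' A := Finset.disjoint_of_subset_left hQ' Finset.sdiff_disjoint
  have hTQ' : Disjoint T' Q' := Finset.disjoint_of_subset_left hTA' hQA'.symm
  have hRS : R ⊆ X.erase v := below_subset _ _ _
  refine (Finset.mem_sdiff.1 (balanced_of_cut hAX hT hg hadj hTA' hvT' hresp' hvA hQ' (by omega)
    (S := X.erase v \ R) Finset.sdiff_subset ?_ ?_).1).2 hwR
  · intro p hp q hq hpq
    refine Finset.mem_sdiff.2 ⟨hp, fun hpR => (Finset.mem_sdiff.1 hq).2 ?_⟩
    rw [hRdef, mem_below, Pi.neg_apply, Pi.neg_apply, neg_lt_neg_iff] at hpR ⊢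
    exact ⟨(Finset.mem_sdiff.1 hq).1, hpR.2.trans hpq⟩
  · have h1 : (X.erase v \ R).card + R.card = (X.erase v).card :=
      Finset.card_sdiff_add_card_eq_card hRS
    have h2 : ((X.erase v \ R) ∩ (T' ∪ Q')).card + (R ∩ (T' ∪ Q')).card = n := by
      rw [← Finset.card_union_of_disjoint, ← Finset.union_inter_distrib_right,
        Finset.sdiff_union_of_subset hRS, erase_inter_of_notMem, Finset.card_union_of_disjoint hTQ']
      · omega
      · exact Finset.union_subset (hTA'.trans hAX) (hQ'.trans Finset.sdiff_subset)
      · exact fun h => (Finset.mem_union.1 h).elim hvT' fun h => Finset.disjoint_left.1 hQA' h hvA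
      · exact Finset.sdiff_disjoint.mono Finset.inter_subset_left Finset.inter_subset_left
    rw [card_inter_union (L := R) hTQ', (Finset.disjoint_iff_inter_eq_empty.1
      (hLR.symm.mono_right (hQ'.trans hside)) : R ∩ Q' = ∅), Finset.card_empty] at h2
    have h3 : (R ∩ T).card + (R ∩ T').card ≤ R.card := by
      rw [← card_inter_union hdisj]
      exact Finset.card_le_card Finset.inter_subset_left
    omega

lemma balanced_of_side (hX : X.card = 2 * n) (hAX : A ⊆ X) (hA : A.card = n + 1)
    (hT : IsTreeOn H A) (hg : Set.InjOn g (X.erase v)) (hadj : BalancedAdj n X H v g) {u : α}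
    (huv : s(u, v) ∈ H) (hne : u ≠ v) (hside : X \ A ⊆ below (X.erase v) g u) :
    2 * (below (X.erase v) g u ∩ A).card = (below (X.erase v) g u).card := by
  have huA := hT.mem _ huv u (by simp)
  have hvA := hT.mem _ huv v (by simp)
  have huS : u ∈ X.erase v := Finset.mem_erase.2 ⟨hne, hAX huA⟩
  have hR := below_neg_eq_empty hX hAX hA hT hg hadj huv hne hside
  have h1 := card_inter_eq_below_add hg huS A
  have h2 := card_eq_below_add hg huS
  rw [if_pos huA, hR, Finset.erase_inter, Finset.inter_eq_right.2 hAX,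
    Finset.card_erase_of_mem hvA] at h1
  rw [hR, Finset.card_erase_of_mem (hAX hvA)] at h2
  simp only [Finset.empty_inter, Finset.card_empty] at h1 h2
  omega

/-- Among the points before `u`, and among those after `u`, exactly half belong to the tree. -/
lemma balanced_of_tree (hX : X.card = 2 * n) (hAX : A ⊆ X) (hA : A.card = n + 1)
    (hT : IsTreeOn H A) (hg : Set.InjOn g (X.erase v)) (hadj : BalancedAdj n X H v g) {u w : α}
    (huv : s(u, v) ∈ H) (hwv : s(w, v) ∈ H) (huw : u ≠ w) (hne : u ≠ v) (hwne : w ≠ v) :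
    2 * (below (X.erase v) g u ∩ A).card = (below (X.erase v) g u).card ∧
      2 * (below (X.erase v) (-g) u ∩ A).card = (below (X.erase v) (-g) u).card := by
  have huA := hT.mem _ huv u (by simp)
  have hvA := hT.mem _ huv v (by simp)
  have hwA := hT.mem _ hwv w (by simp)
  have huS : u ∈ X.erase v := Finset.mem_erase.2 ⟨hne, hAX huA⟩
  have hcA := card_inter_eq_below_add hg huS A
  have hcS := card_eq_below_add hg huS
  rw [if_pos huA, Finset.erase_inter, Finset.inter_eq_right.2 hAX,
    Finset.card_erase_of_mem hvA] at hcA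
  rw [Finset.card_erase_of_mem (hAX hvA)] at hcS
  suffices h : 2 * (below (X.erase v) g u ∩ A).card = (below (X.erase v) g u).card ∨
      2 * (below (X.erase v) (-g) u ∩ A).card = (below (X.erase v) (-g) u).card by omega
  have hXA : (X \ A).card = n - 1 := by rw [Finset.card_sdiff_of_subset hAX]; omega
  obtain ⟨T, hTA, huT, hvT, hresp⟩ := hT.cut u v huv
  have hwT : w ∉ T := fun h => hvT (hresp _ hwv (fun h => huw (Sym2.congr_left.1 h).symm)
    w (by simp) v (by simp) h)
  have hTn : T.card + 2 ≤ n + 1 := by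
    rw [← hA, ← Finset.card_pair hwne, ← Finset.card_union_of_disjoint]
    · exact Finset.card_le_card 
        (Finset.union_subset hTA (by simp [Finset.insert_subset_iff, hwA, hvA]))
    · simp [hwT, hvT]
  have hTpos := Finset.card_pos.2 ⟨u, huT⟩
  have hbal : ∀ Q ⊆ X \ A, T.card + Q.card = n → _ := fun Q hQ hQc =>
    balanced_union_of_cut hX hAX hT hg hadj hTA hvT hresp hvA hQ hQc
  by_cases h1 : T.card = 1
  · left
    have h := hbal _ subset_rfl (by omega)
    obtain ⟨y, rfl⟩ := Finset.card_eq_one.1 h1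
    obtain rfl := Finset.mem_singleton.1 huT
    have hLT : below (X.erase v) g u ∩ {u} = ∅ := by
      rw [Finset.inter_singleton_of_notMem]
      simp [mem_below]
    have hLX : below (X.erase v) g u ⊆ X := (below_subset _ _ _).trans (Finset.erase_subset _ _)
    rw [hLT, ← Finset.inter_sdiff_assoc, Finset.inter_eq_left.2 hLX, Finset.card_empty] at h
    have := Finset.card_inter_add_card_sdiff (below (X.erase v) g u) A
    omega
  by_cases hl : ∃ l ∈ X \ A, l ∈ below (X.erase v) g u
  · by_cases hr : ∃ r ∈ X \ A, r ∉ below (X.erase v) g u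
    · exfalso
      obtain ⟨l, hlX, hlL⟩ := hl
      obtain ⟨r, hrX, hrL⟩ := hr
      have hlr : l ≠ r := fun h => hrL (h ▸ hlL)
      have hlrX : {l, r} ⊆ X \ A :=
        Finset.insert_subset hlX (Finset.singleton_subset_iff.2 hrX)
      have hc : ((X \ A) \ {l, r}).card = n - 3 := by
        rw [Finset.card_sdiff_of_subset hlrX, Finset.card_pair hlr, hXA]
        omega
      obtain ⟨Q, hQ, hQc⟩ := Finset.exists_subset_card_eq
        (by omega : n - T.card - 1 ≤ ((X \ A) \ {l, r}).card)
      have hlQ : l ∉ Q := fun h => by simpa using (Finset.mem_sdiff.1 (hQ h)).2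
      have hrQ : r ∉ Q := fun h => by simpa using (Finset.mem_sdiff.1 (hQ h)).2
      have hQX := hQ.trans Finset.sdiff_subset
      have e1 := hbal (insert l Q) (Finset.insert_subset hlX hQX)
        (by rw [Finset.card_insert_of_notMem hlQ]; omega)
      have e2 := hbal (insert r Q) (Finset.insert_subset hrX hQX)
        (by rw [Finset.card_insert_of_notMem hrQ]; omega)
      rw [Finset.inter_insert_of_mem hlL, Finset.card_insert_of_notMem
        fun h => hlQ (Finset.mem_inter.1 h).2] at e1
      rw [Finset.inter_insert_of_notMem hrL] at e2
      omega
    · push Not at hr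
      exact Or.inl (balanced_of_side hX hAX hA hT hg hadj huv hne hr)
  · right
    push Not at hl
    have hg' : Set.InjOn (-g) (X.erase v) := fun p hp q hq h => hg hp hq (neg_injective h)
    refine balanced_of_side hX hAX hA hT hg' (hadj.neg hX (hAX hvA) hg) huv hne fun p hp => ?_
    have hpA := (Finset.mem_sdiff.1 hp).2
    have hpS : p ∈ X.erase v :=
      Finset.mem_erase.2 ⟨fun h => hpA (h ▸ hvA), (Finset.mem_sdiff.1 hp).1⟩
    have hle : g u ≤ g p := not_lt.1 fun h => hl p hp (mem_below.2 ⟨hpS, h⟩)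
    exact mem_below.2 ⟨hpS, neg_lt_neg (hle.lt_of_ne fun h => hpA (hg huS hpS h ▸ huA))⟩

end Sweep

end Combinatorics

section Geometry

lemma cross_swap (a b c : Pt) : cross a c b = -cross a b c := by
  simp only [cross]; ring

lemma cross_left_self (a b : Pt) : cross a b a = 0 := by
  simp only [cross]; ring

lemma cross_right_self (a b : Pt) : cross a b b = 0 := by
  simp only [cross]; ring

lemma cross_combo (a b p q : Pt) {s t : ℝ} (hst : s + t = 1) :
    cross a b (s • p + t • q) = s * cross a b p + t * cross a b q := by
  obtain rfl : t = 1 - s := by linarith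
  simp only [cross, Prod.fst_add, Prod.snd_add, Prod.smul_fst, Prod.smul_snd, smul_eq_mul]
  ring

lemma convex_cross_preimage (a b : Pt) {I : Set ℝ} (hI : Convex ℝ I) :
    Convex ℝ (cross a b ⁻¹' I) := by
  intro p hp q hq s t hs ht hst
  rw [Set.mem_preimage, cross_combo a b p q hst]
  exact hI hp hq hs ht hst

lemma collinear_of_cross_eq_zero {a b c : Pt} (hab : a ≠ b) (h : cross a b c = 0) :
    Collinear ℝ ({a, b, c} : Set Pt) := by
  rw [collinear_iff_of_mem (p₀ := a) (by simp)]
  refine ⟨b - a, fun p hp => ?_⟩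
  simp only [Set.mem_insert_iff, Set.mem_singleton_iff] at hp
  rcases hp with rfl | rfl | rfl
  · exact ⟨0, by simp⟩
  · exact ⟨1, by simp⟩
  · simp only [cross] at h
    by_cases h1 : b.1 - a.1 = 0
    · have h2 : b.2 - a.2 ≠ 0 := fun h2 => hab (Prod.ext (by linarith) (by linarith))
      refine ⟨(p.2 - a.2) / (b.2 - a.2), Prod.ext ?_ ?_⟩
      · have h3 : p.1 - a.1 = 0 := by
          rw [h1, zero_mul, zero_sub, neg_eq_zero] at h
          exact (mul_eq_zero.1 h).resolve_left h2
        simp only [vadd_eq_add, Prod.fst_add, Prod.smul_fst, Prod.fst_sub, smul_eq_mul, h1]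
        linarith
      · simp only [vadd_eq_add, Prod.snd_add, Prod.smul_snd, Prod.snd_sub, smul_eq_mul]
        field_simp
        ring
    · refine ⟨(p.1 - a.1) / (b.1 - a.1), Prod.ext ?_ ?_⟩
      · simp only [vadd_eq_add, Prod.fst_add, Prod.smul_fst, Prod.fst_sub, smul_eq_mul]
        field_simp
        ring
      · simp only [vadd_eq_add, Prod.snd_add, Prod.smul_snd, Prod.snd_sub, smul_eq_mul]
        field_simp
        linarith

lemma GenPos.cross_ne_zero {X : Finset Pt} (hX : GenPos X) {a b c : Pt} (ha : a ∈ X) (hb : b ∈ X)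
    (hc : c ∈ X) (hab : a ≠ b) (hac : a ≠ c) (hbc : b ≠ c) : cross a b c ≠ 0 :=
  fun h => hX a ha b hb c hc hab hac hbc (collinear_of_cross_eq_zero hab h)

lemma GenPos.mono {X Y : Finset Pt} (hX : GenPos X) (h : Y ⊆ X) : GenPos Y :=
  fun a ha b hb c hc => hX a (h ha) b (h hb) c (h hc)

lemma exists_supporting {X : Finset Pt} {v : Pt}
    (hv : v ∈ Set.extremePoints ℝ (convexHull ℝ (X : Set Pt))) :
    ∃ f : Pt →L[ℝ] ℝ, ∀ p ∈ X.erase v, f v < f p := by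
  have hvn : v ∉ convexHull ℝ ((X.erase v : Finset Pt) : Set Pt) := by
    intro h
    refine (((convex_convexHull ℝ _).mem_extremePoints_iff_mem_sdiff_convexHull_sdiff).1 hv).2
      (convexHull_mono ?_ h)
    rw [Finset.coe_erase]
    exact Set.sdiff_subset_sdiff_left (subset_convexHull ℝ _)
  obtain ⟨f, c, hc, hf⟩ := geometric_hahn_banach_point_closed (convex_convexHull ℝ _)
    (Set.Finite.isClosed_convexHull (𝕜 := ℝ) (Finset.finite_toSet (X.erase v))) hvn
  exact ⟨f, fun p hp => hc.trans (hf p (subset_convexHull ℝ _ hp))⟩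

/-- Around an extreme point `v`, the other points of `X` are ordered by the slopes of the lines
joining them to `v`. -/
lemma exists_angular_order {X : Finset Pt} (hX : GenPos X) {v : Pt}
    (hv : v ∈ Set.extremePoints ℝ (convexHull ℝ (X : Set Pt))) :
    ∃ g : Pt → ℝ, Set.InjOn g (X.erase v) ∧ ∀ x ∈ X.erase v,
      below (X.erase v) g x = (X.filter fun p => cross v x p < 0) ∧
      below (X.erase v) (-g) x = X.filter fun p => 0 < cross v x p := by
  have hvX : v ∈ X := extremePoints_convexHull_subset hv
  obtain ⟨f, hf⟩ := exists_supporting hv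
  set α := f (1, 0)
  set β := f (0, 1)
  have hfe : ∀ p : Pt, f p = α * p.1 + β * p.2 := by
    intro p
    have : p = p.1 • ((1, 0) : Pt) + p.2 • ((0, 1) : Pt) := by ext <;> simp
    conv_lhs => rw [this]
    rw [map_add, map_smul, map_smul, smul_eq_mul, smul_eq_mul]
    ring
  set g : Pt → ℝ := fun p => (α * (p.2 - v.2) - β * (p.1 - v.1)) / (f p - f v) with hg
  have hlt : ∀ p ∈ X.erase v, ∀ q ∈ X.erase v, g p < g q ↔ 0 < cross v p q := by
    intro p hp q hq
    have h1 := sub_pos.2 (hf p hp)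
    have h2 := sub_pos.2 (hf q hq)
    have hid : (α * (q.2 - v.2) - β * (q.1 - v.1)) * (f p - f v) -
        (α * (p.2 - v.2) - β * (p.1 - v.1)) * (f q - f v) = (α ^ 2 + β ^ 2) * cross v p q := by
      rw [hfe, hfe, hfe]; simp only [cross]; ring
    have hpos : 0 < α ^ 2 + β ^ 2 := by
      rcases eq_or_ne α 0 with ha | ha
      · rcases eq_or_ne β 0 with hb | hb
        · rw [hfe, hfe, ha, hb] at h1
          simp at h1
        · positivity
      · positivity
    rw [hg, div_lt_div_iff₀ h1 h2, ← sub_pos, hid, mul_pos_iff_of_pos_left hpos]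
  have hinj : Set.InjOn g (X.erase v) := by
    intro p hp q hq h
    by_contra hne
    have h1 : ¬ 0 < cross v p q := fun hc => ((hlt p hp q hq).2 hc).ne h
    have h2 : ¬ 0 < cross v q p := fun hc => ((hlt q hq p hp).2 hc).ne h.symm
    rw [cross_swap v p q] at h2
    rw [Finset.mem_coe, Finset.mem_erase] at hp hq
    exact hX.cross_ne_zero hvX hp.2 hq.2 hp.1.symm hq.1.symm hne (by linarith)
  refine ⟨g, hinj, fun x hx => ⟨?_, ?_⟩⟩
  · ext p
    rw [mem_below, Finset.mem_filter]
    constructor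
    · rintro ⟨hp, h⟩
      rw [hlt p hp x hx, cross_swap v x p] at h
      exact ⟨Finset.mem_of_mem_erase hp, by linarith⟩
    · rintro ⟨hp, h⟩
      have hpS : p ∈ X.erase v := by
        refine Finset.mem_erase.2 ⟨?_, hp⟩
        rintro rfl
        rw [cross_left_self] at h
        exact lt_irrefl _ h
      exact ⟨hpS, by rw [hlt p hpS x hx, cross_swap v x p]; linarith⟩
  · ext p
    rw [mem_below, Finset.mem_filter, Pi.neg_apply, Pi.neg_apply, neg_lt_neg_iff]
    constructor
    · rintro ⟨hp, h⟩
      exact ⟨Finset.mem_of_mem_erase hp, (hlt x hx p hp).1 h⟩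
    · rintro ⟨hp, h⟩
      have hpS : p ∈ X.erase v := by
        refine Finset.mem_erase.2 ⟨?_, hp⟩
        rintro rfl
        rw [cross_left_self] at h
        exact lt_irrefl _ h
      exact ⟨hpS, (hlt x hx p hpS).2 h⟩

lemma edgeSeg_subset {e : Sym2 Pt} {C : Set Pt} (hC : Convex ℝ C) (h : ∀ p ∈ e, p ∈ C) :
    edgeSeg e ⊆ C := by
  induction e using Sym2.ind with
  | _ a b => exact hC.segment_subset (h a (by simp)) (h b (by simp))

/-- Non-crossing matchings of the two open sides of the line `vx`, together with the edge `vx`,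
form a non-crossing matching. -/
lemma IsNCMatching.insert_union {X : Finset Pt} (hX : GenPos X) {v x : Pt} (hv : v ∈ X)
    (hx : x ∈ X) (hvx : v ≠ x) {M N : Finset (Sym2 Pt)}
    (hM : IsNCMatching (X.filter fun p => cross v x p < 0) M)
    (hN : IsNCMatching (X.filter fun p => 0 < cross v x p) N) :
    IsNCMatching X (insert s(v, x) (M ∪ N)) := by
  obtain ⟨hM1, hM2, hM3⟩ := hM
  obtain ⟨hN1, hN2, hN3⟩ := hN
  have hMs : ∀ e ∈ M, ∀ p ∈ e, p ∈ X ∧ cross v x p < 0 := fun e he p hp =>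
    Finset.mem_filter.1 ((hM1 e he).2 p hp)
  have hNs : ∀ e ∈ N, ∀ p ∈ e, p ∈ X ∧ 0 < cross v x p := fun e he p hp =>
    Finset.mem_filter.1 ((hN1 e he).2 p hp)
  have h0 : ∀ p ∈ s(v, x), cross v x p = 0 := by
    intro p hp
    rcases Sym2.mem_iff.1 hp with rfl | rfl
    exacts [cross_left_self _ _, cross_right_self _ _]
  refine ⟨?_, ?_, ?_⟩
  · intro e he
    rcases Finset.mem_insert.1 he with rfl | he
    · refine ⟨by simpa using hvx, fun p hp => ?_⟩
      rcases Sym2.mem_iff.1 hp with rfl | rfl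
      exacts [hv, hx]
    · rcases Finset.mem_union.1 he with he | he
      · exact ⟨(hM1 e he).1, fun p hp => (hMs e he p hp).1⟩
      · exact ⟨(hN1 e he).1, fun p hp => (hNs e he p hp).1⟩
  · intro p hp
    rcases lt_trichotomy (cross v x p) 0 with h | h | h
    · obtain ⟨e, ⟨he, hpe⟩, huniq⟩ := hM2 p (Finset.mem_filter.2 ⟨hp, h⟩)
      refine ⟨e, ⟨by simp [he], hpe⟩, ?_⟩
      rintro e' ⟨he', hpe'⟩
      rcases Finset.mem_insert.1 he' with rfl | he'
      · exact absurd (h0 p hpe') h.ne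
      · rcases Finset.mem_union.1 he' with he' | he'
        · exact huniq e' ⟨he', hpe'⟩
        · exact absurd (hNs e' he' p hpe').2 h.not_gt
    · have hpm : p ∈ s(v, x) := by
        rw [Sym2.mem_iff]
        by_contra hcon
        push Not at hcon
        exact hX.cross_ne_zero hv hx hp hvx hcon.1.symm hcon.2.symm h
      refine ⟨s(v, x), ⟨by simp, hpm⟩, ?_⟩
      rintro e' ⟨he', hpe'⟩
      rcases Finset.mem_insert.1 he' with rfl | he'
      · rfl
      · rcases Finset.mem_union.1 he' with he' | he'
        · exact absurd h (hMs e' he' p hpe').2.ne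
        · exact absurd h (hNs e' he' p hpe').2.ne'
    · obtain ⟨e, ⟨he, hpe⟩, huniq⟩ := hN2 p (Finset.mem_filter.2 ⟨hp, h⟩)
      refine ⟨e, ⟨by simp [he], hpe⟩, ?_⟩
      rintro e' ⟨he', hpe'⟩
      rcases Finset.mem_insert.1 he' with rfl | he'
      · exact absurd (h0 p hpe') h.ne'
      · rcases Finset.mem_union.1 he' with he' | he'
        · exact absurd (hMs e' he' p hpe').2 h.not_gt
        · exact huniq e' ⟨he', hpe'⟩
  · have sM : ∀ e ∈ M, edgeSeg e ⊆ cross v x ⁻¹' Set.Iio 0 := fun e he =>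
      edgeSeg_subset (convex_cross_preimage v x (convex_Iio 0)) fun p hp => (hMs e he p hp).2
    have sN : ∀ e ∈ N, edgeSeg e ⊆ cross v x ⁻¹' Set.Ioi 0 := fun e he =>
      edgeSeg_subset (convex_cross_preimage v x (convex_Ioi 0)) fun p hp => (hNs e he p hp).2
    have s0 : edgeSeg s(v, x) ⊆ cross v x ⁻¹' {0} :=
      edgeSeg_subset (convex_cross_preimage v x (convex_singleton 0)) h0
    have : Std.Symm fun e f : Sym2 Pt => Disjoint (edgeSeg e) (edgeSeg f) :=
      ⟨fun _ _ h => h.symm⟩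
    rw [Finset.coe_insert, Finset.coe_union]
    refine Set.Pairwise.insert_of_symm ?_ ?_
    · rw [Set.pairwise_union_of_symm]
      exact ⟨hM3, hN3, fun e he f hf _ => Disjoint.mono (sM e he) (sN f hf)
        (Disjoint.preimage _ (Set.disjoint_left.2 fun t h h' =>
          lt_asymm (Set.mem_Iio.1 h) (Set.mem_Ioi.1 h')))⟩
    · rintro f (hf | hf) -
      · exact Disjoint.mono s0 (sM f hf)
          (Disjoint.preimage _ (Set.disjoint_left.2 fun t h h' => by simp_all))
      · exact Disjoint.mono s0 (sN f hf)
          (Disjoint.preimage _ (Set.disjoint_left.2 fun t h h' => by simp_all))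

lemma GenPos.exists_ncMatching_of_sides {X P : Finset Pt} (hX : GenPos X) {v x : Pt} (hv : v ∈ X)
    (hx : x ∈ X) (hvP : v ∉ P) (hxP : x ∈ P)
    (hM : ∃ M, IsNCMatching (X.filter fun p => cross v x p < 0) M ∧ ∀ e ∈ M, ¬ Respects P e)
    (hN : ∃ M, IsNCMatching (X.filter fun p => 0 < cross v x p) M ∧ ∀ e ∈ M, ¬ Respects P e) :
    ∃ M, IsNCMatching X M ∧ s(v, x) ∈ M ∧ ∀ e ∈ M, ¬ Respects P e := by
  obtain ⟨M, hM, hMP⟩ := hM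
  obtain ⟨N, hN, hNP⟩ := hN
  refine ⟨_, hM.insert_union hX hv hx (fun h => hvP (h ▸ hxP)) hN, by simp, fun e he => ?_⟩
  rcases Finset.mem_insert.1 he with rfl | he
  · exact fun h => hvP (h x (by simp) v (by simp) hxP)
  · exact (Finset.mem_union.1 he).elim (hMP e) (hNP e)

/-- If half of the points of `X` belong to `P`, then `X` has a non-crossing perfect matching each
of whose edges has exactly one endpoint in `P`. -/
lemma GenPos.exists_bichromatic_ncMatching {X : Finset Pt} (hX : GenPos X) (P : Finset Pt)
    (hP : 2 * (X ∩ P).card = X.card) :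
    ∃ M, IsNCMatching X M ∧ ∀ e ∈ M, ¬ Respects P e := by
  induction hk : X.card using Nat.strong_induction_on generalizing X P with
  | _ k ih =>
  rcases X.eq_empty_or_nonempty with rfl | hne
  · exact ⟨∅, ⟨by simp, by simp, by simp⟩, by simp⟩
  obtain ⟨v, hv⟩ := (Set.Finite.isCompact_convexHull (𝕜 := ℝ)
    (Finset.finite_toSet X)).extremePoints_nonempty ((convexHull_nonempty_iff (𝕜 := ℝ)).2 hne)
  have hvX : v ∈ X := extremePoints_convexHull_subset hv
  wlog hvP : v ∉ P generalizing P
  · obtain ⟨M, hM, hMP⟩ := this (X \ P) (by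
      rw [Finset.inter_eq_right.2 Finset.sdiff_subset]
      have := Finset.card_inter_add_card_sdiff X P
      omega) (fun h => (Finset.mem_sdiff.1 h).2 (not_not.1 hvP))
    refine ⟨M, hM, fun e he h => hMP e he fun p hp q hq hpP => ?_⟩
    rw [Finset.mem_sdiff] at hpP ⊢
    exact ⟨(hM.1 e he).2 q hq, fun hqP => hpP.2 (h q hq p hp hqP)⟩
  obtain ⟨g, hg, hside⟩ := exists_angular_order hX hv
  have hSP : X.erase v ∩ P = X ∩ P := by
    rw [Finset.erase_inter, Finset.erase_eq_of_notMem]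
    exact fun h => hvP (Finset.mem_inter.1 h).2
  have hpos := Finset.card_pos.2 hne
  have hS := Finset.card_erase_add_one hvX
  obtain ⟨x, hxS, hxP, hbal⟩ := exists_balanced_below P g (X.erase v) hg (by rw [hSP]; omega)
  have h1 := card_inter_eq_below_add hg hxS P
  have h2 := card_eq_below_add hg hxS
  rw [hSP, if_pos hxP] at h1
  rw [(hside x hxS).1] at h1 h2 hbal
  rw [(hside x hxS).2] at h1 h2
  obtain ⟨M, hM, -, hMP⟩ := hX.exists_ncMatching_of_sides hvX (Finset.mem_of_mem_erase hxS) hvP hxP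
    (ih _ (by omega) (hX.mono (Finset.filter_subset _ _)) P hbal rfl)
    (ih _ (by omega) (hX.mono (Finset.filter_subset _ _)) P (by omega) rfl)
  exact ⟨M, hM, hMP⟩

/-- The bichromatic matchings through a balanced edge at `v` show that this edge is blocked. -/
lemma balancedAdj_of_blocking {n : ℕ} {X : Finset Pt} (hXcard : X.card = 2 * n) (hX : GenPos X)
    {H : Finset (Sym2 Pt)} (helim : ∀ M : Finset (Sym2 Pt), IsNCMatching X M → ¬ Avoids M H)
    {v : Pt} (hvX : v ∈ X) {g : Pt → ℝ} (hg : Set.InjOn g (X.erase v))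
    (hside : ∀ x ∈ X.erase v, below (X.erase v) g x = (X.filter fun p => cross v x p < 0) ∧
      below (X.erase v) (-g) x = X.filter fun p => 0 < cross v x p) :
    BalancedAdj n X H v g := by
  intro P hPX hPc hvP hresp x hxP hbal
  by_contra hvx
  have hxS : x ∈ X.erase v := Finset.mem_erase.2 ⟨fun h => hvP (h ▸ hxP), hPX hxP⟩
  have h1 := card_inter_eq_below_add hg hxS P
  have h2 := card_eq_below_add hg hxS
  rw [erase_inter_of_notMem hPX hvP, if_pos hxP] at h1
  rw [Finset.card_erase_of_mem hvX] at h2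
  rw [(hside x hxS).1] at h1 h2 hbal
  rw [(hside x hxS).2] at h1 h2
  obtain ⟨M, hM, hvxM, hMP⟩ := hX.exists_ncMatching_of_sides hvX (hPX hxP) hvP hxP
    ((hX.mono (Finset.filter_subset _ _)).exists_bichromatic_ncMatching P hbal)
    ((hX.mono (Finset.filter_subset _ _)).exists_bichromatic_ncMatching P (by omega))
  refine helim M hM fun e he heH => ?_
  by_cases hve : v ∈ e
  · exact hvx ((hM.2.1 v hvX).unique ⟨he, hve⟩ ⟨hvxM, by simp⟩ ▸ heH)
  · exact hMP e he (hresp e heH hve)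

end Geometry

/-- Claim `hezi`: let `H` be a set of exactly `n` edges eliminating all
non-crossing perfect matchings, and let `{u,v} ∈ H` be an edge such that `v` is an extreme point
of the convex hull of `X` and has degree at least `2` in `H`. Then on each open half-plane
determined by the line through `u` and `v`, the number of red points equals the number of blue
points. -/
theorem balanced_sides_of_hull_edge (n : ℕ) (X : Finset Pt)
    (hXcard : X.card = 2 * n) (hgp : GenPos X)
    (H : Finset (Sym2 Pt)) (hH : ∀ e ∈ H, IsEdgeOf X e) (hHcard : H.card = n)
    (helim : ∀ M : Finset (Sym2 Pt), IsNCMatching X M → ¬ Avoids M H)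
    (u v : Pt) (huv : s(u, v) ∈ H)
    (hvhull : v ∈ Set.extremePoints ℝ (convexHull ℝ (X : Set Pt)))
    (hvdeg : ∃ f ∈ H, f ≠ s(u, v) ∧ v ∈ f) :
    ({p ∈ (X : Set Pt) | RedPt H p ∧ 0 < cross u v p}.ncard
        = {p ∈ (X : Set Pt) | ¬ RedPt H p ∧ 0 < cross u v p}.ncard) ∧
    ({p ∈ (X : Set Pt) | RedPt H p ∧ cross u v p < 0}.ncard
        = {p ∈ (X : Set Pt) | ¬ RedPt H p ∧ cross u v p < 0}.ncard) := by
  have hvX : v ∈ X := extremePoints_convexHull_subset hvhull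
  have huX : u ∈ X := (hH _ huv).2 u (by simp)
  have hne : u ≠ v := by simpa using (hH _ huv).1
  obtain ⟨f, hf, hfuv, hvf⟩ := hvdeg
  obtain ⟨w, rfl⟩ := Sym2.mem_iff_exists.1 hvf
  rw [Sym2.eq_swap] at hf hfuv
  have huw : u ≠ w := fun h => hfuv (by rw [h])
  have hwne : w ≠ v := by simpa using (hH _ hf).1
  obtain ⟨A, hAX, hA, hT⟩ := exists_tree hXcard hH hHcard (fun P hPX hPc => by
    by_contra hcon
    push Not at hcon
    obtain ⟨M, hM, hMP⟩ := hgp.exists_bichromatic_ncMatching P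
      (by rw [Finset.inter_eq_right.2 hPX, hPc, hXcard])
    exact helim M hM fun e he heH => hMP e he (hcon e heH)) huv hf huw
  obtain ⟨g, hg, hside⟩ := exists_angular_order hgp hvhull
  have hbal := balanced_of_tree hXcard hAX hA hT hg
    (balancedAdj_of_blocking hXcard hgp helim hvX hg hside) huv hf huw hne hwne
  have hred : ∀ p, RedPt H p ↔ p ∈ A := by
    refine fun p => ⟨fun ⟨e, he, hp⟩ => hT.mem e he p hp, fun hp => ?_⟩
    by_contra hcon
    rcases hT.connected {p} (by simpa using hp) fun e he q hq r hr hqp =>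
        absurd ⟨e, he, Finset.mem_singleton.1 hqp ▸ hq⟩ hcon with h | h
    · simp at h
    · rw [← h] at hT
      exact hne ((Finset.mem_singleton.1 (hT.mem _ huv u (by simp))).trans
        (Finset.mem_singleton.1 (hT.mem _ huv v (by simp))).symm)
  have hcross : ∀ p, cross u v p = -cross v u p := fun p => by simp only [cross]; ring
  have hcount : ∀ {D : Finset Pt} {q : Pt → Prop}, (∀ p, p ∈ D ↔ p ∈ X ∧ q p) →
      2 * (D ∩ A).card = D.card → {p ∈ (X : Set Pt) | RedPt H p ∧ q p}.ncard =
        {p ∈ (X : Set Pt) | ¬ RedPt H p ∧ q p}.ncard := by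
    intro D q hD hDA
    have e1 : {p ∈ (X : Set Pt) | RedPt H p ∧ q p} = ((D ∩ A : Finset Pt) : Set Pt) := by
      ext p
      simp only [Set.mem_ofPred_eq, Finset.mem_coe, Finset.mem_inter, hD, hred]
      tauto
    have e2 : {p ∈ (X : Set Pt) | ¬ RedPt H p ∧ q p} = ((D \ A : Finset Pt) : Set Pt) := by
      ext p
      simp only [Set.mem_ofPred_eq, Finset.mem_coe, Finset.mem_sdiff, hD, hred]
      tauto
    rw [e1, e2, Set.ncard_coe_finset, Set.ncard_coe_finset]
    have := Finset.card_inter_add_card_sdiff D A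
    omega
  have huS : u ∈ X.erase v := Finset.mem_erase.2 ⟨hne, huX⟩
  exact ⟨hcount (fun p => by rw [(hside u huS).1, Finset.mem_filter, hcross, neg_pos]) hbal.1,
    hcount (fun p => by rw [(hside u huS).2, Finset.mem_filter, hcross, neg_lt_zero]) hbal.2⟩
end
end

section
/- For every n ≥ 1 there exists a set X of 2n points in general position in the plane admitting 2n−1 pairwise edge-disjoint non-crossing perfect matchings; consequently, for every set S of at most 2n−2 edges of X there exists a non-crossing perfect matching of X avoiding S. -/
open MeasureTheory Set Filter

noncomputable section

/-- The `m + 1` points of the construction: `m` points on a downward parabola, and, as the point of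
index `m`, an apex lying above every line through two of them. -/
def capPt (m j : ℕ) : Pt := if j < m then ((j : ℝ), -(j : ℝ) ^ 2) else (0, (m : ℝ) ^ 2)

/-- The indices `j` and `k` are joined in the `s`-th round of the round-robin tournament on
`0, …, m`, with `m` playing the role of the fixed player. -/
def RoundAdj (m s j k : ℕ) : Prop :=
  (j < m ∧ k < m ∧ j ≠ k ∧ (j + k = s ∨ j + k = s + m)) ∨
  (j < m ∧ k = m ∧ (2 * j = s ∨ 2 * j = s + m)) ∨
  (k < m ∧ j = m ∧ (2 * k = s ∨ 2 * k = s + m))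

open Classical in
/-- The matching of the cap configuration given by the `s`-th round. -/
def roundMatching (m s : ℕ) : Finset (Sym2 Pt) :=
  ((Finset.range (m + 1) ×ˢ Finset.range (m + 1)).filter fun q => RoundAdj m s q.1 q.2).image
    fun q => s(capPt m q.1, capPt m q.2)

theorem capPt_of_lt {m j : ℕ} (h : j < m) : capPt m j = ((j : ℝ), -(j : ℝ) ^ 2) := if_pos h

theorem capPt_self (m : ℕ) : capPt m m = (0, (m : ℝ) ^ 2) := if_neg (lt_irrefl m)

theorem capPt_inj {m j k : ℕ} (hj : j ≤ m) (hk : k ≤ m) (h : capPt m j = capPt m k) : j = k := by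
  have apex_ne {i : ℕ} (hi : i < m) : capPt m i ≠ capPt m m := by
    rw [capPt_of_lt hi, capPt_self]
    intro h
    have h2 := congrArg Prod.snd h
    have : (0 : ℝ) < m := by exact_mod_cast (Nat.zero_le i).trans_lt hi
    simp only at h2
    nlinarith [sq_nonneg (i : ℝ)]
  rcases hj.lt_or_eq with hj | rfl <;> rcases hk.lt_or_eq with hk | rfl
  · rw [capPt_of_lt hj, capPt_of_lt hk] at h
    have h1 : (j : ℝ) = k := congrArg Prod.fst h
    exact_mod_cast h1
  · exact absurd h (apex_ne hj)
  · exact absurd h.symm (apex_ne hk)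
  · rfl

theorem cross_eq_zero_of_collinear {a b c : Pt} (h : Collinear ℝ ({a, b, c} : Set Pt)) :
    (b.1 - a.1) * (c.2 - a.2) - (c.1 - a.1) * (b.2 - a.2) = 0 := by
  obtain ⟨v, hv⟩ := (collinear_iff_of_mem (Set.mem_insert a {b, c})).1 h
  obtain ⟨r, rfl⟩ := hv b (by simp)
  obtain ⟨t, rfl⟩ := hv c (by simp)
  simp
  ring

theorem cross_capPt_ne_zero {m i j k : ℕ} (hi : i ≤ m) (hj : j ≤ m) (hk : k ≤ m)
    (hij : i ≠ j) (hik : i ≠ k) (hjk : j ≠ k) :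
    ((capPt m j).1 - (capPt m i).1) * ((capPt m k).2 - (capPt m i).2) -
      ((capPt m k).1 - (capPt m i).1) * ((capPt m j).2 - (capPt m i).2) ≠ 0 := by
  have sub_ne {a b : ℕ} (h : a ≠ b) : (a : ℝ) - b ≠ 0 := sub_ne_zero.2 (by exact_mod_cast h)
  have apex_ne {a b : ℕ} (ha : a < m) (hb : b < m) : (m : ℝ) ^ 2 - a * b ≠ 0 := by
    have ha' : (a : ℝ) < m := by exact_mod_cast ha
    have hb' : (b : ℝ) < m := by exact_mod_cast hb
    have := mul_lt_mul'' ha' hb' a.cast_nonneg b.cast_nonneg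
    nlinarith
  rcases hi.lt_or_eq with hi | rfl
  · rcases hj.lt_or_eq with hj | rfl
    · rcases hk.lt_or_eq with hk | rfl
      · rw [capPt_of_lt hi, capPt_of_lt hj, capPt_of_lt hk]
        convert mul_ne_zero (mul_ne_zero (sub_ne hij) (sub_ne hik)) (sub_ne hjk) using 1
        ring
      · rw [capPt_of_lt hi, capPt_of_lt hj, capPt_self]
        convert mul_ne_zero (sub_ne hij.symm) (apex_ne hi hj) using 1
        ring
    · have hk := lt_of_le_of_ne hk hjk.symm
      rw [capPt_of_lt hi, capPt_of_lt hk, capPt_self]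
      convert mul_ne_zero (sub_ne hik) (apex_ne hi hk) using 1
      ring
  · have hj := lt_of_le_of_ne hj hij.symm
    have hk := lt_of_le_of_ne hk hik.symm
    rw [capPt_of_lt hj, capPt_of_lt hk, capPt_self]
    convert mul_ne_zero (sub_ne hjk.symm) (apex_ne hj hk) using 1
    ring

theorem genPos_capPt (m : ℕ) : GenPos ((Finset.range (m + 1)).image (capPt m)) := by
  intro a ha b hb c hc hab hac hbc h
  simp only [Finset.mem_image, Finset.mem_range, Nat.lt_succ_iff] at ha hb hc
  obtain ⟨i, hi, rfl⟩ := ha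
  obtain ⟨j, hj, rfl⟩ := hb
  obtain ⟨k, hk, rfl⟩ := hc
  exact cross_capPt_ne_zero hi hj hk (ne_of_apply_ne _ hab) (ne_of_apply_ne _ hac)
    (ne_of_apply_ne _ hbc) (cross_eq_zero_of_collinear h)

theorem RoundAdj.symm {m s j k : ℕ} (h : RoundAdj m s j k) : RoundAdj m s k j := by
  unfold RoundAdj at *
  omega

theorem RoundAdj.ne {m s j k : ℕ} (h : RoundAdj m s j k) : j ≠ k := by
  unfold RoundAdj at h
  omega

theorem RoundAdj.left_le {m s j k : ℕ} (h : RoundAdj m s j k) : j ≤ m := by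
  unfold RoundAdj at h
  omega

theorem RoundAdj.right_le {m s j k : ℕ} (h : RoundAdj m s j k) : k ≤ m := h.symm.left_le

theorem RoundAdj.right_unique {m s j k l : ℕ} (hm : Odd m) (hs : s < m) (h : RoundAdj m s j k)
    (h' : RoundAdj m s j l) : k = l := by
  obtain ⟨r, rfl⟩ := hm
  unfold RoundAdj at *
  omega

theorem RoundAdj.round_unique {m s t j k : ℕ} (hs : s < m) (ht : t < m) (h : RoundAdj m s j k)
    (h' : RoundAdj m t j k) : s = t := by
  unfold RoundAdj at *
  omega

theorem exists_roundAdj {m s j : ℕ} (hm : Odd m) (hs : s < m) (hj : j ≤ m) :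
    ∃ k, RoundAdj m s j k := by
  obtain ⟨r, rfl⟩ := hm
  unfold RoundAdj
  rcases hj.lt_or_eq with hj | rfl
  · by_cases h : 2 * j = s ∨ 2 * j = s + (2 * r + 1)
    · exact ⟨2 * r + 1, by omega⟩
    · rcases le_or_gt j s with h' | h'
      · exact ⟨s - j, by omega⟩
      · exact ⟨s + (2 * r + 1) - j, by omega⟩
  · rcases Nat.even_or_odd' s with ⟨c, rfl | rfl⟩
    · exact ⟨c, by omega⟩
    · exact ⟨c + r + 1, by omega⟩

theorem mem_roundMatching {m s : ℕ} {e : Sym2 Pt} :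
    e ∈ roundMatching m s ↔ ∃ j k, RoundAdj m s j k ∧ e = s(capPt m j, capPt m k) := by
  simp only [roundMatching, Finset.mem_image, Finset.mem_filter, Finset.mem_product,
    Finset.mem_range, Nat.lt_succ_iff, Prod.exists]
  constructor
  · rintro ⟨j, k, ⟨-, h⟩, rfl⟩
    exact ⟨j, k, h, rfl⟩
  · rintro ⟨j, k, h, rfl⟩
    exact ⟨j, k, ⟨⟨h.left_le, h.right_le⟩, h⟩, rfl⟩

/-- A point of a chord of the parabola `y = -x ^ 2`. -/
theorem mem_segment_parabola {a b : ℝ} (hab : a ≤ b) {p : Pt}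
    (hp : p ∈ segment ℝ ((a, -a ^ 2) : Pt) (b, -b ^ 2)) :
    a ≤ p.1 ∧ p.1 ≤ b ∧ p.2 + p.1 ^ 2 = -((p.1 - a) * (b - p.1)) := by
  obtain ⟨u, v, hu, hv, huv, rfl⟩ := hp
  obtain rfl : u = 1 - v := by linarith
  simp only [Prod.smul_mk, Prod.mk_add_mk, smul_eq_mul]
  refine ⟨?_, ?_, ?_⟩
  · nlinarith
  · nlinarith
  · ring

theorem disjoint_segment_parabola_of_lt {a b c d : ℝ} (hab : a ≤ b) (hbc : b < c) (hcd : c ≤ d) :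
    Disjoint (segment ℝ ((a, -a ^ 2) : Pt) (b, -b ^ 2)) (segment ℝ (c, -c ^ 2) (d, -d ^ 2)) := by
  refine Set.disjoint_left.2 fun p hp hq => ?_
  linarith [(mem_segment_parabola hab hp).2.1, (mem_segment_parabola hcd hq).1]

theorem disjoint_segment_parabola_of_nested {a b c d : ℝ} (hac : a < c) (hcd : c ≤ d)
    (hdb : d < b) :
    Disjoint (segment ℝ ((a, -a ^ 2) : Pt) (b, -b ^ 2)) (segment ℝ (c, -c ^ 2) (d, -d ^ 2)) := by
  refine Set.disjoint_left.2 fun p hp hq => ?_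
  obtain ⟨-, -, h⟩ := mem_segment_parabola (by linarith) hp
  obtain ⟨h1, h2, h3⟩ := mem_segment_parabola hcd hq
  have : (p.1 - c) * (d - p.1) < (p.1 - a) * (b - p.1) :=
    mul_lt_mul'' (by linarith) (by linarith) (by linarith) (by linarith)
  linarith

theorem disjoint_segment_apex {a b c H : ℝ} (hab : a < b) (hca : c ≠ a) (hcb : c ≠ b)
    (hH : c ^ 2 < H) :
    Disjoint (segment ℝ ((a, -a ^ 2) : Pt) (b, -b ^ 2)) (segment ℝ (c, -c ^ 2) (0, H)) := by
  refine Set.disjoint_left.2 fun p hp hq => ?_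
  obtain ⟨h1, h2, h3⟩ := mem_segment_parabola hab.le hp
  obtain ⟨u, v, hu, hv, huv, rfl⟩ := hq
  obtain rfl : u = 1 - v := by linarith
  simp only [Prod.smul_mk, Prod.mk_add_mk, smul_eq_mul, mul_zero, add_zero] at h1 h2 h3
  rcases hv.eq_or_lt with rfl | hv
  · have : (c - a) * (b - c) = 0 := by linarith
    rcases mul_eq_zero.1 this with h | h
    · exact hca (by linarith)
    · exact hcb (by linarith)
  · have h4 := mul_nonneg (sub_nonneg.2 h1) (sub_nonneg.2 h2)
    have h5 : 0 < v * (H - (1 - v) * c ^ 2) :=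
      mul_pos hv (by nlinarith [mul_nonneg hv.le (sq_nonneg c)])
    nlinarith

theorem disjoint_capPt_segment_apex {m s i j k : ℕ} (hi : RoundAdj m s i m)
    (hjk : j < k) (hk : k < m) (hij : i ≠ j) (hik : i ≠ k) :
    Disjoint (segment ℝ (capPt m j) (capPt m k)) (segment ℝ (capPt m i) (capPt m m)) := by
  have him : i < m := lt_of_le_of_ne hi.left_le hi.ne
  rw [capPt_of_lt (hjk.trans hk), capPt_of_lt hk, capPt_of_lt him, capPt_self]
  refine disjoint_segment_apex (by exact_mod_cast hjk) (by exact_mod_cast hij)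
    (by exact_mod_cast hik) ?_
  exact_mod_cast Nat.pow_lt_pow_left him two_ne_zero

theorem disjoint_roundAdj_segment_of_lt {m s i j k l : ℕ} (hm : Odd m) (hs : s < m)
    (h : RoundAdj m s i j) (h' : RoundAdj m s k l) (hij : i < j) (hkl : k < l) (hik : i < k) :
    Disjoint (segment ℝ (capPt m i) (capPt m j)) (segment ℝ (capPt m k) (capPt m l)) := by
  have hjl : j ≠ l := by
    rintro rfl
    exact hik.ne (h.symm.right_unique hm hs h'.symm)
  have hjk : j ≠ k := by
    rintro rfl
    exact (hik.trans hkl).ne (h.symm.right_unique hm hs h')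
  have hil := hik.trans hkl
  rcases h.right_le.lt_or_eq with hj | rfl
  · rcases h'.right_le.lt_or_eq with hl | rfl
    · rw [capPt_of_lt (hij.trans hj), capPt_of_lt hj, capPt_of_lt (hkl.trans hl), capPt_of_lt hl]
      rcases hjk.lt_or_gt with hjk | hjk
      · exact disjoint_segment_parabola_of_lt (by exact_mod_cast hij.le) (by exact_mod_cast hjk)
          (by exact_mod_cast hkl.le)
      · have hlj : l < j := by
          unfold RoundAdj at h h'
          omega
        exact disjoint_segment_parabola_of_nested (by exact_mod_cast hik)
          (by exact_mod_cast hkl.le) (by exact_mod_cast hlj)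
    · exact disjoint_capPt_segment_apex h' hij hj hik.ne' hjk.symm
  · exact (disjoint_capPt_segment_apex h hkl (lt_of_le_of_ne h'.right_le hjl.symm)
      hik.ne hil.ne).symm

theorem exists_lt_of_mem_roundMatching {m s : ℕ} {e : Sym2 Pt} (he : e ∈ roundMatching m s) :
    ∃ j k, j < k ∧ RoundAdj m s j k ∧ e = s(capPt m j, capPt m k) := by
  obtain ⟨j, k, h, rfl⟩ := mem_roundMatching.1 he
  rcases h.ne.lt_or_gt with hjk | hjk
  · exact ⟨j, k, hjk, h, rfl⟩
  · exact ⟨k, j, hjk, h.symm, Sym2.eq_swap⟩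

theorem isNCMatching_roundMatching {m s : ℕ} (hm : Odd m) (hs : s < m) :
    IsNCMatching ((Finset.range (m + 1)).image (capPt m)) (roundMatching m s) := by
  have mem {j : ℕ} (hj : j ≤ m) : capPt m j ∈ (Finset.range (m + 1)).image (capPt m) :=
    Finset.mem_image_of_mem _ (Finset.mem_range.2 (Nat.lt_succ_of_le hj))
  refine ⟨fun e he => ?_, fun p hp => ?_, fun e he f hf hef => ?_⟩
  · obtain ⟨j, k, h, rfl⟩ := mem_roundMatching.1 he
    refine ⟨fun hd => h.ne (capPt_inj h.left_le h.right_le (Sym2.mk_isDiag_iff.1 hd)), ?_⟩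
    intro p hp
    rcases Sym2.mem_iff.1 hp with rfl | rfl
    · exact mem h.left_le
    · exact mem h.right_le
  · obtain ⟨j, hj, rfl⟩ := Finset.mem_image.1 hp
    have hj := Nat.lt_succ_iff.1 (Finset.mem_range.1 hj)
    obtain ⟨k, hk⟩ := exists_roundAdj hm hs hj
    refine ⟨s(capPt m j, capPt m k),
      ⟨mem_roundMatching.2 ⟨j, k, hk, rfl⟩, Sym2.mem_mk_left _ _⟩, ?_⟩
    rintro e ⟨he, hje⟩
    obtain ⟨a, b, h, rfl⟩ := mem_roundMatching.1 he
    rcases Sym2.mem_iff.1 hje with hja | hjb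
    · obtain rfl := capPt_inj hj h.left_le hja
      rw [h.right_unique hm hs hk]
    · obtain rfl := capPt_inj hj h.right_le hjb
      rw [h.symm.right_unique hm hs hk, Sym2.eq_swap]
  · obtain ⟨i, j, hij, h, rfl⟩ := exists_lt_of_mem_roundMatching he
    obtain ⟨k, l, hkl, h', rfl⟩ := exists_lt_of_mem_roundMatching hf
    change Disjoint (segment ℝ (capPt m i) (capPt m j)) (segment ℝ (capPt m k) (capPt m l))
    rcases lt_trichotomy i k with hik | rfl | hik
    · exact disjoint_roundAdj_segment_of_lt hm hs h h' hij hkl hik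
    · exact absurd (by rw [h.right_unique hm hs h']) hef
    · exact (disjoint_roundAdj_segment_of_lt hm hs h' h hkl hij hik).symm

theorem disjoint_roundMatching {m s t : ℕ} (hs : s < m) (ht : t < m) (hst : s ≠ t) :
    Disjoint (roundMatching m s) (roundMatching m t) := by
  refine Finset.disjoint_left.2 fun e he hf => hst ?_
  obtain ⟨i, j, h, rfl⟩ := mem_roundMatching.1 he
  obtain ⟨k, l, h', hkl⟩ := mem_roundMatching.1 hf
  rcases Sym2.eq_iff.1 hkl with ⟨h1, h2⟩ | ⟨h1, h2⟩
  · obtain rfl := capPt_inj h.left_le h'.left_le h1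
    obtain rfl := capPt_inj h.right_le h'.right_le h2
    exact h.round_unique hs ht h'
  · obtain rfl := capPt_inj h.left_le h'.right_le h1
    obtain rfl := capPt_inj h.right_le h'.left_le h2
    exact h.round_unique hs ht h'.symm

/-- Among pairwise disjoint sets, more numerous than the elements of `S`, one misses `S`. -/
theorem exists_disjoint_of_card_lt {ι α : Type*} [Fintype ι] {M : ι → Finset α} {S : Finset α}
    (hM : ∀ i j, i ≠ j → Disjoint (M i) (M j)) (hS : S.card < Fintype.card ι) :
    ∃ i, ∀ e ∈ M i, e ∉ S := by
  by_contra! h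
  choose e he heS using h
  obtain ⟨i, -, j, -, hij, heq⟩ := Finset.exists_ne_map_eq_of_card_lt_of_maps_to
    (s := Finset.univ) (t := S) (f := e) (by rwa [Finset.card_univ]) (fun i _ => heS i)
  exact Finset.disjoint_left.1 (hM i j hij) (he i) (heq ▸ he j)

/-- for every `n ≥ 1` there is a set of `2n` points in general position
admitting `2n - 1` pairwise edge-disjoint non-crossing perfect matchings; consequently any set
of at most `2n - 2` edges can be avoided by some non-crossing perfect matching. -/
theorem exists_config_with_many_disjoint_matchings (n : ℕ) (hn : 1 ≤ n) :
    ∃ X : Finset Pt, X.card = 2 * n ∧ GenPos X ∧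
      (∃ Ms : Fin (2 * n - 1) → Finset (Sym2 Pt),
        (∀ i, IsNCMatching X (Ms i)) ∧
        ∀ i j, i ≠ j → Disjoint (Ms i) (Ms j)) ∧
      ∀ S : Finset (Sym2 Pt), (∀ e ∈ S, IsEdgeOf X e) → S.card ≤ 2 * n - 2 →
        ∃ M : Finset (Sym2 Pt), IsNCMatching X M ∧ Avoids M S := by
  set m := 2 * n - 1 with hm
  have hodd : Odd m := ⟨n - 1, by omega⟩
  have hdisj (i j : Fin m) (hij : i ≠ j) : Disjoint (roundMatching m i) (roundMatching m j) :=
    disjoint_roundMatching i.2 j.2 (Fin.val_ne_of_ne hij)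
  refine ⟨(Finset.range (m + 1)).image (capPt m), ?_, genPos_capPt m,
    ⟨fun i => roundMatching m i, fun i => isNCMatching_roundMatching hodd i.2, hdisj⟩, ?_⟩
  · rw [Finset.card_image_of_injOn, Finset.card_range]
    · omega
    · intro j hj k hk h
      simp only [Finset.coe_range, Set.mem_Iio, Nat.lt_succ_iff] at hj hk
      exact capPt_inj hj hk h
  · intro S _ hS
    obtain ⟨i, hi⟩ := exists_disjoint_of_card_lt hdisj (S := S) (by rw [Fintype.card_fin]; omega)
    exact ⟨roundMatching m i, isNCMatching_roundMatching hodd i.2, hi⟩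
end
end

section
/- Let Γ ⊆ ℝ² be a compact convex set with nonempty interior, and let k = k(n) be a sequence of positive integers with k(n) ≥ log n for all n. For each n let X₁,…,X_n be independent random points each uniformly distributed on Γ, and let X = {X₁,…,X_n}. Then the probability of the event that for every subset Y ⊆ X with |Y| = k(n) whose points are in convex position, the interior of the convex hull of Y contains at least k(n) points of X ∖ Y, tends to 1 as n → ∞. -/
open MeasureTheory Set Filter

noncomputable section

/-- The uniform probability distribution on `Γ`: normalized Lebesgue measure restricted to `Γ`. -/
def unifOn (Γ : Set Pt) : Measure Pt := (volume Γ)⁻¹ • volume.restrict Γ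

/-- The determinant of two planar vectors. -/
def planeDet (u v : Pt) : ℝ := u.1 * v.2 - u.2 * v.1

/-- First affine coordinate of `p` in the frame with origin `a` and basis `b - a`, `c - a`. -/
def coordFst (a b c p : Pt) : ℝ := planeDet (p - a) (c - a) / planeDet (b - a) (c - a)

/-- Second affine coordinate of `p` in the frame with origin `a` and basis `b - a`, `c - a`. -/
def coordSnd (a b c p : Pt) : ℝ := planeDet (b - a) (p - a) / planeDet (b - a) (c - a)

section Frame

variable {a b c : Pt}

theorem coordFst_combo (p q : Pt) {s t : ℝ} (hst : s + t = 1) :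
    coordFst a b c (s • p + t • q) = s * coordFst a b c p + t * coordFst a b c q := by
  obtain rfl : t = 1 - s := by linarith
  simp only [coordFst]
  rw [mul_div_assoc', mul_div_assoc', ← add_div]
  congr 1
  simp only [planeDet, Prod.fst_sub, Prod.snd_sub, Prod.fst_add, Prod.snd_add, Prod.smul_fst,
    Prod.smul_snd, smul_eq_mul]
  ring

theorem coordSnd_combo (p q : Pt) {s t : ℝ} (hst : s + t = 1) :
    coordSnd a b c (s • p + t • q) = s * coordSnd a b c p + t * coordSnd a b c q := by
  obtain rfl : t = 1 - s := by linarith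
  simp only [coordSnd]
  rw [mul_div_assoc', mul_div_assoc', ← add_div]
  congr 1
  simp only [planeDet, Prod.fst_sub, Prod.snd_sub, Prod.fst_add, Prod.snd_add, Prod.smul_fst,
    Prod.smul_snd, smul_eq_mul]
  ring

theorem eq_combo_coord (h : planeDet (b - a) (c - a) ≠ 0) (p : Pt) :
    p = (1 - coordFst a b c p - coordSnd a b c p) • a + coordFst a b c p • b
      + coordSnd a b c p • c := by
  have e1 : coordFst a b c p * planeDet (b - a) (c - a) = planeDet (p - a) (c - a) :=
    div_mul_cancel₀ _ h
  have e2 : coordSnd a b c p * planeDet (b - a) (c - a) = planeDet (b - a) (p - a) :=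
    div_mul_cancel₀ _ h
  generalize coordFst a b c p = α at *
  generalize coordSnd a b c p = β at *
  ext
  all_goals
    apply mul_left_cancel₀ h
    simp only [planeDet, Prod.fst_sub, Prod.snd_sub, Prod.fst_add, Prod.snd_add, Prod.smul_fst,
      Prod.smul_snd, smul_eq_mul] at e1 e2 ⊢
  · linear_combination -(b.1 - a.1) * e1 - (c.1 - a.1) * e2
  · linear_combination -(b.2 - a.2) * e1 - (c.2 - a.2) * e2

theorem coord_injective (h : planeDet (b - a) (c - a) ≠ 0) {p q : Pt}
    (h1 : coordFst a b c p = coordFst a b c q) (h2 : coordSnd a b c p = coordSnd a b c q) :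
    p = q := by
  rw [eq_combo_coord h p, eq_combo_coord h q, h1, h2]

/-- The open triangle in affine coordinates. -/
theorem mem_interior_convexHull_of_coord_pos (h : planeDet (b - a) (c - a) ≠ 0) {p : Pt}
    (h1 : 0 < coordFst a b c p) (h2 : 0 < coordSnd a b c p)
    (h3 : coordFst a b c p + coordSnd a b c p < 1) :
    p ∈ interior (convexHull ℝ ({a, b, c} : Set Pt)) := by
  have hsub : {q | 0 < coordFst a b c q ∧ 0 < coordSnd a b c q ∧
      coordFst a b c q + coordSnd a b c q < 1} ⊆ convexHull ℝ ({a, b, c} : Set Pt) := by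
    rintro q ⟨q1, q2, q3⟩
    rw [eq_combo_coord h q]
    have ha : a ∈ convexHull ℝ ({a, b, c} : Set Pt) := subset_convexHull ℝ _ (by simp)
    have hb : b ∈ convexHull ℝ ({a, b, c} : Set Pt) := subset_convexHull ℝ _ (by simp)
    have hc : c ∈ convexHull ℝ ({a, b, c} : Set Pt) := subset_convexHull ℝ _ (by simp)
    have := (convex_convexHull ℝ ({a, b, c} : Set Pt)).sum_mem (t := Finset.univ)
      (w := ![1 - coordFst a b c q - coordSnd a b c q, coordFst a b c q, coordSnd a b c q])
      (z := ![a, b, c]) (by intro i _; fin_cases i <;> simp <;> linarith)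
      (by simp only [Fin.sum_univ_three, Matrix.cons_val]; ring) (by intro i _; fin_cases i <;> simp [ha, hb, hc])
    simpa [Fin.sum_univ_three] using this
  have hc1 : Continuous (coordFst a b c) := by unfold coordFst planeDet; fun_prop
  have hc2 : Continuous (coordSnd a b c) := by unfold coordSnd planeDet; fun_prop
  refine interior_maximal hsub ?_ ⟨h1, h2, h3⟩
  exact (isOpen_lt continuous_const hc1).inter
    ((isOpen_lt continuous_const hc2).inter (isOpen_lt (hc1.add hc2) continuous_const))

theorem exists_mem_combo_of_lt {A : Set Pt} (hA : Convex ℝ A)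
    {p q r : Pt} (hq : q ∈ A) (hr : r ∈ A)
    (h1 : coordFst a b c q < coordFst a b c p) (h2 : coordFst a b c p < coordFst a b c r) :
    ∃ s t : ℝ, 0 < s ∧ 0 < t ∧ s + t = 1 ∧ s • q + t • r ∈ A ∧
      coordFst a b c (s • q + t • r) = coordFst a b c p := by
  have hd : 0 < coordFst a b c r - coordFst a b c q := by linarith
  have hst : (coordFst a b c r - coordFst a b c p) / (coordFst a b c r - coordFst a b c q)
      + (coordFst a b c p - coordFst a b c q) / (coordFst a b c r - coordFst a b c q) = 1 := by
    field_simp; ring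
  have hs := div_pos (sub_pos.2 h2) hd
  have ht := div_pos (sub_pos.2 h1) hd
  refine ⟨_, _, hs, ht, hst, hA hq hr hs.le ht.le hst, ?_⟩
  rw [coordFst_combo _ _ hst]
  field_simp; ring

/-- A point with points of a convex set in all four open quadrants around it is in the set. -/
theorem mem_of_four_quadrants (h : planeDet (b - a) (c - a) ≠ 0) {A : Set Pt} (hA : Convex ℝ A)
    {p ne nw sw se : Pt} (hne : ne ∈ A) (hnw : nw ∈ A) (hsw : sw ∈ A) (hse : se ∈ A)
    (ne1 : coordFst a b c p < coordFst a b c ne) (ne2 : coordSnd a b c p < coordSnd a b c ne)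
    (nw1 : coordFst a b c nw < coordFst a b c p) (nw2 : coordSnd a b c p < coordSnd a b c nw)
    (sw1 : coordFst a b c sw < coordFst a b c p) (sw2 : coordSnd a b c sw < coordSnd a b c p)
    (se1 : coordFst a b c p < coordFst a b c se) (se2 : coordSnd a b c se < coordSnd a b c p) :
    p ∈ A := by
  obtain ⟨s, t, hs, ht, hst, hn, hn1⟩ := exists_mem_combo_of_lt hA hnw hne nw1 ne1
  obtain ⟨s', t', hs', ht', hst', hm, hm1⟩ := exists_mem_combo_of_lt hA hsw hse sw1 se1
  have hn2 := coordSnd_combo (a := a) (b := b) (c := c) nw ne hst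
  have hm2 := coordSnd_combo (a := a) (b := b) (c := c) sw se hst'
  have hup : coordSnd a b c p < coordSnd a b c (s • nw + t • ne) := by
    rw [hn2]
    calc coordSnd a b c p = s * coordSnd a b c p + t * coordSnd a b c p := by
          rw [← add_mul, hst, one_mul]
      _ < _ := by gcongr
  have hdown : coordSnd a b c (s' • sw + t' • se) < coordSnd a b c p := by
    rw [hm2]
    calc _ < s' * coordSnd a b c p + t' * coordSnd a b c p := by gcongr
      _ = coordSnd a b c p := by rw [← add_mul, hst', one_mul]
  generalize s • nw + t • ne = u at *
  generalize s' • sw + t' • se = v at *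
  have hd : 0 < coordSnd a b c u - coordSnd a b c v := by linarith
  have hσ := div_pos (sub_pos.2 hdown) hd
  have hτ := div_pos (sub_pos.2 hup) hd
  have hστ : (coordSnd a b c p - coordSnd a b c v) / (coordSnd a b c u - coordSnd a b c v)
      + (coordSnd a b c u - coordSnd a b c p) / (coordSnd a b c u - coordSnd a b c v) = 1 := by
    field_simp; ring
  have hp : p = ((coordSnd a b c p - coordSnd a b c v) /
      (coordSnd a b c u - coordSnd a b c v)) • u + ((coordSnd a b c u - coordSnd a b c p) /
        (coordSnd a b c u - coordSnd a b c v)) • v := by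
    refine coord_injective h ?_ ?_
    · rw [coordFst_combo _ _ hστ, hn1, hm1, ← add_mul, hστ, one_mul]
    · rw [coordSnd_combo _ _ hστ]
      field_simp; ring
  rw [hp]
  exact hA hn hm hσ.le hτ.le hστ

end Frame

theorem collinear_of_planeDet_eq_zero {a b c : Pt} (hab : a ≠ b)
    (h : planeDet (b - a) (c - a) = 0) : Collinear ℝ ({a, b, c} : Set Pt) := by
  rw [collinear_iff_of_mem (p₀ := a) (by simp)]
  refine ⟨b - a, ?_⟩
  simp only [planeDet, Prod.fst_sub, Prod.snd_sub] at h
  have hc : ∃ r : ℝ, c = r • (b - a) +ᵥ a := by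
    by_cases h1 : b.1 - a.1 = 0
    · have h2 : b.2 - a.2 ≠ 0 := fun h2 => hab (Prod.ext (by linarith) (by linarith))
      refine ⟨(c.2 - a.2) / (b.2 - a.2), ?_⟩
      ext <;> simp only [vadd_eq_add, Prod.fst_add, Prod.snd_add, Prod.smul_fst, Prod.smul_snd,
        Prod.fst_sub, Prod.snd_sub, smul_eq_mul] <;> field_simp
      · linear_combination -h
      · ring
    · refine ⟨(c.1 - a.1) / (b.1 - a.1), ?_⟩
      ext <;> simp only [vadd_eq_add, Prod.fst_add, Prod.snd_add, Prod.smul_fst, Prod.smul_snd,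
        Prod.fst_sub, Prod.snd_sub, smul_eq_mul] <;> field_simp
      · ring
      · linear_combination h
  rintro p (rfl | rfl | rfl)
  · exact ⟨0, by simp⟩
  · exact ⟨1, by simp⟩
  · exact hc

/-- The points of a finite set in convex position: each is an extreme point of the hull. -/
def ConvexPosition (Y : Finset Pt) : Prop :=
  ∀ p ∈ Y, p ∈ Set.extremePoints ℝ (convexHull ℝ (Y : Set Pt))

theorem ConvexPosition.not_wbtw {Y : Finset Pt} (hY : ConvexPosition Y) {a b c : Pt}
    (ha : a ∈ Y) (hb : b ∈ Y) (hc : c ∈ Y) (hab : a ≠ b) (hbc : b ≠ c) : ¬ Wbtw ℝ a b c := by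
  intro hw
  have hw' := mem_segment_iff_wbtw.2 hw
  rcases (mem_extremePoints_iff_forall_segment.1 (hY b hb)).2 a
    (subset_convexHull ℝ _ ha) c (subset_convexHull ℝ _ hc) hw' with h | h
  · exact hab h
  · exact hbc h.symm

theorem ConvexPosition.planeDet_ne_zero {Y : Finset Pt} (hY : ConvexPosition Y) {a b c : Pt}
    (ha : a ∈ Y) (hb : b ∈ Y) (hc : c ∈ Y) (hab : a ≠ b) (hac : a ≠ c) (hbc : b ≠ c) :
    planeDet (b - a) (c - a) ≠ 0 := by
  intro h
  rcases (collinear_of_planeDet_eq_zero hab h).wbtw_or_wbtw_or_wbtw with hw | hw | hw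
  · exact hY.not_wbtw ha hb hc hab hbc hw
  · exact hY.not_wbtw hb hc ha hbc hac.symm hw
  · exact hY.not_wbtw hc ha hb hac.symm hab hw

/-- A set in convex position with at least three points lies in a parallelogram spanned by three
of its points. -/
theorem ConvexPosition.exists_frame {Y : Finset Pt} (hY : ConvexPosition Y) (h3 : 3 ≤ Y.card) :
    ∃ a ∈ Y, ∃ b ∈ Y, ∃ c ∈ Y, planeDet (b - a) (c - a) ≠ 0 ∧
      ∀ p ∈ Y, |coordFst a b c p| ≤ 1 ∧ |coordSnd a b c p| ≤ 1 := by
  obtain ⟨a₀, b₀, c₀, ha₀, hb₀, hc₀, hab, hac, hbc⟩ := 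
    Finset.two_lt_card_iff.1 (show 2 < Y.card by omega)
  obtain ⟨⟨a, b, c⟩, hmem, hmax⟩ := Finset.exists_max_image (Y ×ˢ Y ×ˢ Y)
    (fun q : Pt × Pt × Pt => |planeDet (q.2.1 - q.1) (q.2.2 - q.1)|)
    ⟨(a₀, b₀, c₀), by simp [ha₀, hb₀, hc₀]⟩
  simp only [Finset.mem_product] at hmem
  obtain ⟨ha, hb, hc⟩ := hmem
  have hpos : 0 < |planeDet (b - a) (c - a)| :=
    (abs_pos.2 (hY.planeDet_ne_zero ha₀ hb₀ hc₀ hab hac hbc)).trans_le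
      (hmax (a₀, b₀, c₀) (by simp [ha₀, hb₀, hc₀]))
  refine ⟨a, ha, b, hb, c, hc, abs_pos.1 hpos, fun p hp => ⟨?_, ?_⟩⟩
  · rw [coordFst, abs_div, div_le_one hpos]
    exact hmax (a, p, c) (by simp [ha, hp, hc])
  · rw [coordSnd, abs_div, div_le_one hpos]
    exact hmax (a, b, p) (by simp [ha, hp, hb])

/-- The index of the cell of side `1 / m` containing `p`, in affine coordinates. -/
def cellIndex (m : ℕ) (a b c p : Pt) : ℤ × ℤ := (⌊coordFst a b c p * m⌋, ⌊coordSnd a b c p * m⌋)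

/-- A set of cells with an empty strict quadrant around each of its cells is small. -/
theorem card_le_of_empty_quadrant (m : ℕ) (S : Finset (ℤ × ℤ))
    (hb : ∀ q ∈ S, |q.1| ≤ m ∧ |q.2| ≤ m)
    (hS : ∀ q ∈ S, ¬ ((∃ r ∈ S, q.1 < r.1 ∧ q.2 < r.2) ∧ (∃ r ∈ S, r.1 < q.1 ∧ q.2 < r.2) ∧
      (∃ r ∈ S, r.1 < q.1 ∧ r.2 < q.2) ∧ ∃ r ∈ S, q.1 < r.1 ∧ r.2 < q.2)) :
    S.card ≤ 4 * (4 * m + 1) := by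
  classical
  have key : ∀ (T : Finset (ℤ × ℤ)) (f : ℤ × ℤ → ℤ), T ⊆ S →
      (∀ q ∈ S, |f q| ≤ 2 * m) → Set.InjOn f T → T.card ≤ 4 * m + 1 := by
    intro T f hT hf hinj
    have := Finset.card_le_card_of_injOn (t := Finset.Icc (-(2 * m : ℤ)) (2 * m)) f
      (fun q hq => by
        have := abs_le.1 (hf q (hT hq))
        simpa using this) hinj
    rw [Int.card_Icc] at this
    omega
  have hdiff : ∀ q ∈ S, |q.1 - q.2| ≤ 2 * (m : ℤ) := fun q hq => by
    have h1 := abs_le.1 (hb q hq).1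
    have h2 := abs_le.1 (hb q hq).2
    exact abs_le.2 ⟨by omega, by omega⟩
  have hsum : ∀ q ∈ S, |q.1 + q.2| ≤ 2 * (m : ℤ) := fun q hq => by
    have h1 := abs_le.1 (hb q hq).1
    have h2 := abs_le.1 (hb q hq).2
    exact abs_le.2 ⟨by omega, by omega⟩
  let S1 := S.filter fun q => ¬ ∃ r ∈ S, q.1 < r.1 ∧ q.2 < r.2
  let S2 := S.filter fun q => ¬ ∃ r ∈ S, r.1 < q.1 ∧ q.2 < r.2
  let S3 := S.filter fun q => ¬ ∃ r ∈ S, r.1 < q.1 ∧ r.2 < q.2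
  let S4 := S.filter fun q => ¬ ∃ r ∈ S, q.1 < r.1 ∧ r.2 < q.2
  have hcover : S ⊆ S1 ∪ S2 ∪ (S3 ∪ S4) := by
    intro q hq
    have := hS q hq
    simp only [S1, S2, S3, S4, Finset.mem_union, Finset.mem_filter, hq, true_and]
    rw [not_and_or, not_and_or, not_and_or] at this
    rcases this with h | h | h | h
    · exact .inl (.inl h)
    · exact .inl (.inr h)
    · exact .inr (.inl h)
    · exact .inr (.inr h)
  have h1 : S1.card ≤ 4 * m + 1 := by
    refine key S1 (fun q => q.1 - q.2) (Finset.filter_subset _ _) hdiff ?_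
    intro q hq r hr hqr
    simp only [S1, Finset.coe_filter, Set.mem_ofPred_eq, not_exists, not_and] at hq hr hqr
    have e1 := hq.2 r hr.1
    have e2 := hr.2 q hq.1
    ext <;> omega
  have h2 : S2.card ≤ 4 * m + 1 := by
    refine key S2 (fun q => q.1 + q.2) (Finset.filter_subset _ _) hsum ?_
    intro q hq r hr hqr
    simp only [S2, Finset.coe_filter, Set.mem_ofPred_eq, not_exists, not_and] at hq hr hqr
    have e1 := hq.2 r hr.1
    have e2 := hr.2 q hq.1
    ext <;> omega
  have h3 : S3.card ≤ 4 * m + 1 := by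
    refine key S3 (fun q => q.1 - q.2) (Finset.filter_subset _ _) hdiff ?_
    intro q hq r hr hqr
    simp only [S3, Finset.coe_filter, Set.mem_ofPred_eq, not_exists, not_and] at hq hr hqr
    have e1 := hq.2 r hr.1
    have e2 := hr.2 q hq.1
    ext <;> omega
  have h4 : S4.card ≤ 4 * m + 1 := by
    refine key S4 (fun q => q.1 + q.2) (Finset.filter_subset _ _) hsum ?_
    intro q hq r hr hqr
    simp only [S4, Finset.coe_filter, Set.mem_ofPred_eq, not_exists, not_and] at hq hr hqr
    have e1 := hq.2 r hr.1
    have e2 := hr.2 q hq.1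
    ext <;> omega
  have := Finset.card_le_card hcover
  have := Finset.card_union_le (S1 ∪ S2) (S3 ∪ S4)
  have := Finset.card_union_le S1 S2
  have := Finset.card_union_le S3 S4
  omega

theorem lt_of_floor_mul_lt {x y : ℝ} {m : ℕ} (h : ⌊x * m⌋ < ⌊y * m⌋) : x < y := by
  by_contra! hle
  exact absurd h (not_lt.2 (Int.floor_le_floor (by gcongr)))

theorem abs_floor_mul_le {x : ℝ} {m : ℕ} (h : |x| ≤ 1) : |⌊x * m⌋| ≤ m := by
  obtain ⟨h1, h2⟩ := abs_le.1 h
  have hm : (0 : ℝ) ≤ m := m.cast_nonneg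
  refine abs_le.2 ⟨Int.le_floor.2 ?_, Int.cast_le (R := ℝ).1 ((Int.floor_le _).trans ?_)⟩
  · push_cast; nlinarith
  · push_cast; nlinarith

/-- The collections of at most linearly many cells of the grid with `(2 * m + 1) ^ 2` cells. -/
def cellFamilies (m : ℕ) : Finset (Finset (ℤ × ℤ)) :=
  (Finset.Icc (-(m : ℤ)) m ×ˢ Finset.Icc (-(m : ℤ)) m).powerset.filter
    fun S => S.card ≤ 4 * (4 * m + 1)

/-- A set in convex position meets few cells of a grid. -/
theorem ConvexPosition.image_cellIndex_mem {Y : Finset Pt} (hY : ConvexPosition Y) (m : ℕ)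
    {a b c : Pt} (h : planeDet (b - a) (c - a) ≠ 0)
    (hb : ∀ p ∈ Y, |coordFst a b c p| ≤ 1 ∧ |coordSnd a b c p| ≤ 1) :
    Y.image (cellIndex m a b c) ∈ cellFamilies m := by
  have hbd : ∀ q ∈ Y.image (cellIndex m a b c), |q.1| ≤ m ∧ |q.2| ≤ m := by
    intro q hq
    obtain ⟨p, hp, rfl⟩ := Finset.mem_image.1 hq
    exact ⟨abs_floor_mul_le (hb p hp).1, abs_floor_mul_le (hb p hp).2⟩
  rw [cellFamilies, Finset.mem_filter, Finset.mem_powerset]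
  refine ⟨fun q hq => ?_, card_le_of_empty_quadrant m _ hbd ?_⟩
  · have := hbd q hq
    rw [abs_le, abs_le] at this
    simpa [Finset.mem_product, Finset.mem_Icc] using this
  intro q hq
  obtain ⟨p, hp, rfl⟩ := Finset.mem_image.1 hq
  simp only [Finset.exists_mem_image]
  rintro ⟨⟨ne, hne, ne1, ne2⟩, ⟨nw, hnw, nw1, nw2⟩, ⟨sw, hsw, sw1, sw2⟩, ⟨se, hse, se1, se2⟩⟩
  have hext := (convex_convexHull ℝ (Y : Set Pt)).mem_extremePoints_iff_convex_sdiff.1 (hY p hp)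
  have hmem : ∀ q ∈ Y, q ≠ p → q ∈ convexHull ℝ (Y : Set Pt) \ {p} :=
    fun q hq hqp => ⟨subset_convexHull ℝ _ hq, hqp⟩
  have hp' := mem_of_four_quadrants h hext.2
    (hmem ne hne (by rintro rfl; exact lt_irrefl _ ne1))
    (hmem nw hnw (by rintro rfl; exact lt_irrefl _ nw1))
    (hmem sw hsw (by rintro rfl; exact lt_irrefl _ sw1))
    (hmem se hse (by rintro rfl; exact lt_irrefl _ se1))
    (lt_of_floor_mul_lt ne1) (lt_of_floor_mul_lt ne2) (lt_of_floor_mul_lt nw1)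
    (lt_of_floor_mul_lt nw2) (lt_of_floor_mul_lt sw1) (lt_of_floor_mul_lt sw2)
    (lt_of_floor_mul_lt se1) (lt_of_floor_mul_lt se2)
  exact hp'.2 rfl

/-- The parallelogram of side `w` with corner `(s, t)`, in affine coordinates. -/
def coordBox (a b c : Pt) (s t w : ℝ) : Set Pt :=
  {p | (s ≤ coordFst a b c p ∧ coordFst a b c p < s + w) ∧
    (t ≤ coordSnd a b c p ∧ coordSnd a b c p < t + w)}

theorem measurable_coordFst : Measurable fun q : Pt × Pt × Pt × Pt =>
    coordFst q.1 q.2.1 q.2.2.1 q.2.2.2 := by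
  unfold coordFst planeDet; fun_prop

theorem measurable_coordSnd : Measurable fun q : Pt × Pt × Pt × Pt =>
    coordSnd q.1 q.2.1 q.2.2.1 q.2.2.2 := by
  unfold coordSnd planeDet; fun_prop

theorem volume_coordBox {a b c : Pt} (h : planeDet (b - a) (c - a) ≠ 0) (s t : ℝ) {w : ℝ}
    (hw : 0 < w) :
    volume (coordBox a b c s t w) = ENNReal.ofReal (w ^ 2) * volume (coordBox a b c 0 0 1) := by
  set e : Pt := a - w⁻¹ • (a + s • (b - a) + t • (c - a)) with he
  have h1 : ∀ p, coordFst a b c (w⁻¹ • p + e) = (coordFst a b c p - s) / w := by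
    intro p
    simp only [coordFst]
    field_simp
    simp only [he, planeDet, Prod.fst_sub, Prod.snd_sub, Prod.fst_add, Prod.snd_add,
      Prod.smul_fst, Prod.smul_snd, smul_eq_mul]
    field_simp
    ring
  have h2 : ∀ p, coordSnd a b c (w⁻¹ • p + e) = (coordSnd a b c p - t) / w := by
    intro p
    simp only [coordSnd]
    field_simp
    simp only [he, planeDet, Prod.fst_sub, Prod.snd_sub, Prod.fst_add, Prod.snd_add,
      Prod.smul_fst, Prod.smul_snd, smul_eq_mul]
    field_simp
    ring
  have hpre : coordBox a b c s t w =
      (fun p : Pt => w⁻¹ • p) ⁻¹' ((fun p => p + e) ⁻¹' coordBox a b c 0 0 1) := by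
    ext p
    simp only [coordBox, Set.mem_preimage, Set.mem_ofPred_eq, h1, h2, zero_add, le_div_iff₀ hw,
      div_lt_iff₀ hw, zero_mul, one_mul, sub_nonneg, sub_lt_iff_lt_add']
  rw [hpre, Measure.addHaar_preimage_smul _ (inv_ne_zero hw.ne'), measure_preimage_add_right]
  congr 2
  rw [Module.finrank_prod, Module.finrank_self, inv_pow, inv_inv, abs_of_nonneg (by positivity)]

theorem cellIndex_preimage_subset {m : ℕ} (hm : 0 < m) (a b c : Pt) (S : Finset (ℤ × ℤ)) :
    {p | cellIndex m a b c p ∈ S} ⊆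
      ⋃ q ∈ S, coordBox a b c ((q.1 : ℝ) / m) ((q.2 : ℝ) / m) (1 / m) := by
  intro p hp
  have hm' : (0 : ℝ) < m := by exact_mod_cast hm
  refine Set.mem_iUnion₂.2 ⟨_, hp, ?_⟩
  simp only [coordBox, cellIndex, Set.mem_ofPred_eq, ← add_div, div_le_iff₀ hm', lt_div_iff₀ hm']
  exact ⟨⟨Int.floor_le _, Int.lt_floor_add_one _⟩, Int.floor_le _, Int.lt_floor_add_one _⟩

/-- A parallelogram well inside the triangle spanned by `a`, `b`, `c`. -/
def innerBox (a b c : Pt) : Set Pt := coordBox a b c (1 / 8) (1 / 8) (1 / 4)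

theorem innerBox_subset_interior {a b c : Pt} (h : planeDet (b - a) (c - a) ≠ 0) :
    innerBox a b c ⊆ interior (convexHull ℝ ({a, b, c} : Set Pt)) := by
  rintro p ⟨⟨h1, h2⟩, h3, h4⟩
  exact mem_interior_convexHull_of_coord_pos h (by linarith) (by linarith) (by linarith)

theorem measurableSet_innerBox : MeasurableSet {q : Pt × Pt × Pt × Pt |
    q.2.2.2 ∈ innerBox q.1 q.2.1 q.2.2.1} := by
  simp only [innerBox, coordBox, Set.mem_ofPred_eq]
  exact ((measurableSet_le measurable_const measurable_coordFst).inter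
    (measurableSet_lt measurable_coordFst measurable_const)).inter
    ((measurableSet_le measurable_const measurable_coordSnd).inter
    (measurableSet_lt measurable_coordSnd measurable_const))

theorem measurableSet_cellIndex (m : ℕ) (S : Finset (ℤ × ℤ)) :
    MeasurableSet {q : Pt × Pt × Pt × Pt | cellIndex m q.1 q.2.1 q.2.2.1 q.2.2.2 ∈ S} := by
  have : Measurable fun q : Pt × Pt × Pt × Pt => cellIndex m q.1 q.2.1 q.2.2.1 q.2.2.2 :=
    (Int.measurable_floor.comp (measurable_coordFst.mul_const _)).prodMk
      (Int.measurable_floor.comp (measurable_coordSnd.mul_const _))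
  exact this (S : Set (ℤ × ℤ)).to_countable.measurableSet

theorem volume_cells_le {m : ℕ} (hm : 2 ^ 19 ≤ m) {a b c : Pt}
    (h : planeDet (b - a) (c - a) ≠ 0) {S : Finset (ℤ × ℤ)} (hS : S ∈ cellFamilies m) :
    2 ^ 9 * volume {p | cellIndex m a b c p ∈ S} ≤ 2⁻¹ * volume (innerBox a b c) := by
  have hm0 : 0 < m := lt_of_lt_of_le (by norm_num) hm
  have hmr : (2 : ℝ) ^ 19 ≤ m := by exact_mod_cast hm
  have hm' : (0 : ℝ) < m := by exact_mod_cast hm0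
  have hcard : (S.card : ℝ) ≤ 4 * (4 * m + 1) := by
    exact_mod_cast (Finset.mem_filter.1 hS).2
  rw [innerBox, volume_coordBox h _ _ (by norm_num)]
  calc 2 ^ 9 * volume {p | cellIndex m a b c p ∈ S}
      ≤ 2 ^ 9 * ∑ q ∈ S, volume (coordBox a b c ((q.1 : ℝ) / m) ((q.2 : ℝ) / m) (1 / m)) := by
        gcongr
        exact (measure_mono (cellIndex_preimage_subset hm0 a b c S)).trans
          (measure_biUnion_finset_le _ _)
    _ = ENNReal.ofReal (2 ^ 9 * (S.card * (1 / m) ^ 2)) * volume (coordBox a b c 0 0 1) := by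
        rw [Finset.sum_congr rfl fun q _ => volume_coordBox h _ _ (one_div_pos.2 hm'),
          Finset.sum_const, nsmul_eq_mul, ENNReal.ofReal_mul (by positivity),
          ENNReal.ofReal_mul (by positivity), ENNReal.ofReal_natCast,
          ENNReal.ofReal_pow (by norm_num)]
        norm_num
        ring
    _ ≤ ENNReal.ofReal (2⁻¹ * (1 / 4) ^ 2) * volume (coordBox a b c 0 0 1) := by
        refine mul_le_mul' (ENNReal.ofReal_le_ofReal ?_) le_rfl
        rw [one_div, inv_pow, ← div_eq_mul_inv, ← mul_div_assoc, div_le_iff₀ (by positivity)]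
        nlinarith
    _ = 2⁻¹ * (ENNReal.ofReal ((1 / 4) ^ 2) * volume (coordBox a b c 0 0 1)) := by
        rw [ENNReal.ofReal_mul (by positivity), ENNReal.ofReal_inv_of_pos (by norm_num),
          ENNReal.ofReal_ofNat, mul_assoc]

open Classical in
/-- An exponential weight rewarding points in the cells `S` and penalizing points in the inner
parallelogram. -/
def cellWeight (m : ℕ) (S : Finset (ℤ × ℤ)) (a b c p : Pt) : ENNReal :=
  (if cellIndex m a b c p ∈ S then 2 ^ 9 else 1) * (if p ∈ innerBox a b c then 2⁻¹ else 1)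

theorem Measurable.cellWeight (m : ℕ) (S : Finset (ℤ × ℤ)) {X : Type*} [MeasurableSpace X]
    {a b c p : X → Pt} (ha : Measurable a) (hb : Measurable b) (hc : Measurable c)
    (hp : Measurable p) : Measurable fun x => cellWeight m S (a x) (b x) (c x) (p x) := by
  have hq : Measurable fun x => (a x, b x, c x, p x) := by fun_prop
  have hU : MeasurableSet {x | cellIndex m (a x) (b x) (c x) (p x) ∈ S} :=
    hq (measurableSet_cellIndex m S)
  have hQ : MeasurableSet {x | p x ∈ innerBox (a x) (b x) (c x)} := hq measurableSet_innerBox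
  exact (Measurable.ite hU measurable_const measurable_const).mul
    (Measurable.ite hQ measurable_const measurable_const)

theorem cellWeight_add_le (m : ℕ) (S : Finset (ℤ × ℤ)) (a b c p : Pt) :
    cellWeight m S a b c p + (innerBox a b c).indicator (fun _ => 2⁻¹) p
      ≤ 1 + {p | cellIndex m a b c p ∈ S}.indicator (fun _ => 2 ^ 9) p := by
  have h2 : (2⁻¹ : ENNReal) ≤ 1 := ENNReal.inv_le_one.2 one_le_two
  by_cases hU : cellIndex m a b c p ∈ S <;> by_cases hQ : p ∈ innerBox a b c <;>
    simp only [cellWeight, Set.indicator, Set.mem_ofPred_eq, hU, hQ, if_true, if_false, one_mul,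
      mul_one, add_zero, ENNReal.inv_two_add_inv_two, le_refl]
  · rw [add_comm]
    exact add_le_add h2 (mul_le_of_le_one_right' h2)
  · exact le_add_self

theorem isProbabilityMeasure_unifOn {Γ : Set Pt} (hc : IsCompact Γ)
    (hi : (interior Γ).Nonempty) : IsProbabilityMeasure (unifOn Γ) := by
  refine ⟨?_⟩
  have h0 : volume Γ ≠ 0 :=
    ((isOpen_interior.measure_pos volume hi).trans_le (measure_mono interior_subset)).ne'
  rw [unifOn, Measure.smul_apply, Measure.restrict_apply_univ, smul_eq_mul,
    ENNReal.inv_mul_cancel h0 hc.measure_lt_top.ne]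

/-- The weight has expectation at most one, for any nondegenerate frame of points of `Γ`. -/
theorem lintegral_cellWeight_le_one {Γ : Set Pt} (hc : IsCompact Γ) (hconv : Convex ℝ Γ)
    (hi : (interior Γ).Nonempty) {m : ℕ} (hm : 2 ^ 19 ≤ m) {a b c : Pt} (ha : a ∈ Γ) (hb : b ∈ Γ)
    (hc' : c ∈ Γ) (h : planeDet (b - a) (c - a) ≠ 0) {S : Finset (ℤ × ℤ)}
    (hS : S ∈ cellFamilies m) : ∫⁻ p, cellWeight m S a b c p ∂unifOn Γ ≤ 1 := by
  have := isProbabilityMeasure_unifOn hc hi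
  have hpair : Measurable fun p : Pt => (a, b, c, p) := by fun_prop
  have hQm : MeasurableSet (innerBox a b c) := hpair measurableSet_innerBox
  have hUm : MeasurableSet {p | cellIndex m a b c p ∈ S} := hpair (measurableSet_cellIndex m S)
  have hQΓ : innerBox a b c ⊆ Γ := (innerBox_subset_interior h).trans <|
    interior_subset.trans <| convexHull_min (by rintro p (rfl | rfl | rfl) <;> assumption) hconv
  have hUQ : 2 ^ 9 * unifOn Γ {p | cellIndex m a b c p ∈ S} ≤ 2⁻¹ * unifOn Γ (innerBox a b c) := by
    simp only [unifOn, Measure.smul_apply, smul_eq_mul, Measure.restrict_eq_self _ hQΓ]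
    rw [mul_left_comm, mul_left_comm 2⁻¹]
    refine mul_le_mul' le_rfl ?_
    exact (mul_le_mul' le_rfl (Measure.restrict_apply_le _ _)).trans (volume_cells_le hm h hS)
  have hWm : Measurable (cellWeight m S a b c) :=
    .cellWeight m S measurable_const measurable_const measurable_const measurable_id
  have hint := lintegral_mono (μ := unifOn Γ) (cellWeight_add_le m S a b c)
  rw [lintegral_add_left hWm, lintegral_add_left measurable_const,
    lintegral_indicator_const hQm, lintegral_indicator_const hUm, lintegral_const, measure_univ,
    one_mul] at hint
  have hfin : 2⁻¹ * unifOn Γ (innerBox a b c) ≠ ⊤ :=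
    ENNReal.mul_ne_top (by simp) (measure_ne_top _ _)
  exact (ENNReal.add_le_add_iff_right hfin).1 (hint.trans (add_le_add le_rfl hUQ))

/-- If the convex hull of a large convex-position set contains few points, then the product of the
weights over the remaining points is large for some frame and some family of cells. -/
theorem ConvexPosition.exists_le_prod_cellWeight {n k : ℕ} (m : ℕ) {x : Fin n → Pt}
    (hx : Function.Injective x) {Y : Finset Pt} (hYx : Y ⊆ Finset.image x Finset.univ)
    (hk : Y.card = k) (h3 : 3 ≤ k) (hY : ConvexPosition Y)
    (hfew : (((Finset.image x Finset.univ \ Y : Finset Pt) : Set Pt) ∩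
      interior (convexHull ℝ (Y : Set Pt))).ncard < k) :
    ∃ i j l, ∃ S ∈ cellFamilies m, planeDet (x j - x i) (x l - x i) ≠ 0 ∧
      (2 : ENNReal) ^ (7 * k) ≤
        2 ^ 27 * ∏ h ∈ Finset.univ \ {i, j, l}, cellWeight m S (x i) (x j) (x l) (x h) := by
  classical
  obtain ⟨a, ha, b, hb, c, hc, hdet, hbox⟩ := hY.exists_frame (hk ▸ h3)
  have hS := hY.image_cellIndex_mem m hdet hbox
  have hint : innerBox a b c ⊆ interior (convexHull ℝ (Y : Set Pt)) :=
    (innerBox_subset_interior hdet).trans <| interior_mono <| convexHull_mono <| by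
      rintro p (rfl | rfl | rfl) <;> assumption
  obtain ⟨i, -, rfl⟩ := Finset.mem_image.1 (hYx ha)
  obtain ⟨j, -, rfl⟩ := Finset.mem_image.1 (hYx hb)
  obtain ⟨l, -, rfl⟩ := Finset.mem_image.1 (hYx hc)
  refine ⟨i, j, l, _, hS, hdet, ?_⟩
  simp only [cellWeight]
  rw [Finset.prod_mul_distrib, Finset.prod_ite, Finset.prod_ite, Finset.prod_const,
    Finset.prod_const, Finset.prod_const, Finset.prod_const, one_pow, one_pow, mul_one, mul_one]
  set P := (Finset.univ \ {i, j, l}).filter fun h =>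
    cellIndex m (x i) (x j) (x l) (x h) ∈ Y.image (cellIndex m (x i) (x j) (x l)) with hP
  set R := (Finset.univ \ {i, j, l}).filter fun h => x h ∈ innerBox (x i) (x j) (x l) with hR
  have hPcard : k ≤ P.card + 3 := by
    have hsub : Y ⊆ (P ∪ {i, j, l}).image x := by
      intro p hp
      obtain ⟨h, -, rfl⟩ := Finset.mem_image.1 (hYx hp)
      refine Finset.mem_image_of_mem _ ?_
      by_cases hh : h ∈ ({i, j, l} : Finset (Fin n))
      · exact Finset.mem_union_right _ hh
      · exact Finset.mem_union_left _ (Finset.mem_filter.2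
          ⟨Finset.mem_sdiff.2 ⟨Finset.mem_univ _, hh⟩, Finset.mem_image_of_mem _ hp⟩)
    have h1 := (Finset.card_le_card hsub).trans Finset.card_image_le
    have h2 := Finset.card_union_le P {i, j, l}
    have h4 : ({i, j, l} : Finset (Fin n)).card ≤ 3 := Finset.card_le_three
    omega
  have hRcard : R.card ≤ 2 * k := by
    have hfin : (((Finset.image x Finset.univ \ Y : Finset Pt) : Set Pt) ∩
      interior (convexHull ℝ (Y : Set Pt))).Finite := (Finset.finite_toSet _).inter_of_left _
    rw [Set.ncard_eq_toFinset_card _ hfin] at hfew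
    have hsub : R.image x ⊆ Y ∪ hfin.toFinset := by
      intro p hp
      obtain ⟨h, hh, rfl⟩ := Finset.mem_image.1 hp
      by_cases hpY : x h ∈ Y
      · exact Finset.mem_union_left _ hpY
      · refine Finset.mem_union_right _ (hfin.mem_toFinset.2 ⟨?_, hint (Finset.mem_filter.1 hh).2⟩)
        exact Finset.mem_coe.2 (Finset.mem_sdiff.2
          ⟨Finset.mem_image_of_mem _ (Finset.mem_univ _), hpY⟩)
    have h1 := Finset.card_le_card hsub
    rw [Finset.card_image_of_injective _ hx] at h1
    have h2 := Finset.card_union_le Y hfin.toFinset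
    omega
  calc (2 : ENNReal) ^ (7 * k) = 2 ^ (9 * k) * 2⁻¹ ^ (2 * k) := by
        rw [show 9 * k = 7 * k + 2 * k by ring, pow_add, mul_assoc, ← mul_pow,
          ENNReal.mul_inv_cancel two_ne_zero ENNReal.ofNat_ne_top, one_pow, mul_one]
    _ ≤ 2 ^ (27 + 9 * P.card) * 2⁻¹ ^ R.card := by
        refine mul_le_mul' (pow_le_pow_right₀ one_le_two (by omega)) ?_
        exact pow_le_pow_right_of_le_one' (ENNReal.inv_le_one.2 one_le_two) hRcard
    _ = 2 ^ 27 * ((2 ^ 9) ^ P.card * 2⁻¹ ^ R.card) := by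
        rw [pow_add, pow_mul, mul_assoc]

theorem lmarginal_prod_le_one {ι E : Type*} [DecidableEq ι] [MeasurableSpace E] (μ : Measure E)
    [SigmaFinite μ] (g : (ι → E) → E → ENNReal)
    (hg : Measurable fun q : (ι → E) × E => g q.1 q.2) (h1 : ∀ x, ∫⁻ p, g x p ∂μ ≤ 1)
    (s : Finset ι) (hdep : ∀ i ∈ s, ∀ x p, g (Function.update x i p) = g x) :
    lmarginal (fun _ : ι => μ) s (fun x => ∏ h ∈ s, g x (x h)) ≤ 1 := by
  induction s using Finset.induction_on with
  | empty =>
    intro x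
    simp
  | insert i s hi ih =>
    have hmeas : ∀ t : Finset ι, Measurable fun x : ι → E => ∏ h ∈ t, g x (x h) := fun t =>
      Finset.measurable_fun_prod t fun h _ => hg.comp (measurable_id.prodMk (measurable_pi_apply h))
    rw [lmarginal_insert' _ (hmeas _) hi]
    refine le_trans (lmarginal_mono fun x => ?_) (ih fun j hj => hdep j (Finset.mem_insert_of_mem hj))
    have hgx : Measurable (g x) := hg.comp (measurable_const.prodMk measurable_id)
    calc ∫⁻ p, ∏ h ∈ insert i s, g (Function.update x i p) (Function.update x i p h) ∂μ
        = ∫⁻ p, g x p * ∏ h ∈ s, g x (x h) ∂μ := by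
          refine lintegral_congr fun p => ?_
          rw [Finset.prod_insert hi, hdep i (Finset.mem_insert_self i s), Function.update_self]
          congr 1
          refine Finset.prod_congr rfl fun h hh => ?_
          rw [Function.update_of_ne (by rintro rfl; exact hi hh)]
      _ = (∫⁻ p, g x p ∂μ) * ∏ h ∈ s, g x (x h) := lintegral_mul_const _ hgx
      _ ≤ ∏ h ∈ s, g x (x h) := mul_le_of_le_one_left' (h1 x)

theorem lintegral_prod_le_one {ι E : Type*} [DecidableEq ι] [Fintype ι] [MeasurableSpace E]
    (μ : Measure E) [IsProbabilityMeasure μ] (g : (ι → E) → E → ENNReal)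
    (hg : Measurable fun q : (ι → E) × E => g q.1 q.2) (h1 : ∀ x, ∫⁻ p, g x p ∂μ ≤ 1)
    (s : Finset ι) (hdep : ∀ i ∈ s, ∀ x p, g (Function.update x i p) = g x) :
    ∫⁻ x, ∏ h ∈ s, g x (x h) ∂Measure.pi (fun _ : ι => μ) ≤ 1 := by
  have hmeas : Measurable fun x : ι → E => ∏ h ∈ s, g x (x h) :=
    Finset.measurable_fun_prod s fun h _ => hg.comp (measurable_id.prodMk (measurable_pi_apply h))
  refine (lintegral_le_of_lmarginal_le (g := fun _ => 1) s hmeas measurable_const ?_).trans ?_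
  · refine (lmarginal_prod_le_one μ g hg h1 s hdep).trans fun x => ?_
    simp [lmarginal]
  · simp

theorem measure_pi_coord_eq {ι E : Type*} [DecidableEq ι] [Fintype ι] [MeasurableSpace E]
    [MeasurableSingletonClass E] [MeasurableEq E] (μ : Measure E) [SigmaFinite μ]
    [NullSingletonClass μ] {i j : ι} (hij : i ≠ j) : Measure.pi (fun _ : ι => μ) {x | x i = x j} = 0 := by
  have hm : MeasurableSet {x : ι → E | x i = x j} :=
    measurableSet_eq_fun (measurable_pi_apply i) (measurable_pi_apply j)
  rw [← lintegral_indicator_one hm, ← nonpos_iff_eq_zero]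
  refine (lintegral_le_of_lmarginal_le {i} (measurable_one.indicator hm)
    (g := fun _ => 0) measurable_const ?_).trans_eq lintegral_zero
  intro x
  rw [lmarginal_singleton]
  have : ∀ p, {x : ι → E | x i = x j}.indicator (1 : (ι → E) → ENNReal) (Function.update x i p)
      = ({x j} : Set E).indicator 1 p := by
    intro p
    have h : Function.update x i p ∈ {x : ι → E | x i = x j} ↔ p ∈ ({x j} : Set E) := by
      rw [mem_ofPred_eq, Function.update_self, Function.update_of_ne hij.symm, mem_singleton_iff]
    by_cases hp : p ∈ ({x j} : Set E)
    · rw [indicator_of_mem (h.2 hp), indicator_of_mem hp, Pi.one_apply, Pi.one_apply]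
    · rw [indicator_of_notMem (fun h' => hp (h.1 h')), indicator_of_notMem hp]
  simp only [this]
  rw [lintegral_indicator_one (measurableSet_singleton _), measure_singleton]
  exact zero_le

/-- For fixed indices of the frame and a fixed family of cells, the weights are unlikely to have a
large product. -/
theorem measure_prod_cellWeight_le {Γ : Set Pt} (hc : IsCompact Γ) (hconv : Convex ℝ Γ)
    (hi : (interior Γ).Nonempty) {m : ℕ} (hm : 2 ^ 19 ≤ m) {n : ℕ} (i j l : Fin n)
    {S : Finset (ℤ × ℤ)} (hS : S ∈ cellFamilies m) (k : ℕ) :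
    2 ^ (7 * k) * Measure.pi (fun _ : Fin n => unifOn Γ)
      {x | (x i ∈ Γ ∧ x j ∈ Γ ∧ x l ∈ Γ) ∧ planeDet (x j - x i) (x l - x i) ≠ 0 ∧
        (2 : ENNReal) ^ (7 * k) ≤
          2 ^ 27 * ∏ h ∈ Finset.univ \ {i, j, l}, cellWeight m S (x i) (x j) (x l) (x h)}
      ≤ 2 ^ 27 := by
  classical
  have := isProbabilityMeasure_unifOn hc hi
  set good : Set (Fin n → Pt) :=
    {x | (x i ∈ Γ ∧ x j ∈ Γ ∧ x l ∈ Γ) ∧ planeDet (x j - x i) (x l - x i) ≠ 0} with hgood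
  have hgoodm : MeasurableSet good := by
    have hΓ : MeasurableSet Γ := hc.isClosed.measurableSet
    have hdet : Measurable fun x : Fin n → Pt => planeDet (x j - x i) (x l - x i) := by
      unfold planeDet; fun_prop
    exact ((measurable_pi_apply i hΓ).inter
      ((measurable_pi_apply j hΓ).inter (measurable_pi_apply l hΓ))).inter
      (hdet (measurableSet_singleton 0).compl)
  set g : (Fin n → Pt) → Pt → ENNReal := fun x p =>
    if x ∈ good then cellWeight m S (x i) (x j) (x l) p else 0 with hg
  have hgm : Measurable fun q : (Fin n → Pt) × Pt => g q.1 q.2 := by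
    refine Measurable.ite (measurable_fst hgoodm) ?_ measurable_const
    exact .cellWeight m S (by fun_prop) (by fun_prop) (by fun_prop) measurable_snd
  have h1 : ∀ x, ∫⁻ p, g x p ∂unifOn Γ ≤ 1 := by
    intro x
    by_cases hx : x ∈ good
    · simp only [hg, hx, if_true]
      exact lintegral_cellWeight_le_one hc hconv hi hm hx.1.1 hx.1.2.1 hx.1.2.2 hx.2 hS
    · simp [hg, hx]
  have hdep : ∀ h ∈ Finset.univ \ {i, j, l}, ∀ x p, g (Function.update x h p) = g x := by
    intro h hh x p
    simp only [Finset.mem_sdiff, Finset.mem_insert, Finset.mem_singleton, not_or] at hh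
    obtain ⟨-, hhi, hhj, hhl⟩ := hh
    simp only [hg, hgood, Set.mem_ofPred_eq, Function.update_of_ne (Ne.symm hhi),
      Function.update_of_ne (Ne.symm hhj), Function.update_of_ne (Ne.symm hhl)]
  have hint := lintegral_prod_le_one (unifOn Γ) g hgm h1 _ hdep
  have hmeas : Measurable fun x : Fin n → Pt => 2 ^ 27 * ∏ h ∈ Finset.univ \ {i, j, l}, g x (x h) :=
    (Finset.measurable_fun_prod _ fun h _ =>
      hgm.comp (measurable_id.prodMk (measurable_pi_apply h))).const_mul _
  calc _ ≤ 2 ^ (7 * k) * Measure.pi (fun _ : Fin n => unifOn Γ)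
        {x | (2 : ENNReal) ^ (7 * k) ≤ 2 ^ 27 * ∏ h ∈ Finset.univ \ {i, j, l}, g x (x h)} := by
        refine mul_le_mul' le_rfl (measure_mono ?_)
        rintro x ⟨hx1, hx2, hx3⟩
        have hx : x ∈ good := ⟨hx1, hx2⟩
        simpa only [Set.mem_ofPred_eq, hg, hx, if_true] using hx3
    _ ≤ ∫⁻ x, 2 ^ 27 * ∏ h ∈ Finset.univ \ {i, j, l}, g x (x h) ∂Measure.pi fun _ => unifOn Γ :=
        mul_meas_ge_le_lintegral hmeas _
    _ = 2 ^ 27 * ∫⁻ x, ∏ h ∈ Finset.univ \ {i, j, l}, g x (x h) ∂Measure.pi fun _ => unifOn Γ :=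
        lintegral_const_mul' _ _ (by simp)
    _ ≤ 2 ^ 27 := mul_le_of_le_one_right' hint

/-- The points `x` for which some convex-position subset of size `k` has fewer than `k` further
points in the interior of its hull. -/
def sparseConfigurations (n k : ℕ) : Set (Fin n → Pt) :=
  {x | ∃ Y : Finset Pt, Y ⊆ Finset.image x Finset.univ ∧ Y.card = k ∧ ConvexPosition Y ∧
    (((Finset.image x Finset.univ \ Y : Finset Pt) : Set Pt) ∩
      interior (convexHull ℝ (Y : Set Pt))).ncard < k}

theorem measure_sparseConfigurations_le {Γ : Set Pt} (hc : IsCompact Γ) (hconv : Convex ℝ Γ)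
    (hi : (interior Γ).Nonempty) {m : ℕ} (hm : 2 ^ 19 ≤ m) (n : ℕ) {k : ℕ} (h3 : 3 ≤ k) :
    2 ^ (7 * k) * Measure.pi (fun _ : Fin n => unifOn Γ) (sparseConfigurations n k)
      ≤ (n : ENNReal) ^ 3 * ((cellFamilies m).card * 2 ^ 27) := by
  classical
  have := isProbabilityMeasure_unifOn hc hi
  have hatoms : NullSingletonClass (unifOn Γ) := ⟨fun p => by simp [unifOn]⟩
  set A : (Fin n × Fin n × Fin n) × Finset (ℤ × ℤ) → Set (Fin n → Pt) := fun q =>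
    {x | (x q.1.1 ∈ Γ ∧ x q.1.2.1 ∈ Γ ∧ x q.1.2.2 ∈ Γ) ∧
      planeDet (x q.1.2.1 - x q.1.1) (x q.1.2.2 - x q.1.1) ≠ 0 ∧ (2 : ENNReal) ^ (7 * k) ≤
        2 ^ 27 * ∏ h ∈ Finset.univ \ {q.1.1, q.1.2.1, q.1.2.2},
          cellWeight m q.2 (x q.1.1) (x q.1.2.1) (x q.1.2.2) (x h)} with hA
  have hmem : ∀ᵐ x ∂Measure.pi (fun _ : Fin n => unifOn Γ), ∀ i, x i ∈ Γ := by
    refine ae_all_iff.2 fun i => ?_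
    have : ∀ᵐ p ∂unifOn Γ, p ∈ Γ :=
      Measure.ae_smul_measure (ae_restrict_mem hc.isClosed.measurableSet) _
    exact (measurePreserving_eval (fun _ : Fin n => unifOn Γ) i).quasiMeasurePreserving.ae this
  have hinj : ∀ᵐ x ∂Measure.pi (fun _ : Fin n => unifOn Γ), Function.Injective x := by
    have : ∀ᵐ x ∂Measure.pi (fun _ : Fin n => unifOn Γ), ∀ i j, i ≠ j → x i ≠ x j := by
      refine ae_all_iff.2 fun i => ae_all_iff.2 fun j => ?_
      by_cases hij : i = j
      · simp [hij]
      · have h0 := measure_pi_coord_eq (unifOn Γ) hij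
        rw [← compl_compl {x : Fin n → Pt | x i = x j}] at h0
        filter_upwards [mem_ae_iff.2 h0] with x hx _ using hx
    filter_upwards [this] with x hx i j hij
    by_contra hne
    exact hx i j hne hij
  have hsub : ∀ᵐ x ∂Measure.pi (fun _ : Fin n => unifOn Γ), x ∈ sparseConfigurations n k →
      x ∈ ⋃ q ∈ (Finset.univ ×ˢ cellFamilies m), A q := by
    filter_upwards [hmem, hinj] with x hx1 hx2
    rintro ⟨Y, hYx, hYk, hY, hfew⟩
    obtain ⟨i, j, l, S, hS, hdet, hprod⟩ :=
      hY.exists_le_prod_cellWeight m hx2 hYx hYk h3 hfew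
    refine Set.mem_iUnion₂.2 ⟨((i, j, l), S), by simp [hS], ?_⟩
    exact ⟨⟨hx1 i, hx1 j, hx1 l⟩, hdet, hprod⟩
  calc _ ≤ 2 ^ (7 * k) * ∑ q ∈ Finset.univ ×ˢ cellFamilies m,
        Measure.pi (fun _ : Fin n => unifOn Γ) (A q) := by
        refine mul_le_mul' le_rfl ((measure_mono_ae hsub).trans (measure_biUnion_finset_le _ _))
    _ = ∑ q ∈ Finset.univ ×ˢ cellFamilies m,
        2 ^ (7 * k) * Measure.pi (fun _ : Fin n => unifOn Γ) (A q) := Finset.mul_sum _ _ _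
    _ ≤ ∑ q ∈ (Finset.univ : Finset (Fin n × Fin n × Fin n)) ×ˢ cellFamilies m, 2 ^ 27 := by
        refine Finset.sum_le_sum fun q hq => ?_
        exact measure_prod_cellWeight_le hc hconv hi hm q.1.1 q.1.2.1 q.1.2.2
          (Finset.mem_product.1 hq).2 k
    _ = (n : ENNReal) ^ 3 * ((cellFamilies m).card * 2 ^ 27) := by
        rw [Finset.sum_const, Finset.card_product, nsmul_eq_mul, Finset.card_univ,
          Fintype.card_prod, Fintype.card_prod, Fintype.card_fin]
        push_cast
        ring

theorem natCast_pow_three_le {n k : ℕ} (h : Real.log n ≤ k) : n ^ 3 ≤ 2 ^ (6 * k) := by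
  rcases Nat.eq_zero_or_pos n with rfl | hn
  · simp
  have hle : (n : ℝ) ≤ 4 ^ k := by
    calc (n : ℝ) = Real.exp (Real.log n) := (Real.exp_log (by exact_mod_cast hn)).symm
      _ ≤ Real.exp k := Real.exp_le_exp.2 h
      _ = Real.exp 1 ^ k := by rw [← Real.exp_nat_mul, mul_one]
      _ ≤ 4 ^ k := by
        gcongr
        linarith [Real.exp_one_lt_three]
  calc n ^ 3 ≤ (4 ^ k) ^ 3 := Nat.pow_le_pow_left (by exact_mod_cast hle) 3
    _ = 2 ^ (6 * k) := by
      rw [show (4 : ℕ) = 2 ^ 2 by norm_num, ← pow_mul, ← pow_mul]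
      ring_nf

/-- Theorem `convexunit`: for `n` i.i.d. uniform points in a compact convex
set with nonempty interior and `k(n) ≥ log n`, with probability tending to `1` every subset of
`k(n)` of the points that is in convex position contains at least `k(n)` of the other points in
the interior of its convex hull. -/
theorem random_convex_subsets_contain_points (Γ : Set Pt) (hΓc : IsCompact Γ)
    (hΓconv : Convex ℝ Γ) (hΓint : (interior Γ).Nonempty)
    (k : ℕ → ℕ) (hk : ∀ n : ℕ, Real.log n ≤ k n) :
    Tendsto (fun n : ℕ =>
      Measure.pi (fun _ : Fin n => unifOn Γ)
        {x : Fin n → Pt |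
          ∀ Y : Finset Pt, Y ⊆ Finset.image x Finset.univ → Y.card = k n →
            (∀ p ∈ Y, p ∈ Set.extremePoints ℝ (convexHull ℝ (Y : Set Pt))) →
            k n ≤ (((Finset.image x Finset.univ \ Y : Finset Pt) : Set Pt) ∩
              interior (convexHull ℝ (Y : Set Pt))).ncard})
      atTop (nhds 1) := by
  have := isProbabilityMeasure_unifOn hΓc hΓint
  have hktop : Tendsto k atTop atTop :=
    tendsto_natCast_atTop_iff.1 (tendsto_atTop_mono hk
      (Real.tendsto_log_atTop.comp tendsto_natCast_atTop_atTop) : Tendsto (fun n => (k n : ℝ)) _ _)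
  obtain ⟨m, hm⟩ : ∃ m : ℕ, 2 ^ 19 ≤ m := ⟨_, le_rfl⟩
  set C : ENNReal := (cellFamilies m).card * 2 ^ 27 with hC
  have hCtop : C ≠ ⊤ := ENNReal.mul_ne_top (ENNReal.natCast_ne_top _) (by simp)
  have hbad : ∀ᶠ n in atTop,
      Measure.pi (fun _ : Fin n => unifOn Γ) (sparseConfigurations n (k n)) ≤ C * 2⁻¹ ^ k n := by
    filter_upwards [hktop.eventually_ge_atTop 3] with n hn
    have h1 := measure_sparseConfigurations_le hΓc hΓconv hΓint hm n hn
    have h2 : (n : ENNReal) ^ 3 ≤ 2 ^ (6 * k n) := by exact_mod_cast natCast_pow_three_le (hk n)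
    have h3 := h1.trans (mul_le_mul' h2 le_rfl)
    rw [show 7 * k n = 6 * k n + k n by ring, pow_add, mul_assoc,
      ENNReal.mul_le_mul_iff_right (by simp) (by simp)] at h3
    rw [← ENNReal.inv_pow, ← div_eq_mul_inv, ENNReal.le_div_iff_mul_le (by simp) (by simp), mul_comm]
    exact h3
  have hlim : Tendsto (fun n => C * 2⁻¹ ^ k n) atTop (nhds 0) := by
    have h2 : Tendsto (fun j : ℕ => (2⁻¹ : ENNReal) ^ j) atTop (nhds 0) :=
      ENNReal.tendsto_pow_atTop_nhds_zero_of_lt_one (by simp)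
    simpa using ENNReal.Tendsto.const_mul (h2.comp hktop) (Or.inr hCtop)
  have hlim' : Tendsto (fun n => 1 - C * 2⁻¹ ^ k n) atTop (nhds 1) := by
    simpa using ENNReal.Tendsto.sub tendsto_const_nhds hlim (Or.inl ENNReal.one_ne_top)
  refine tendsto_of_tendsto_of_tendsto_of_le_of_le' hlim' tendsto_const_nhds ?_
    (Eventually.of_forall fun n => prob_le_one)
  filter_upwards [hbad] with n hn
  rw [tsub_le_iff_right, ← measure_univ (μ := Measure.pi fun _ : Fin n => unifOn Γ)]
  refine le_trans ?_ (add_le_add le_rfl hn)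
  refine (measure_mono fun x _ => ?_).trans (measure_union_le _ _)
  by_contra hx
  rw [Set.mem_union, not_or] at hx
  refine hx.1 fun Y hYx hYk hY => ?_
  by_contra! hfew
  exact hx.2 ⟨Y, hYx, hYk, hY, hfew⟩
end
end
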